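/- arXiv:0905.3253 — 6 statements merged into one kernel-verified Lean document; each statement's English description precedes it below -/
import Mathlib

section
/- Let k ≥ 1 and let x¹ = (x¹_1,…,x¹_{2k}) ∈ ℂ^{2k}, x² = (x²_1,…,x²_k) ∈ ℂ^k satisfy x¹_a ≠ x²_b for all 1 ≤ a ≤ 2k and 1 ≤ b ≤ k. Then Δ_{2k}(x¹) · Δ_k(x²)^4 / ∏_{a=1}^{2k} ∏_{b=1}^{k} (x¹_a − x²_b)^2 = (−1)^{k(k−1)/2} · det M, where M is the 2k×2k complex matrix whose entry in row a (1 ≤ a ≤ 2k) and column b equals 1/(x¹_a − x²_b) for 1 ≤ b ≤ k and equals 1/(x¹_a − x²_{b−k})^2 for k+1 ≤ b ≤ 2k. -/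
open Finset

/-- The Vandermonde determinant `Δ_n(x) = ∏_{a<b} (x_a - x_b)`. -/
noncomputable def vandermondeProd {n : ℕ} (x : Fin n → ℂ) : ℂ :=
  ∏ a : Fin n, ∏ b ∈ Finset.Ioi a, (x a - x b)

open Matrix Polynomial in
theorem vandermonde_mul_coeff {R : Type*} [CommRing R] {n : ℕ} (v : Fin n → R) (p : Fin n → R[X])
    (hp : ∀ j, (p j).natDegree < n) :
    vandermonde v * (of fun i j : Fin n => (p j).coeff i) = of fun i j => (p j).eval (v i) := by
  ext i j
  simp only [mul_apply, vandermonde_apply, of_apply]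
  rw [eval_eq_sum_range' (hp j), ← Fin.sum_univ_eq_sum_range (fun m => (p j).coeff m * v i ^ m)]
  exact Finset.sum_congr rfl fun _ _ => mul_comm _ _

open Matrix Polynomial in
theorem det_vandermonde_mul_det_eval {R : Type*} [CommRing R] {n : ℕ} (v w : Fin n → R)
    (p : Fin n → R[X]) (hp : ∀ j, (p j).natDegree < n) :
    det (vandermonde v) * det (of fun i j => (p j).eval (w i)) =
      det (vandermonde w) * det (of fun i j => (p j).eval (v i)) := by
  rw [← vandermonde_mul_coeff v p hp, ← vandermonde_mul_coeff w p hp, det_mul, det_mul]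
  ring

open Matrix Polynomial in
theorem det_prod_erase_sub {n : ℕ} (x z : Fin n → ℂ) (hz : Function.Injective z) :
    det (of fun a b => ∏ i ∈ univ.erase b, (x a - z i)) =
      det (vandermonde x) * vandermondeProd z := by
  have hV : det (vandermonde z) ≠ 0 := det_vandermonde_ne_zero_iff.2 hz
  have key := det_vandermonde_mul_det_eval z x
    (fun j => ∏ i ∈ univ.erase j, (X - C (z i))) (fun j => by
      rw [natDegree_prod_of_monic _ _ fun i _ => monic_X_sub_C (z i)]
      simp only [natDegree_X_sub_C, sum_const, smul_eq_mul, mul_one]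
      simpa using Finset.card_erase_lt_of_mem (mem_univ j))
  simp only [eval_prod, eval_sub, eval_X, eval_C] at key
  have hdiag : (of fun i j => ∏ l ∈ univ.erase j, (z i - z l) : Matrix (Fin n) (Fin n) ℂ) =
      diagonal fun j => ∏ l ∈ univ.erase j, (z j - z l) := by
    ext i j
    rcases eq_or_ne i j with rfl | hij
    · simp
    · rw [diagonal_apply_ne _ hij, of_apply]
      exact prod_eq_zero (mem_erase.2 ⟨hij, mem_univ i⟩) (sub_self _)
  have hoff : ∏ j, ∏ l ∈ univ.erase j, (z j - z l) =
      det (vandermonde z) * vandermondeProd z := by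
    rw [det_vandermonde, vandermondeProd, mul_comm, ← prod_mul_distrib]
    simp_rw [← prod_mul_distrib]
    rw [prod_prod_Ioi_mul_eq_prod_prod_off_diag (fun i j => z j - z i)]
    refine prod_congr rfl fun i _ => prod_congr ?_ fun _ _ => rfl
    ext; simp
  rw [hdiag, det_diagonal, hoff] at key
  refine mul_left_cancel₀ hV (key.trans ?_)
  ring

open Matrix in
/-- Cauchy's determinant. -/
theorem det_cauchy_mul_prod {n : ℕ} (x z : Fin n → ℂ) (hz : Function.Injective z)
    (hxz : ∀ a b, x a ≠ z b) :
    det (of fun a b => 1 / (x a - z b)) * ∏ a, ∏ b, (x a - z b) =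
      det (vandermonde x) * vandermondeProd z := by
  rw [← det_prod_erase_sub x z hz, mul_comm, ← det_mul_column]
  congr 1
  ext a b
  have h := sub_ne_zero.2 (hxz a b)
  rw [of_apply, of_apply, of_apply, ← mul_prod_erase univ _ (mem_univ b)]
  field_simp

theorem prod_prod_Ioi_neg {n : ℕ} (f : Fin n → Fin n → ℂ) :
    ∏ a, ∏ b ∈ Ioi a, -f a b = (-1) ^ (n * (n - 1) / 2) * ∏ a, ∏ b ∈ Ioi a, f a b := by
  simp_rw [prod_neg, prod_mul_distrib, prod_pow_eq_pow_sum, Fin.card_Ioi]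
  rw [Fin.sum_univ_eq_sum_range (fun i => n - 1 - i), sum_range_reflect (fun i => i),
    sum_range_id]

theorem det_vandermonde_eq_vandermondeProd {n : ℕ} (x : Fin n → ℂ) :
    (Matrix.vandermonde x).det = (-1) ^ (n * (n - 1) / 2) * vandermondeProd x := by
  rw [vandermondeProd, ← prod_prod_Ioi_neg, Matrix.det_vandermonde]
  simp

theorem vandermondeProd_append {m n : ℕ} (y : Fin m → ℂ) (w : Fin n → ℂ) :
    vandermondeProd (Fin.append y w) =
      vandermondeProd y * vandermondeProd w * ∏ a, ∏ b, (y a - w b) := by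
  have hL (a : Fin m) : Ioi (Fin.castAdd n a) =
      (Ioi a).map (Fin.castAddEmb n) ∪ univ.map (Fin.natAddEmb m) := by
    ext c
    refine Fin.addCases (fun c => ?_) (fun c => ?_) c
    · have h (q : Fin n) : m + (q : ℕ) ≠ c := by omega
      simp [Fin.ext_iff (n := m + n), h, Fin.val_inj]
      exact Iff.rfl
    · simp [Fin.lt_def, -Fin.val_fin_lt]
      omega
  have hR (a : Fin n) : Ioi (Fin.natAdd m a) = (Ioi a).map (Fin.natAddEmb m) := by
    ext c
    refine Fin.addCases (fun c => ?_) (fun c => ?_) c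
    · simp
    · simp
  have hd (a : Fin m) : Disjoint ((Ioi a).map (Fin.castAddEmb n)) (univ.map (Fin.natAddEmb m)) := by
    rw [disjoint_left]
    intro c hc hc'
    simp only [mem_map, mem_univ, true_and] at hc hc'
    obtain ⟨p, -, rfl⟩ := hc
    obtain ⟨q, hq⟩ := hc'
    have := congrArg Fin.val hq
    simp at this
    omega
  simp only [vandermondeProd, Fin.prod_univ_add, hL, hR, prod_union (hd _), prod_map,
    Fin.castAddEmb_apply, Fin.natAddEmb_apply, Fin.append_left, Fin.append_right,
    prod_mul_distrib]
  ring

theorem prod_prod_erase_sub {n : ℕ} (y : Fin n → ℂ) :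
    ∏ a, ∏ b ∈ univ.erase a, (y a - y b) =
      (-1) ^ (n * (n - 1) / 2) * vandermondeProd y ^ 2 := by
  rw [vandermondeProd, sq, ← mul_assoc, ← prod_prod_Ioi_neg, mul_comm, ← prod_mul_distrib]
  simp_rw [← prod_mul_distrib, neg_sub]
  rw [prod_prod_Ioi_mul_eq_prod_prod_off_diag (fun i j => y j - y i)]
  refine prod_congr rfl fun i _ => prod_congr ?_ fun _ _ => rfl
  ext; simp

theorem vandermondeProd_add_const {n : ℕ} (y : Fin n → ℂ) (ε : ℂ) :
    vandermondeProd (fun b => y b + ε) = vandermondeProd y := by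
  simp [vandermondeProd]

/-- The Cauchy matrix with nodes `y`, next to its divided differences with step `ε`. -/
noncomputable def dividedCauchy {k : ℕ} (x : Fin (k + k) → ℂ) (y : Fin k → ℂ) (ε : ℂ) :
    Matrix (Fin (k + k)) (Fin (k + k)) ℂ :=
  Matrix.of fun a => Fin.append (fun b => 1 / (x a - y b))
    fun b => 1 / ((x a - y b) * (x a - (y b + ε)))

open Matrix in
theorem det_cauchy_append {k : ℕ} (x : Fin (k + k) → ℂ) (y : Fin k → ℂ) (ε : ℂ)
    (h0 : ∀ a b, x a ≠ y b) (hε : ∀ a b, x a ≠ y b + ε) :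
    det (of fun a b => 1 / (x a - Fin.append y (fun b => y b + ε) b)) =
      ε ^ k * det (dividedCauchy x y ε) := by
  have h : (of fun a b => 1 / (x a - Fin.append y (fun b => y b + ε) b)) =
      dividedCauchy x y ε * (fromBlocks (1 : Matrix (Fin k) (Fin k) ℂ) 1 0
        (ε • 1)).submatrix finSumFinEquiv.symm finSumFinEquiv.symm := by
    ext a b
    refine Fin.addCases (fun b => ?_) (fun b => ?_) b
    · simp [mul_apply, Fin.sum_univ_add, dividedCauchy, one_apply, -Fin.natAdd_eq_addNat]
    · have h1 := sub_ne_zero.2 (h0 a b)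
      have h2 := sub_ne_zero.2 (hε a b)
      simp [mul_apply, Fin.sum_univ_add, dividedCauchy, one_apply, -Fin.natAdd_eq_addNat]
      field_simp
      ring
  rw [h, det_mul, det_submatrix_equiv_self, det_fromBlocks_zero₂₁, det_smul]
  simp [mul_comm]

theorem det_dividedCauchy_mul_prod {k : ℕ} (x : Fin (k + k) → ℂ) (y : Fin k → ℂ) {ε : ℂ}
    (hy : Function.Injective y) (ε0 : ε ≠ 0) (hyε : ∀ a b, y a ≠ y b + ε)
    (h0 : ∀ a b, x a ≠ y b) (hε : ∀ a b, x a ≠ y b + ε) :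
    (dividedCauchy x y ε).det * ∏ a, ∏ b, ((x a - y b) * (x a - (y b + ε))) =
      vandermondeProd x * vandermondeProd y ^ 2 *
        ∏ a, ∏ b ∈ univ.erase a, (y a - (y b + ε)) := by
  have hz : Function.Injective (Fin.append y fun b => y b + ε) := by
    rw [Fin.append_injective_iff]
    exact ⟨hy, fun a b h => hy (add_right_cancel h), hyε⟩
  have key := det_cauchy_mul_prod x _ hz fun a b => by
    refine Fin.addCases (fun b => ?_) (fun b => ?_) b
    · simpa using h0 a b
    · simpa [-Fin.natAdd_eq_addNat] using hε a b
  have hsplit (a : Fin (k + k)) : ∏ b, (x a - Fin.append y (fun b => y b + ε) b) =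
      ∏ b, ((x a - y b) * (x a - (y b + ε))) := by
    simp only [Fin.prod_univ_add, Fin.append_left, Fin.append_right, prod_mul_distrib]
  simp only [hsplit] at key
  rw [det_cauchy_append x y ε h0 hε, vandermondeProd_append, vandermondeProd_add_const,
    det_vandermonde_eq_vandermondeProd] at key
  have hdiag : ∏ a, ∏ b, (y a - (y b + ε)) =
      (-1) ^ k * ε ^ k * ∏ a, ∏ b ∈ univ.erase a, (y a - (y b + ε)) := by
    have (a : Fin k) : ∏ b, (y a - (y b + ε)) =
        -1 * ε * ∏ b ∈ univ.erase a, (y a - (y b + ε)) := by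
      rw [← mul_prod_erase univ _ (mem_univ a)]
      ring
    simp_rw [this, prod_mul_distrib]
    simp
  have hsign : (-1 : ℂ) ^ ((k + k) * (k + k - 1) / 2) * (-1) ^ k = 1 := by
    rw [← two_mul, mul_assoc, Nat.mul_div_cancel_left _ two_pos, ← pow_add]
    refine Even.neg_one_pow ⟨k * k, ?_⟩
    cases k with
    | zero => rfl
    | succ n =>
      rw [show 2 * (n + 1) - 1 = 2 * n + 1 by omega]
      ring
  rw [hdiag] at key
  refine mul_left_cancel₀ (pow_ne_zero k ε0) ?_
  rw [← mul_assoc, key]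
  linear_combination (ε ^ k * vandermondeProd x * vandermondeProd y ^ 2 *
    ∏ a, ∏ b ∈ univ.erase a, (y a - (y b + ε))) * hsign

open Filter Topology in
theorem det_dividedCauchy_zero_mul_prod {k : ℕ} (x : Fin (k + k) → ℂ) (y : Fin k → ℂ)
    (hy : Function.Injective y) (h0 : ∀ a b, x a ≠ y b) :
    (dividedCauchy x y 0).det * ∏ a, ∏ b, (x a - y b) ^ 2 =
      (-1) ^ (k * (k - 1) / 2) * (vandermondeProd x * vandermondeProd y ^ 4) := by
  have hne (u v : ℂ) : ∀ᶠ ε in 𝓝[≠] (0 : ℂ), u ≠ v + ε := by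
    rcases eq_or_ne u v with rfl | huv
    · filter_upwards [self_mem_nhdsWithin] with ε hε h
      exact hε (by simpa using h)
    · have : Tendsto (fun ε : ℂ => v + ε) (𝓝[≠] 0) (𝓝 v) := by
        refine Tendsto.mono_left ?_ nhdsWithin_le_nhds
        exact Continuous.tendsto' (by fun_prop) _ _ (by simp)
      exact (this.eventually_ne huv.symm).mono fun _ h => h.symm
  have hev : ∀ᶠ ε in 𝓝[≠] (0 : ℂ),
      (dividedCauchy x y ε).det * ∏ a, ∏ b, ((x a - y b) * (x a - (y b + ε))) =
        vandermondeProd x * vandermondeProd y ^ 2 *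
          ∏ a, ∏ b ∈ univ.erase a, (y a - (y b + ε)) := by
    filter_upwards [self_mem_nhdsWithin,
      eventually_all.2 fun a => eventually_all.2 fun b => hne (y a) (y b),
      eventually_all.2 fun a => eventually_all.2 fun b => hne (x a) (y b)] with ε ε0 hyε hε
    exact det_dividedCauchy_mul_prod x y hy ε0 hyε h0 hε
  have hdet : ContinuousAt (fun ε => (dividedCauchy x y ε).det) 0 := by
    refine ContinuousAt.comp (f := dividedCauchy x y)
      (continuous_id.matrix_det).continuousAt ?_
    refine continuousAt_pi.2 fun a => continuousAt_pi.2 fun b => ?_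
    refine Fin.addCases (fun b => ?_) (fun b => ?_) b
    · simpa [dividedCauchy] using continuousAt_const
    · simp only [dividedCauchy, Matrix.of_apply, Fin.append_right]
      refine ContinuousAt.div (by fun_prop) (by fun_prop) ?_
      have := sub_ne_zero.2 (h0 a b)
      simpa using this
  have hl : ContinuousAt (fun ε => (dividedCauchy x y ε).det *
      ∏ a, ∏ b, ((x a - y b) * (x a - (y b + ε)))) 0 := hdet.mul (by fun_prop)
  have hr : ContinuousAt (fun ε : ℂ => vandermondeProd x * vandermondeProd y ^ 2 *
      ∏ a, ∏ b ∈ univ.erase a, (y a - (y b + ε))) 0 := by fun_prop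
  have h := tendsto_nhds_unique_of_eventuallyEq (hl.tendsto.mono_left nhdsWithin_le_nhds)
    (hr.tendsto.mono_left nhdsWithin_le_nhds) hev
  simp only [add_zero, ← sq] at h
  rw [h, prod_prod_erase_sub]
  ring

theorem vandermondeProd_eq_zero {n : ℕ} (y : Fin n → ℂ) (hy : ¬ Function.Injective y) :
    vandermondeProd y = 0 := by
  have h := det_vandermonde_eq_vandermondeProd y
  rw [not_not.1 (mt Matrix.det_vandermonde_ne_zero_iff.1 hy)] at h
  simpa using h.symm

theorem det_dividedCauchy_eq_zero {k : ℕ} (x : Fin (k + k) → ℂ) (y : Fin k → ℂ) (ε : ℂ)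
    (hy : ¬ Function.Injective y) : (dividedCauchy x y ε).det = 0 := by
  simp only [Function.Injective, not_forall] at hy
  obtain ⟨i, j, hij, hne⟩ := hy
  refine Matrix.det_zero_of_column_eq (i := Fin.castAdd k i) (j := Fin.castAdd k j)
    (by simpa using hne) fun a => ?_
  simp [dividedCauchy, hij]

theorem vandermondeProd_div_eq_det {k n : ℕ} (hn : n = 2 * k) (x1 : Fin n → ℂ) (x2 : Fin k → ℂ)
    (hx : ∀ a b, x1 a ≠ x2 b) :
    vandermondeProd x1 * (vandermondeProd x2) ^ 4 / ∏ a, ∏ b, (x1 a - x2 b) ^ 2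
      = (-1 : ℂ) ^ (k * (k - 1) / 2) *
        Matrix.det (Matrix.of fun a b : Fin n =>
          if h : (b : ℕ) < k then 1 / (x1 a - x2 ⟨b, h⟩)
          else 1 / (x1 a - x2 ⟨(b : ℕ) - k, by omega⟩) ^ 2) := by
  obtain rfl : n = k + k := by omega
  have hM : (Matrix.of fun a b : Fin (k + k) =>
      if h : (b : ℕ) < k then 1 / (x1 a - x2 ⟨b, h⟩)
      else 1 / (x1 a - x2 ⟨(b : ℕ) - k, by omega⟩) ^ 2) = dividedCauchy x1 x2 0 := by
    ext a b
    refine Fin.addCases (fun b => ?_) (fun b => ?_) b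
    · simp [dividedCauchy]
    · simp [dividedCauchy, sq, -Fin.natAdd_eq_addNat]
  rw [hM]
  by_cases hy : Function.Injective x2
  · have hP : ∏ a, ∏ b, (x1 a - x2 b) ^ 2 ≠ 0 :=
      prod_ne_zero_iff.2 fun a _ => prod_ne_zero_iff.2 fun b _ =>
        pow_ne_zero 2 (sub_ne_zero.2 (hx a b))
    rw [div_eq_iff hP, mul_assoc, det_dividedCauchy_zero_mul_prod x1 x2 hy hx, ← mul_assoc,
      ← mul_pow]
    simp
  · rw [vandermondeProd_eq_zero x2 hy, det_dividedCauchy_eq_zero x1 x2 0 hy]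
    simp

/-- Determinantal structure of the Berezinian of UOSp(2k/2k). -/
theorem berezinian_det_structure (k : ℕ) (hk : 1 ≤ k)
    (x1 : Fin (2 * k) → ℂ) (x2 : Fin k → ℂ)
    (hx : ∀ (a : Fin (2 * k)) (b : Fin k), x1 a ≠ x2 b) :
    vandermondeProd x1 * (vandermondeProd x2) ^ 4 /
        ∏ a : Fin (2 * k), ∏ b : Fin k, (x1 a - x2 b) ^ 2
      = (-1 : ℂ) ^ (k * (k - 1) / 2) *
        Matrix.det (Matrix.of fun a b : Fin (2 * k) =>
          if h : (b : ℕ) < k then 1 / (x1 a - x2 ⟨b, h⟩)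
          else 1 / (x1 a - x2 ⟨(b : ℕ) - k, by omega⟩) ^ 2) := by
  exact vandermondeProd_div_eq_det rfl x1 x2 hx
end

section
/- For every n ≥ 1, applying the differential operator ∏_{j=1}^{n} ∂^{n−1}/∂x_j^{n−1} (i.e. the (n−1)-st partial derivative in each of the n variables) to the polynomial Δ_n(x)^2 yields the constant polynomial (−1)^{n(n−1)/2} · n! · ((n−1)!)^n. -/
open Finset MvPolynomial

/-- The Vandermonde determinant `Δ_n(x) = ∏_{a<b} (x_a - x_b)` as a multivariate polynomial. -/
noncomputable def vandermondePoly (n : ℕ) : MvPolynomial (Fin n) ℂ :=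
  ∏ a : Fin n, ∏ b ∈ Finset.Ioi a, (X a - X b)

theorem iterate_pderiv_monomial {σ R : Type*} [CommSemiring R] (i : σ) (k : ℕ)
    (s : σ →₀ ℕ) (a : R) :
    (⇑(pderiv i))^[k] (monomial s a)
      = monomial (s - Finsupp.single i k) (a * ((s i).descFactorial k : R)) := by
  induction k with
  | zero => simp
  | succ k ih =>
    rw [Function.iterate_succ_apply', ih, pderiv_monomial, tsub_tsub, ← Finsupp.single_add,
      Nat.descFactorial_succ, Finsupp.tsub_apply, Finsupp.single_eq_same]
    push_cast
    ring_nf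

theorem foldr_iterate_pderiv_monomial {σ R : Type*} [CommSemiring R] (k : ℕ) (l : List σ)
    (hl : l.Nodup) (s : σ →₀ ℕ) (a : R) :
    l.foldr (fun j p => (⇑(pderiv j))^[k] p) (monomial s a)
      = monomial (s - (l.map fun j => Finsupp.single j k).sum)
          (a * (l.map fun j => ((s j).descFactorial k : R)).prod) := by
  induction l with
  | nil => simp
  | cons j l ih =>
    obtain ⟨hj, hl⟩ := List.nodup_cons.mp hl
    have hsum : ((l.map fun i => Finsupp.single i k).sum : σ →₀ ℕ) j = 0 := by
      rw [← Finsupp.applyAddHom_apply, map_list_sum, List.map_map]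
      refine List.sum_eq_zero fun x hx => ?_
      obtain ⟨i, hi, rfl⟩ := List.mem_map.mp hx
      have hne : i ≠ j := fun h => hj (h ▸ hi)
      simp [hne]
    rw [List.foldr_cons, ih hl, iterate_pderiv_monomial, Finsupp.tsub_apply, hsum, tsub_zero,
      tsub_tsub, List.map_cons, List.sum_cons, List.map_cons, List.prod_cons, mul_assoc,
      add_comm (Finsupp.single j k), mul_comm (List.prod _)]

/-- The composition of the `k`-th partial derivatives in the variables of `l`, as a linear map. -/
noncomputable def mixedPDeriv {σ : Type*} (R : Type*) [CommSemiring R] (k : ℕ) (l : List σ) :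
    MvPolynomial σ R →ₗ[R] MvPolynomial σ R :=
  (l.map fun j => (pderiv j : Derivation R _ _).toLinearMap ^ k).prod

theorem mixedPDeriv_apply {σ R : Type*} [CommSemiring R] (k : ℕ) (l : List σ)
    (p : MvPolynomial σ R) :
    mixedPDeriv R k l p = l.foldr (fun j p => (⇑(pderiv j))^[k] p) p := by
  induction l with
  | nil => simp [mixedPDeriv]
  | cons j l ih =>
    rw [List.foldr_cons, ← ih, mixedPDeriv, List.map_cons, List.prod_cons, Module.End.mul_apply,
      Module.End.pow_apply]
    rfl

theorem mixedPDeriv_finRange_prod_X_pow {R : Type*} [CommSemiring R] {n : ℕ} (k : ℕ)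
    (e : Fin n → ℕ) :
    mixedPDeriv R k (List.finRange n) (∏ i, X i ^ e i)
      = monomial (Finsupp.equivFunOnFinite.symm fun i => e i - k)
          (∏ i, ((e i).descFactorial k : R)) := by
  have hX : (∏ i, X i ^ e i : MvPolynomial (Fin n) R)
      = monomial (Finsupp.equivFunOnFinite.symm e) 1 := by
    rw [monomial_eq, C_1, one_mul, Finsupp.prod_fintype _ _ fun i => pow_zero _]
    rfl
  rw [mixedPDeriv_apply, hX, foldr_iterate_pderiv_monomial _ _ (List.nodup_finRange n), one_mul,
    ← List.ofFn_eq_map, ← List.ofFn_eq_map, List.sum_ofFn, List.prod_ofFn]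
  congr 2
  ext i
  simp [Finsupp.single_apply]

theorem sign_finRevPerm (n : ℕ) :
    Equiv.Perm.sign (Fin.revPerm : Equiv.Perm (Fin n)) = (-1) ^ (n * (n - 1) / 2) := by
  have h (j : Fin n) : ∏ i ∈ Finset.Iio j,
      (if Fin.revPerm i < Fin.revPerm j then (1 : ℤˣ) else -1) = (-1) ^ (j : ℕ) := by
    rw [Finset.prod_congr rfl fun i hi => if_neg ?_, Finset.prod_const, Fin.card_Iio]
    simpa using (Finset.mem_Iio.mp hi).le
  rw [Equiv.Perm.sign_eq_prod_prod_Iio, Finset.prod_congr rfl fun j _ => h j,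
    Finset.prod_pow_eq_pow_sum, Fin.sum_univ_eq_sum_range fun i => i, Finset.sum_range_id]

theorem eq_finRevPerm_mul {n : ℕ} {σ τ : Equiv.Perm (Fin n)}
    (h : ∀ i, n - 1 ≤ (σ i : ℕ) + τ i) : τ = Fin.revPerm * σ := by
  have hle : ∀ i ∈ (Finset.univ : Finset (Fin n)),
      ((Fin.revPerm * σ : Equiv.Perm (Fin n)) i : ℕ) ≤ τ i := fun i _ => by
    have := h i
    simp only [Equiv.Perm.mul_apply, Fin.revPerm_apply, Fin.val_rev]
    omega
  have hsum := (Finset.sum_eq_sum_iff_of_le hle).mp <|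
    (Equiv.sum_comp (Fin.revPerm * σ) fun i : Fin n => (i : ℕ)).trans
      (Equiv.sum_comp τ fun i : Fin n => (i : ℕ)).symm
  exact Equiv.ext fun i => Fin.ext (hsum i (Finset.mem_univ i)).symm

theorem vandermondePoly_sq (n : ℕ) :
    vandermondePoly n ^ 2
      = ∑ σ : Equiv.Perm (Fin n), ∑ τ : Equiv.Perm (Fin n),
          ((Equiv.Perm.sign σ : ℤ) * (Equiv.Perm.sign τ : ℤ) : ℂ) •
            ∏ i, X i ^ ((σ i : ℕ) + τ i) := by
  have hdet : vandermondePoly n ^ 2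
      = (Matrix.vandermonde (X : Fin n → MvPolynomial (Fin n) ℂ)).det ^ 2 := by
    simp only [vandermondePoly, Matrix.det_vandermonde, ← Finset.prod_pow]
    exact Finset.prod_congr rfl fun a _ => Finset.prod_congr rfl fun b _ => by ring
  rw [hdet, sq, ← Matrix.det_transpose, Matrix.det_apply', Finset.sum_mul_sum]
  refine Finset.sum_congr rfl fun σ _ => Finset.sum_congr rfl fun τ _ => ?_
  simp only [Matrix.transpose_apply, Matrix.vandermonde_apply, pow_add, Finset.prod_mul_distrib,
    smul_eq_C_mul, map_mul, map_intCast]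
  ring

/-- Eq. (4.17) of the paper: applying `∏_j ∂^{n-1}/∂x_j^{n-1}` to `Δ_n(x)^2` yields the
constant `(-1)^{n(n-1)/2} n! ((n-1)!)^n`. -/
theorem deriv_vandermonde_sq (n : ℕ) (hn : 1 ≤ n) :
    (List.finRange n).foldr (fun j p => (⇑(pderiv j))^[n - 1] p) ((vandermondePoly n) ^ 2)
      = C ((-1 : ℂ) ^ (n * (n - 1) / 2) * (n.factorial : ℂ) * ((n - 1).factorial : ℂ) ^ n) := by
  have hterm (σ : Equiv.Perm (Fin n)) :
      ∑ τ : Equiv.Perm (Fin n), ((Equiv.Perm.sign σ : ℤ) * (Equiv.Perm.sign τ : ℤ) : ℂ) •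
          mixedPDeriv ℂ (n - 1) (List.finRange n) (∏ i, X i ^ ((σ i : ℕ) + τ i))
        = C ((-1 : ℂ) ^ (n * (n - 1) / 2) * ((n - 1).factorial : ℂ) ^ n) := by
    rw [Finset.sum_eq_single (Fin.revPerm * σ) _ fun h => absurd (Finset.mem_univ _) h]
    · have hexp (i : Fin n) : (σ i : ℕ) + (Fin.revPerm * σ : Equiv.Perm (Fin n)) i = n - 1 := by
        simp only [Equiv.Perm.mul_apply, Fin.revPerm_apply, Fin.val_rev]
        omega
      have hsign : ((Equiv.Perm.sign σ : ℤ) * (Equiv.Perm.sign (Fin.revPerm * σ) : ℤ) : ℂ)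
          = (-1) ^ (n * (n - 1) / 2) := by
        rw [Equiv.Perm.sign_mul, sign_finRevPerm, ← Int.cast_mul, ← Units.val_mul,
          mul_left_comm, Int.units_mul_self, mul_one]
        simp
      have hzero : (Finsupp.equivFunOnFinite.symm fun _ : Fin n => 0) = (0 : Fin n →₀ ℕ) := by
        ext; rfl
      simp only [mixedPDeriv_finRange_prod_X_pow, hexp, hsign, Nat.descFactorial_self, tsub_self,
        Finset.prod_const, Finset.card_univ, Fintype.card_fin, hzero, smul_monomial, smul_eq_mul]
      rfl
    · intro τ _ hτ
      obtain ⟨i, hi⟩ : ∃ i, (σ i : ℕ) + τ i < n - 1 := by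
        by_contra! h
        exact hτ (eq_finRevPerm_mul h)
      rw [mixedPDeriv_finRange_prod_X_pow, Finset.prod_eq_zero (Finset.mem_univ i),
        monomial_zero, smul_zero]
      rw [Nat.descFactorial_of_lt hi, Nat.cast_zero]
  rw [← mixedPDeriv_apply, vandermondePoly_sq]
  simp only [map_sum, map_smul, hterm]
  rw [Finset.sum_const, Finset.card_univ, Fintype.card_perm, Fintype.card_fin, ← map_nsmul,
    nsmul_eq_mul]
  congr 1
  ring
end

section
/- Let Λ be the exterior algebra of a finite-dimensional complex vector space, with its natural ℤ/2 grading into an even part Λ₀ and an odd part Λ₁. Let a, b, c ≥ 0, let W₁ be a c×(a+b) matrix whose first a columns have entries in Λ₀ and whose last b columns have entries in Λ₁, and let W₂ be an (a+b)×c matrix whose first a rows have entries in Λ₀ and whose last b rows have entries in Λ₁. Then for every m ≥ 1, tr((W₁W₂)^m) = Str((W₂W₁)^m), where W₁W₂ is a c×c matrix with entries in Λ₀ and tr is its ordinary trace, and the supertrace of the (a+b)×(a+b) matrix (W₂W₁)^m is taken with respect to block sizes (a,b). -/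
open Finset

/-- The supertrace of a square block supermatrix `M = [[P, Q],[R, S]]` with respect to the
block decomposition `α ⊕ β`: `Str M = tr P - tr S`. -/
noncomputable def supertrace {R : Type*} [Ring R] {α β : Type*} [Fintype α] [Fintype β]
    (M : Matrix (α ⊕ β) (α ⊕ β) R) : R :=
  (∑ i : α, M (Sum.inl i) (Sum.inl i)) - ∑ j : β, M (Sum.inr j) (Sum.inr j)

open CliffordAlgebra in
/-- In the exterior algebra, moving a vector past an element applies the grade involution. -/
theorem ExteriorAlgebra.mul_ι_eq_ι_mul_involute {R V : Type*} [CommRing R] [AddCommGroup V]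
    [Module R V] (x : ExteriorAlgebra R V) (v : V) :
    x * CliffordAlgebra.ι (0 : QuadraticForm R V) v =
      CliffordAlgebra.ι (0 : QuadraticForm R V) v * involute x := by
  induction x using ExteriorAlgebra.induction with
  | algebraMap r => rw [AlgHom.commutes, Algebra.commutes]
  | ι w =>
    rw [involute_ι, mul_neg, eq_neg_iff_add_eq_zero]
    simp
  | mul x y hx hy => rw [mul_assoc, hy, ← mul_assoc, hx, mul_assoc, map_mul]
  | add x y hx hy => rw [add_mul, hx, hy, map_add, mul_add]

open CliffordAlgebra in
/-- Even elements of the exterior algebra are central. -/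
theorem ExteriorAlgebra.mul_comm_of_mem_evenOdd_zero {R V : Type*} [CommRing R] [AddCommGroup V]
    [Module R V] {x : ExteriorAlgebra R V} (hx : x ∈ evenOdd (0 : QuadraticForm R V) 0)
    (y : ExteriorAlgebra R V) : x * y = y * x := by
  induction y using ExteriorAlgebra.induction with
  | algebraMap r => rw [Algebra.commutes]
  | ι w => rw [mul_ι_eq_ι_mul_involute, involute_eq_of_mem_even hx]
  | mul y z hy hz => rw [← mul_assoc, hy, mul_assoc, hz, mul_assoc]
  | add y z hy hz => rw [add_mul, mul_add, hy, hz]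

open CliffordAlgebra in
/-- Moving an odd element past an arbitrary one applies the grade involution to the latter. -/
theorem ExteriorAlgebra.mul_eq_involute_mul_of_mem_evenOdd_one {R V : Type*} [CommRing R]
    [AddCommGroup V] [Module R V] {x : ExteriorAlgebra R V}
    (hx : x ∈ evenOdd (0 : QuadraticForm R V) 1) (y : ExteriorAlgebra R V) :
    x * y = involute (Q := (0 : QuadraticForm R V)) y * x := by
  induction y using ExteriorAlgebra.induction with
  | algebraMap r => rw [AlgHom.commutes, Algebra.commutes]
  | ι w => rw [mul_ι_eq_ι_mul_involute, involute_eq_of_mem_odd hx, involute_ι, mul_neg, neg_mul]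
  | mul y z hy hz => rw [← mul_assoc, hy, mul_assoc, hz, map_mul, mul_assoc]
  | add y z hy hz => rw [mul_add, hy, hz, map_add, add_mul]

/-- Odd elements of the exterior algebra anticommute. -/
theorem ExteriorAlgebra.mul_eq_neg_mul_of_mem_evenOdd_one {R V : Type*} [CommRing R]
    [AddCommGroup V] [Module R V] {x y : ExteriorAlgebra R V}
    (hx : x ∈ CliffordAlgebra.evenOdd (0 : QuadraticForm R V) 1)
    (hy : y ∈ CliffordAlgebra.evenOdd (0 : QuadraticForm R V) 1) : x * y = -(y * x) := by
  rw [mul_eq_involute_mul_of_mem_evenOdd_one hx, CliffordAlgebra.involute_eq_of_mem_odd hy,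
    neg_mul]

/-- If the entries of `A` and `B` commute in the first block and anticommute in the second,
then the trace of `A * B` is the supertrace of `B * A`. -/
theorem trace_mul_eq_supertrace_mul {R α β γ : Type*} [Ring R] [Fintype α] [Fintype β] [Fintype γ]
    (A : Matrix γ (α ⊕ β) R) (B : Matrix (α ⊕ β) γ R)
    (hl : ∀ i j, A i (Sum.inl j) * B (Sum.inl j) i = B (Sum.inl j) i * A i (Sum.inl j))
    (hr : ∀ i j, A i (Sum.inr j) * B (Sum.inr j) i = -(B (Sum.inr j) i * A i (Sum.inr j))) :
    Matrix.trace (A * B) = supertrace (B * A) := by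
  rw [supertrace, sub_eq_add_neg]
  simp only [Matrix.trace, Matrix.diag_apply, Matrix.mul_apply, Fintype.sum_sum_type,
    hl, hr, Finset.sum_add_distrib, Finset.sum_neg_distrib]
  congr 1
  · exact Finset.sum_comm
  · exact congrArg Neg.neg Finset.sum_comm

/-- A product of matrices with homogeneous entries has homogeneous entries. -/
theorem Matrix.mul_apply_mem_graded {ι R S l m n : Type*} [AddMonoid ι] [Semiring R]
    [SetLike S R] [AddSubmonoidClass S R] (𝒜 : ι → S) [SetLike.GradedMul 𝒜] [Fintype m]
    {A : Matrix l m R} {B : Matrix m n R} {e : ι} {p q : m → ι} {i : l} {k : n}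
    (hA : ∀ j, A i j ∈ 𝒜 (p j)) (hB : ∀ j, B j k ∈ 𝒜 (q j)) (h : ∀ j, p j + q j = e) :
    (A * B) i k ∈ 𝒜 e := by
  rw [Matrix.mul_apply]
  exact sum_mem fun j _ => h j ▸ SetLike.GradedMul.mul_mem (hA j) (hB j)

/-- The duality relation `tr (W₁W₂)^m = Str (W₂W₁)^m` between ordinary and superspace
(Eqs. (3.22) and (A.2) of the paper), over the exterior algebra of a finite-dimensional
complex vector space with its natural ℤ/2 grading (even part `evenOdd 0`, odd part
`evenOdd 1`). -/
theorem trace_pow_eq_supertrace_pow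
    (V : Type) [AddCommGroup V] [Module ℂ V] [FiniteDimensional ℂ V]
    (a b c : ℕ)
    (W₁ : Matrix (Fin c) (Fin a ⊕ Fin b) (ExteriorAlgebra ℂ V))
    (W₂ : Matrix (Fin a ⊕ Fin b) (Fin c) (ExteriorAlgebra ℂ V))
    (h₁l : ∀ i j, W₁ i (Sum.inl j) ∈ CliffordAlgebra.evenOdd (0 : QuadraticForm ℂ V) 0)
    (h₁r : ∀ i j, W₁ i (Sum.inr j) ∈ CliffordAlgebra.evenOdd (0 : QuadraticForm ℂ V) 1)
    (h₂l : ∀ i j, W₂ (Sum.inl i) j ∈ CliffordAlgebra.evenOdd (0 : QuadraticForm ℂ V) 0)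
    (h₂r : ∀ i j, W₂ (Sum.inr i) j ∈ CliffordAlgebra.evenOdd (0 : QuadraticForm ℂ V) 1)
    (m : ℕ) (hm : 1 ≤ m) :
    Matrix.trace ((W₁ * W₂) ^ m) = supertrace ((W₂ * W₁) ^ m) := by
  let parity : Fin a ⊕ Fin b → ZMod 2 := Sum.elim (fun _ => 0) (fun _ => 1)
  have h₁ : ∀ i s, W₁ i s ∈ CliffordAlgebra.evenOdd (0 : QuadraticForm ℂ V) (parity s) := by
    rintro i (j | j)
    exacts [h₁l i j, h₁r i j]
  have h₂ : ∀ s i, W₂ s i ∈ CliffordAlgebra.evenOdd (0 : QuadraticForm ℂ V) (parity s) := by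
    rintro (j | j) i
    exacts [h₂l j i, h₂r j i]
  have h₁₂ : ∀ i j, (W₁ * W₂) i j ∈ CliffordAlgebra.evenOdd (0 : QuadraticForm ℂ V) 0 :=
    fun i j => Matrix.mul_apply_mem_graded _ (h₁ i) (fun s => h₂ s j)
      fun s => CharTwo.add_self_eq_zero _
  have hpow : ∀ (n : ℕ) i s, ((W₁ * W₂) ^ n * W₁) i s ∈
      CliffordAlgebra.evenOdd (0 : QuadraticForm ℂ V) (parity s) := by
    intro n
    induction n with
    | zero => simpa using h₁
    | succ n ih =>
      intro i s
      rw [pow_succ', Matrix.mul_assoc]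
      exact Matrix.mul_apply_mem_graded _ (h₁₂ i) (fun j => ih j s) fun _ => zero_add _
  have hcomm : ∀ n : ℕ, (W₂ * W₁) ^ (n + 1) = W₂ * ((W₁ * W₂) ^ n * W₁) := by
    intro n
    induction n with
    | zero => simp
    | succ n ih => rw [pow_succ', ih, pow_succ']; simp only [Matrix.mul_assoc]
  obtain ⟨n, rfl⟩ := Nat.exists_eq_add_of_le' hm
  rw [hcomm, pow_succ, ← Matrix.mul_assoc]
  exact trace_mul_eq_supertrace_mul _ _
    (fun i j => ExteriorAlgebra.mul_comm_of_mem_evenOdd_zero (hpow n i (Sum.inl j)) _)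
    (fun i j => ExteriorAlgebra.mul_eq_neg_mul_of_mem_evenOdd_one (hpow n i (Sum.inr j))
      (h₂r j i))
end

section
/- Let m ≥ 1 and n ≥ 2m be integers, let ε > 0, and let R be a complex Hermitian m×m matrix. Then ∫_{Herm(m)} exp(−i·tr(R(S + iε·1_m))) · det(S + iε·1_m)^{−n} d[S] = i^{−mn} · π^{−m(n−m)} · (∏_{j=n−m+1}^{n} 2π^{j}/Γ(j)) · det(R)^{n−m} if R is positive definite, and the integral equals 0 if R is not positive definite. (The integrand is absolutely integrable since n ≥ 2m.) -/
open Finset MeasureTheory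
open scoped ComplexOrder

/-- The index set of entries strictly above the diagonal of an `m × m` matrix. -/
abbrev UpperIdx (m : ℕ) := { p : Fin m × Fin m // p.1 < p.2 }

/-- The complex Hermitian matrix with diagonal entries `dg`, and real and imaginary parts
`re`, `im` of the entries above the diagonal. Integrating a function of this matrix over
Lebesgue measure in the coordinates `(dg, re, im)` realizes the flat measure `d[S]`
on `Herm(m)`. -/
noncomputable def hermOf {m : ℕ} (dg : Fin m → ℝ) (re im : UpperIdx m → ℝ) :
    Matrix (Fin m) (Fin m) ℂ :=
  Matrix.of fun i j =>
    if h : i < j then (re ⟨(i, j), h⟩ : ℂ) + (im ⟨(i, j), h⟩ : ℂ) * Complex.I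
    else if h' : j < i then (re ⟨(j, i), h'⟩ : ℂ) - (im ⟨(j, i), h'⟩ : ℂ) * Complex.I
    else (dg i : ℂ)

/-- The integrand of the Ingham–Siegel integral:
`exp(-i tr(R(S + iε1))) det(S + iε1)^{-n}` in the coordinates of `Herm(m)`. -/
noncomputable def inghamSiegelIntegrand (m n : ℕ) (ε : ℝ) (R : Matrix (Fin m) (Fin m) ℂ)
    (p : (Fin m → ℝ) × (UpperIdx m → ℝ) × (UpperIdx m → ℝ)) : ℂ :=
  Complex.exp (-(Complex.I *
      (R * (hermOf p.1 p.2.1 p.2.2 +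
        ((ε : ℂ) * Complex.I) • (1 : Matrix (Fin m) (Fin m) ℂ))).trace)) *
    (hermOf p.1 p.2.1 p.2.2 +
        ((ε : ℂ) * Complex.I) • (1 : Matrix (Fin m) (Fin m) ℂ)).det ^ (-(n : ℤ))

theorem integrableOn_pow_mul_cexp_neg_mul_Ioi (k : ℕ) {b : ℂ} (hb : 0 < b.re) :
    IntegrableOn (fun t : ℝ => (t : ℂ) ^ k * Complex.exp (-(b * t))) (Set.Ioi 0) := by
  have h := integrableOn_rpow_mul_exp_neg_mul_rpow (p := 1) (s := k) (b := b.re)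
    (by have : (0 : ℝ) ≤ k := k.cast_nonneg
        linarith) zero_lt_one hb
  refine Integrable.mono' h (by fun_prop) ?_
  refine (ae_restrict_iff' measurableSet_Ioi).2 (.of_forall fun t ht => ?_)
  have ht' : (0 : ℝ) < t := ht
  simp [Complex.norm_exp, abs_of_pos ht']

theorem integral_pow_mul_cexp_neg_mul_Ioi (k : ℕ) {b : ℂ} (hb : 0 < b.re) :
    ∫ t : ℝ in Set.Ioi 0, (t : ℂ) ^ k * Complex.exp (-(b * t)) =
      (k.factorial : ℂ) * (b ^ (k + 1))⁻¹ := by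
  have hb0 : b ≠ 0 := by rintro rfl; simp at hb
  induction k with
  | zero =>
    have := integral_exp_mul_complex_Ioi (a := -b) (by simpa) 0
    simpa [neg_div] using this
  | succ k ih =>
    have h1 := integrableOn_pow_mul_cexp_neg_mul_Ioi k hb
    have h2 := integrableOn_pow_mul_cexp_neg_mul_Ioi (k + 1) hb
    have hd : ∀ t ∈ Set.Ici (0 : ℝ), HasDerivAt
        (fun t : ℝ => (t : ℂ) ^ (k + 1) * Complex.exp (-(b * t)))
        ((k + 1) * ((t : ℂ) ^ k * Complex.exp (-(b * t))) -
          b * ((t : ℂ) ^ (k + 1) * Complex.exp (-(b * t)))) t := by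
      intro t _
      have h3 : HasDerivAt (fun t : ℝ => (t : ℂ)) 1 t := Complex.ofRealCLM.hasDerivAt
      have := (h3.pow (k + 1)).mul (((h3.const_mul b).neg).cexp)
      convert! this using 1
      push_cast
      simp
      ring
    have hlim : Filter.Tendsto (fun t : ℝ => (t : ℂ) ^ (k + 1) * Complex.exp (-(b * t)))
        Filter.atTop (nhds 0) := by
      rw [tendsto_zero_iff_norm_tendsto_zero]
      have := tendsto_rpow_mul_exp_neg_mul_atTop_nhds_zero (k + 1 : ℕ) b.re hb
      refine this.congr' ?_
      filter_upwards [Filter.eventually_ge_atTop 0] with t ht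
      rw [Real.rpow_natCast]
      simp [Complex.norm_exp, abs_of_nonneg ht]
    have := integral_Ioi_of_hasDerivAt_of_tendsto' hd
      ((h1.const_mul _).sub (h2.const_mul _)) hlim
    rw [integral_sub (h1.const_mul _) (h2.const_mul _), integral_const_mul,
      integral_const_mul, ih] at this
    simp only [Complex.ofReal_zero, ne_eq, Nat.succ_ne_zero, not_false_eq_true, zero_pow,
      zero_mul, sub_self] at this
    have h4 := sub_eq_zero.1 this
    rw [← mul_right_inj' hb0, ← h4, Nat.factorial_succ]
    push_cast
    field_simp
    ring

theorem integrable_inv_sq_add_sq {b : ℝ} (hb : 0 < b) :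
    Integrable fun s : ℝ => (s ^ 2 + b ^ 2)⁻¹ := by
  have := ((integrable_inv_one_add_sq.comp_div hb.ne').const_mul ((b ^ 2)⁻¹))
  refine this.congr (.of_forall fun s => ?_)
  simp only
  rw [← mul_inv]
  congr 1
  field_simp
  ring

theorem norm_inv_ofReal_add_pow_le {n : ℕ} (hn : 2 ≤ n) {c : ℂ} {ε : ℝ} (hε : 0 < ε)
    (hc : ε ≤ c.im) (s : ℝ) :
    ‖(((s : ℂ) + c) ^ n)⁻¹‖ ≤ (c.im ^ (n - 2))⁻¹ * ((s + c.re) ^ 2 + ε ^ 2)⁻¹ := by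
  have hc0 : 0 < c.im := hε.trans_le hc
  rw [norm_inv, norm_pow, ← mul_inv]
  refine inv_anti₀ (by positivity) ?_
  have h1 : c.im ≤ ‖(s : ℂ) + c‖ := by
    simpa [abs_of_pos hc0] using Complex.abs_im_le_norm ((s : ℂ) + c)
  have h2 : (s + c.re) ^ 2 + ε ^ 2 ≤ ‖(s : ℂ) + c‖ ^ 2 := by
    rw [Complex.sq_norm, Complex.normSq_apply]
    simp
    nlinarith
  calc _ ≤ ‖(s : ℂ) + c‖ ^ (n - 2) * ‖(s : ℂ) + c‖ ^ 2 := by gcongr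
    _ = _ := by rw [← pow_add]; congr 1; omega

theorem integrable_inv_ofReal_add_pow {n : ℕ} (hn : 2 ≤ n) {c : ℂ} (hc : 0 < c.im) :
    Integrable fun s : ℝ => (((s : ℂ) + c) ^ n)⁻¹ := by
  refine Integrable.mono' (((integrable_inv_sq_add_sq hc).comp_add_right c.re).const_mul
    (c.im ^ (n - 2))⁻¹) (by fun_prop)
    (.of_forall fun s => norm_inv_ofReal_add_pow_le hn hc le_rfl s)

open FourierTransform in
theorem integral_cexp_mul_inv_ofReal_add_pow {n : ℕ} (hn : 2 ≤ n) {c : ℂ} (hc : 0 < c.im)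
    (r : ℝ) :
    ∫ s : ℝ, Complex.exp (-(Complex.I * (r * (s + c)))) * ((s + c) ^ n)⁻¹ =
      if 0 < r then 2 * Real.pi * (-Complex.I) ^ n * r ^ (n - 1) / Real.Gamma n else 0 := by
  obtain ⟨k, rfl⟩ : ∃ k, n = k + 1 := ⟨n - 1, by omega⟩
  set f : ℝ → ℂ := fun x => ((max x 0 : ℝ) : ℂ) ^ k * Complex.exp (Complex.I * c * x) with hf
  have hfc : Continuous f := by fun_prop
  have hk : k ≠ 0 := by omega
  have hfind (b : ℂ) : (fun x : ℝ => Complex.exp (-(b * x)) * f x) = (Set.Ioi (0 : ℝ)).indicator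
      (fun t : ℝ => (t : ℂ) ^ k * Complex.exp (-((b - Complex.I * c) * t))) := by
    ext x
    rcases le_or_gt x 0 with h | h
    · simp [hf, h, hk]
    · simp only [hf, max_eq_left h.le, Set.indicator_of_mem (Set.mem_Ioi.2 h)]
      rw [mul_left_comm, ← Complex.exp_add]
      congr 2
      ring
  have hfi : Integrable f := by
    have := hfind 0
    simp only [zero_mul, neg_zero, Complex.exp_zero, one_mul, zero_sub] at this
    change f = _ at this
    rw [this]
    exact (integrableOn_pow_mul_cexp_neg_mul_Ioi k (by simpa)).integrable_indicator
      measurableSet_Ioi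
  have hinv (w : ℝ) : 𝓕⁻ f w = (k.factorial : ℂ) * Complex.I ^ (k + 1) *
      ((((2 * Real.pi * w : ℝ) : ℂ) + c) ^ (k + 1))⁻¹ := by
    rw [Real.fourierInv_eq']
    have h0 : ∀ v : ℝ, Complex.exp (((2 * Real.pi * inner ℝ v w : ℝ) : ℂ) * Complex.I) • f v
      = Complex.exp (-(-(2 * Real.pi * w * Complex.I) * v)) * f v := by
      intro v
      rw [smul_eq_mul]
      congr 2
      simp
      ring
    simp_rw [h0]
    rw [hfind, integral_indicator measurableSet_Ioi, integral_pow_mul_cexp_neg_mul_Ioi]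
    · rw [mul_assoc (k.factorial : ℂ), ← inv_pow, ← inv_pow, ← mul_pow]
      congr 2
      rw [← inv_inj, mul_inv, inv_inv, inv_inv, Complex.inv_I]
      push_cast
      ring
    · simpa using hc
  have hfi' : Integrable (𝓕 f) := by
    suffices h : Integrable (𝓕⁻ f) by
      refine h.comp_neg.congr (.of_forall fun w => ?_)
      simp [Real.fourierInv_eq_fourier_neg]
    rw [show 𝓕⁻ f = _ from funext hinv]
    exact (((integrable_inv_ofReal_add_pow hn hc).comp_mul_left'
      (R := 2 * Real.pi) (by positivity))).const_mul _
  have key := hfi.fourier_fourierInv_eq hfi' (v := r) hfc.continuousAt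
  rw [Real.fourier_eq'] at key
  simp_rw [hinv] at key
  have h1 (v : ℝ) : Complex.exp (((-2 * Real.pi * inner ℝ v r : ℝ) : ℂ) * Complex.I) •
      ((k.factorial : ℂ) * Complex.I ^ (k + 1) *
        ((((2 * Real.pi * v : ℝ) : ℂ) + c) ^ (k + 1))⁻¹) =
      (k.factorial : ℂ) * Complex.I ^ (k + 1) * Complex.exp (Complex.I * (r * c)) *
      (fun s : ℝ => Complex.exp (-(Complex.I * (r * (s + c)))) * ((s + c) ^ (k + 1))⁻¹)
        (2 * Real.pi * v) := by
    simp only [smul_eq_mul]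
    rw [show (((-2 * Real.pi * inner ℝ v r : ℝ) : ℂ) * Complex.I) = Complex.I * (r * c)  +
      -(Complex.I * (r * ((2 * Real.pi * v : ℝ) + c))) by simp; ring, Complex.exp_add]
    ring
  simp_rw [h1] at key
  rw [integral_const_mul, Measure.integral_comp_mul_left
    (fun s : ℝ => Complex.exp (-(Complex.I * (r * (s + c)))) * ((s + c) ^ (k + 1))⁻¹)] at key
  set J := ∫ s : ℝ, Complex.exp (-(Complex.I * (r * (s + c)))) * ((s + c) ^ (k + 1))⁻¹
  have hI : Complex.I ^ (k + 1) * (-Complex.I) ^ (k + 1) = 1 := by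
    rw [← mul_pow]; simp
  have hfac : (k.factorial : ℂ) ≠ 0 := by exact_mod_cast k.factorial_ne_zero
  have hpi : (Real.pi : ℂ) ≠ 0 := by exact_mod_cast Real.pi_ne_zero
  have hJ : J = 2 * Real.pi * (-Complex.I) ^ (k + 1) / k.factorial *
      (Complex.exp (-(Complex.I * (r * c))) * f r) := by
    rw [← key, Complex.real_smul, abs_of_pos (by positivity), Complex.exp_neg]
    push_cast
    field_simp
    linear_combination (-J) * hI
  rw [hJ]
  have := congrFun (hfind (Complex.I * c)) r
  rw [show Complex.I * (r * c) = Complex.I * c * r by ring, this]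
  split_ifs with h
  · rw [Set.indicator_of_mem (Set.mem_Ioi.2 h)]
    simp [Real.Gamma_nat_eq_factorial]
    ring
  · rw [Set.indicator_of_notMem (by simpa using h)]
    simp

section

open Matrix

/-- A Hermitian matrix split off its first row and column, indexed by `Fin m ⊕ Unit`. -/
def finSumUnitEquiv (m : ℕ) : Fin m ⊕ Unit ≃ Fin (m + 1) :=
  ((finSuccEquiv m).trans (Equiv.optionEquivSumPUnit _)).symm

theorem submatrix_finSumUnitEquiv {m : ℕ} (M : Matrix (Fin (m + 1)) (Fin (m + 1)) ℂ) :
    M.submatrix (finSumUnitEquiv m) (finSumUnitEquiv m) =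
      Matrix.fromBlocks (M.submatrix Fin.succ Fin.succ)
        (Matrix.replicateCol Unit fun i => M i.succ 0)
        (Matrix.replicateRow Unit fun j => M 0 j.succ) (Matrix.of fun _ _ => M 0 0) := by
  ext (i | i) (j | j) <;> simp [finSumUnitEquiv]

theorem det_eq_det_mul_schur {m : ℕ} (M : Matrix (Fin (m + 1)) (Fin (m + 1)) ℂ)
    (h : (M.submatrix Fin.succ Fin.succ).det ≠ 0) :
    M.det = (M.submatrix Fin.succ Fin.succ).det *
      (M 0 0 - ((fun j => M 0 j.succ) ᵥ* (M.submatrix Fin.succ Fin.succ)⁻¹) ⬝ᵥ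
        fun i => M i.succ 0) := by
  have : Invertible (M.submatrix Fin.succ Fin.succ) :=
    Matrix.invertibleOfIsUnitDet _ (isUnit_iff_ne_zero.2 h)
  rw [← Matrix.det_submatrix_equiv_self (finSumUnitEquiv m), submatrix_finSumUnitEquiv,
    Matrix.det_fromBlocks₁₁, Matrix.invOf_eq_nonsing_inv]
  simp [Matrix.det_unique, Matrix.mul_apply, Matrix.vecMul, dotProduct]

/-- The Schur complement of the top left entry of a matrix. -/
noncomputable def schurZero {m : ℕ} (M : Matrix (Fin (m + 1)) (Fin (m + 1)) ℂ) :
    Matrix (Fin m) (Fin m) ℂ :=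
  M.submatrix Fin.succ Fin.succ -
    (M 0 0)⁻¹ • Matrix.vecMulVec (fun i : Fin m => M i.succ 0) (fun j : Fin m => M 0 j.succ)

theorem schurZero_eq {m : ℕ} (M : Matrix (Fin (m + 1)) (Fin (m + 1)) ℂ) :
    M.submatrix Fin.succ Fin.succ - (Matrix.replicateCol Unit fun i : Fin m => M i.succ 0) *
      (Matrix.of fun _ _ : Unit => M 0 0)⁻¹ *
        (Matrix.replicateRow Unit fun j : Fin m => M 0 j.succ) = schurZero M := by
  ext i j
  simp [schurZero, Matrix.mul_apply, Matrix.vecMulVec]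
  ring

theorem det_eq_mul_det_schur {m : ℕ} (M : Matrix (Fin (m + 1)) (Fin (m + 1)) ℂ)
    (h : M 0 0 ≠ 0) :
    M.det = M 0 0 * (schurZero M).det := by
  have : Invertible (Matrix.of fun _ _ : Unit => M 0 0) :=
    Matrix.invertibleOfIsUnitDet _ (isUnit_iff_ne_zero.2 (by simpa))
  rw [← Matrix.det_submatrix_equiv_self (finSumUnitEquiv m), submatrix_finSumUnitEquiv,
    Matrix.det_fromBlocks₂₂, Matrix.invOf_eq_nonsing_inv, schurZero_eq]
  simp [Matrix.det_unique]

theorem posDef_succ_iff {m : ℕ} {M : Matrix (Fin (m + 1)) (Fin (m + 1)) ℂ}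
    (hM : M.IsHermitian) :
    M.PosDef ↔ 0 < M 0 0 ∧ (schurZero M).PosDef := by
  by_cases h0 : 0 < M 0 0
  · have hD : (Matrix.of fun _ _ : Unit => M 0 0).PosDef := by
      convert! Matrix.PosDef.diagonal (n := Unit) (d := fun _ => M 0 0) (fun _ => h0)
    have : Invertible (Matrix.of fun _ _ : Unit => M 0 0) :=
      Matrix.invertibleOfIsUnitDet _ (isUnit_iff_ne_zero.2 (by simpa using h0.ne'))
    have hB : (Matrix.replicateRow Unit fun j : Fin m => M 0 j.succ) =
        (Matrix.replicateCol Unit fun i : Fin m => M i.succ 0)ᴴ := by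
      ext i j
      simpa using (hM.apply 0 j.succ).symm
    have hS : M.PosSemidef ↔ (schurZero M).PosSemidef := by
      rw [← Matrix.posSemidef_submatrix_equiv (finSumUnitEquiv m),
        submatrix_finSumUnitEquiv, hB, Matrix.PosDef.fromBlocks₂₂ _ _ hD, ← hB, schurZero_eq]
    have key (k : ℕ) (N : Matrix (Fin k) (Fin k) ℂ) : N.PosDef ↔ N.PosSemidef ∧ N.det ≠ 0 :=
      ⟨fun h => ⟨h.posSemidef, h.det_pos.ne'⟩, fun h => h.1.posDef_iff_det_ne_zero.2 h.2⟩
    rw [key, key, hS, det_eq_mul_det_schur M h0.ne']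
    simp [h0, h0.ne']
  · exact ⟨fun h => absurd h.diag_pos h0, fun h => absurd h.1 h0⟩

theorem trace_mul_succ {m : ℕ} (R Z : Matrix (Fin (m + 1)) (Fin (m + 1)) ℂ) :
    (R * Z).trace = R 0 0 * Z 0 0 + (fun j : Fin m => R 0 j.succ) ⬝ᵥ (fun i : Fin m => Z i.succ 0) +
      (fun j : Fin m => Z 0 j.succ) ⬝ᵥ (fun i : Fin m => R i.succ 0) +
      (R.submatrix Fin.succ Fin.succ * Z.submatrix Fin.succ Fin.succ).trace := by
  simp [Matrix.trace, Matrix.mul_apply, Fin.sum_univ_succ, dotProduct, Finset.sum_add_distrib,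
    mul_comm]
  ring

theorem measurePreserving_prodProdProdComm (α β γ δ : Type*) [MeasureSpace α] [MeasureSpace β]
    [MeasureSpace γ] [MeasureSpace δ] [SigmaFinite (volume : Measure α)]
    [SigmaFinite (volume : Measure β)] [SigmaFinite (volume : Measure γ)]
    [SigmaFinite (volume : Measure δ)] :
    MeasurePreserving (fun p : (α × β) × γ × δ => ((p.1.1, p.2.1), (p.1.2, p.2.2))) := by
  have h : MeasurePreserving (fun p : β × γ × δ => (p.2.1, (p.1, p.2.2))) :=
    volume_preserving_prodAssoc.comp
      ((Measure.measurePreserving_swap.prod (MeasurePreserving.id _)).comp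
        volume_preserving_prodAssoc.symm)
  exact volume_preserving_prodAssoc.symm.comp
    (((MeasurePreserving.id _).prod h).comp volume_preserving_prodAssoc)

/-- An index above the diagonal lies in the first row, or comes from the lower right block. -/
def upperIdxSuccEquiv (m : ℕ) : UpperIdx m ⊕ Fin m ≃ UpperIdx (m + 1) where
  toFun := Sum.elim (fun p => ⟨(p.1.1.succ, p.1.2.succ), Fin.succ_lt_succ_iff.2 p.2⟩)
    (fun j => ⟨(0, j.succ), j.succ_pos⟩)
  invFun p := Fin.cases (motive := fun i => i < p.1.2 → UpperIdx m ⊕ Fin m)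
    (fun h => .inr (p.1.2.pred h.ne'))
    (fun i h => .inl ⟨(i, p.1.2.pred (Fin.ne_zero_of_lt h)), by
      rw [← Fin.succ_lt_succ_iff, Fin.succ_pred]; exact h⟩) p.1.1 p.2
  left_inv := by rintro (p | j) <;> simp
  right_inv := by
    rintro ⟨⟨i, j⟩, h⟩
    induction i using Fin.cases <;> simp

theorem measurePreserving_upperIdx_succ (m : ℕ) :
    MeasurePreserving (fun y : UpperIdx (m + 1) → ℝ =>
      ((fun p : UpperIdx m => y ⟨(p.1.1.succ, p.1.2.succ), Fin.succ_lt_succ_iff.2 p.2⟩),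
        (fun j : Fin m => y ⟨(0, j.succ), j.succ_pos⟩))) :=
  (volume_measurePreserving_sumPiEquivProdPi (fun _ : UpperIdx m ⊕ Fin m => ℝ)).comp
    (volume_measurePreserving_piCongrLeft (fun _ => ℝ) (upperIdxSuccEquiv m)).symm

theorem measurePreserving_ofReal_add_mul_I (ι : Type*) [Fintype ι] :
    MeasurePreserving (fun p : (ι → ℝ) × (ι → ℝ) =>
      fun i => (p.1 i : ℂ) + (p.2 i : ℂ) * Complex.I) := by
  have h1 := (volume_measurePreserving_arrowProdEquivProdArrow ℝ ℝ ι).symm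
  have h2 := volume_preserving_pi (ι := ι) (fun _ => Complex.volume_preserving_equiv_real_prod.symm)
  convert! h2.comp h1 using 1
  ext p i
  exact (Complex.mk_eq_add_mul_I _ _).symm

/-- Coordinates on Hermitian matrices splitting off the first row and column. -/
noncomputable def splitCoord {m : ℕ}
    (x : (Fin (m + 1) → ℝ) × (UpperIdx (m + 1) → ℝ) × (UpperIdx (m + 1) → ℝ)) :
    ((Fin m → ℝ) × (UpperIdx m → ℝ) × (UpperIdx m → ℝ)) × ((Fin m → ℂ) × ℝ) :=
  ((fun i => x.1 i.succ,
    fun p => x.2.1 ⟨(p.1.1.succ, p.1.2.succ), Fin.succ_lt_succ_iff.2 p.2⟩,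
    fun p => x.2.2 ⟨(p.1.1.succ, p.1.2.succ), Fin.succ_lt_succ_iff.2 p.2⟩),
   (fun j => (x.2.1 ⟨(0, j.succ), j.succ_pos⟩ : ℂ) +
      (x.2.2 ⟨(0, j.succ), j.succ_pos⟩ : ℂ) * Complex.I, x.1 0))

theorem measurePreserving_splitCoord (m : ℕ) : MeasurePreserving (splitCoord (m := m)) := by
  have h1 : MeasurePreserving (fun d : Fin (m + 1) → ℝ => ((fun i : Fin m => d i.succ), d 0)) :=
    Measure.measurePreserving_swap.comp (volume_preserving_piFinSuccAbove (fun _ => ℝ) 0)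
  have h2 := (measurePreserving_upperIdx_succ m).prod (measurePreserving_upperIdx_succ m)
  have h3 := (measurePreserving_prodProdProdComm _ _ _ _).comp h2
  have h4 := (measurePreserving_prodProdProdComm _ _ _ _).comp (h1.prod h3)
  have h5 := ((MeasurePreserving.id _).prod (Measure.measurePreserving_swap.comp
    ((MeasurePreserving.id _).prod (measurePreserving_ofReal_add_mul_I (Fin m))))).comp h4
  exact h5

theorem hermOf_zero_zero {m : ℕ} (x : (Fin (m + 1) → ℝ) × (UpperIdx (m + 1) → ℝ) ×
    (UpperIdx (m + 1) → ℝ)) : hermOf x.1 x.2.1 x.2.2 0 0 = (splitCoord x).2.2 := by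
  simp [hermOf, splitCoord]

theorem hermOf_zero_succ {m : ℕ} (x : (Fin (m + 1) → ℝ) × (UpperIdx (m + 1) → ℝ) ×
    (UpperIdx (m + 1) → ℝ)) (j : Fin m) :
    hermOf x.1 x.2.1 x.2.2 0 j.succ = (splitCoord x).2.1 j := by
  simp [hermOf, splitCoord]

theorem hermOf_succ_zero {m : ℕ} (x : (Fin (m + 1) → ℝ) × (UpperIdx (m + 1) → ℝ) ×
    (UpperIdx (m + 1) → ℝ)) (j : Fin m) :
    hermOf x.1 x.2.1 x.2.2 j.succ 0 = star ((splitCoord x).2.1 j) := by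
  simp [hermOf, splitCoord, sub_eq_add_neg]

theorem hermOf_submatrix_succ {m : ℕ} (x : (Fin (m + 1) → ℝ) × (UpperIdx (m + 1) → ℝ) ×
    (UpperIdx (m + 1) → ℝ)) :
    (hermOf x.1 x.2.1 x.2.2).submatrix Fin.succ Fin.succ =
      hermOf (splitCoord x).1.1 (splitCoord x).1.2.1 (splitCoord x).1.2.2 := by
  ext i j
  simp [hermOf, splitCoord]

theorem isHermitian_hermOf {m : ℕ} (dg : Fin m → ℝ) (re im : UpperIdx m → ℝ) :
    (hermOf dg re im).IsHermitian := by
  ext i j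
  rcases lt_trichotomy i j with h | rfl | h
  · simp [hermOf, h, h.not_gt, sub_eq_add_neg]
  · simp [hermOf]
  · simp [hermOf, h, h.not_gt, sub_eq_add_neg]

theorem map_vecMul_volume {m : ℕ} {M : Matrix (Fin m) (Fin m) ℂ} (hM : M.det ≠ 0) :
    Measure.map (fun a : Fin m → ℂ => a ᵥ* M) volume =
      ENNReal.ofReal ((‖M.det‖ ^ 2)⁻¹) • volume := by
  have hdet : LinearMap.det ((Matrix.toLin' Mᵀ).restrictScalars ℝ) = ‖M.det‖ ^ 2 := by
    rw [LinearMap.det_restrictScalars, LinearMap.det_toLin', Matrix.det_transpose,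
      Algebra.norm_complex_eq, Complex.sq_norm]
    rfl
  have := Measure.map_linearMap_addHaar_eq_smul_addHaar (volume : Measure (Fin m → ℂ))
    (f := (Matrix.toLin' Mᵀ).restrictScalars ℝ) (by rw [hdet]; positivity)
  rw [hdet, abs_of_nonneg (by positivity)] at this
  rw [← this]
  congr 1
  ext1 a
  simp [Matrix.mulVec_transpose]

theorem lintegral_eq_mul_lintegral_vecMul {m : ℕ} {M : Matrix (Fin m) (Fin m) ℂ}
    (hM : M.det ≠ 0) {g : (Fin m → ℂ) → ENNReal} (hg : Measurable g) :
    ∫⁻ u, g u = ENNReal.ofReal (‖M.det‖ ^ 2) * ∫⁻ a, g (a ᵥ* M) := by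
  have h := lintegral_map hg (g := fun a : Fin m → ℂ => a ᵥ* M) (μ := volume)
    (by fun_prop)
  rw [map_vecMul_volume hM, lintegral_smul_measure] at h
  rw [← h, smul_eq_mul, ← mul_assoc, ← ENNReal.ofReal_mul (by positivity),
    mul_inv_cancel₀ (by positivity), ENNReal.ofReal_one, one_mul]

theorem exists_eq_conjTranspose_mul_diagonal_mul {m : ℕ} {S : Matrix (Fin m) (Fin m) ℂ}
    (hS : S.IsHermitian) : ∃ (V : Matrix (Fin m) (Fin m) ℂ) (d : Fin m → ℝ),
      V * Vᴴ = 1 ∧ Vᴴ * V = 1 ∧ ∀ c : ℂ, S + c • 1 = Vᴴ * diagonal (fun j => (d j : ℂ) + c) * V := by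
  have h1 : (star (hS.eigenvectorUnitary : Matrix (Fin m) (Fin m) ℂ)) * hS.eigenvectorUnitary = 1 :=
    Unitary.coe_star_mul_self _
  have h2 : hS.eigenvectorUnitary * (star (hS.eigenvectorUnitary : Matrix (Fin m) (Fin m) ℂ)) = 1 :=
    Unitary.coe_mul_star_self _
  refine ⟨star (hS.eigenvectorUnitary : Matrix (Fin m) (Fin m) ℂ), hS.eigenvalues, ?_, ?_, ?_⟩
  · simpa [Matrix.star_eq_conjTranspose] using h1
  · simpa [Matrix.star_eq_conjTranspose] using h2
  · intro c
    have h3 := hS.spectral_theorem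
    rw [Unitary.conjStarAlgAut_apply] at h3
    rw [Matrix.star_eq_conjTranspose] at h2 h3
    have h4 : diagonal (fun j => (hS.eigenvalues j : ℂ) + c) =
        diagonal (RCLike.ofReal ∘ hS.eigenvalues) + c • (1 : Matrix (Fin m) (Fin m) ℂ) := by
      rw [Matrix.smul_one_eq_diagonal, Matrix.diagonal_add]
      rfl
    rw [Matrix.star_eq_conjTranspose, Matrix.conjTranspose_conjTranspose, h4, Matrix.mul_add,
      Matrix.add_mul, ← h3, Matrix.mul_smul, Matrix.mul_one, Matrix.smul_mul, h2]

theorem det_add_smul_one_ne_zero {m : ℕ} {S : Matrix (Fin m) (Fin m) ℂ} (hS : S.IsHermitian)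
    {c : ℂ} (hc : c.im ≠ 0) : (S + c • (1 : Matrix (Fin m) (Fin m) ℂ)).det ≠ 0 := by
  obtain ⟨V, d, h1, h2, h3⟩ := exists_eq_conjTranspose_mul_diagonal_mul hS
  rw [h3, Matrix.det_mul_right_comm, h2, Matrix.one_mul, Matrix.det_diagonal,
    Finset.prod_ne_zero_iff]
  intro j _ h
  apply hc
  simpa using congrArg Complex.im h

theorem integral_cexp_vecMul_inv {m : ℕ} {S : Matrix (Fin m) (Fin m) ℂ} (hS : S.IsHermitian)
    {ε r : ℝ} (hε : 0 < ε) (hr : 0 < r) (w : Fin m → ℂ) :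
    ∫ u : Fin m → ℂ, Complex.exp (-(Complex.I * (w ⬝ᵥ star u + u ⬝ᵥ star w +
        r * ((u ᵥ* (S + ((ε : ℂ) * Complex.I) • (1 : Matrix (Fin m) (Fin m) ℂ))⁻¹) ⬝ᵥ star u)))) =
      (Real.pi / (Complex.I * r)) ^ m *
        (S + ((ε : ℂ) * Complex.I) • (1 : Matrix (Fin m) (Fin m) ℂ)).det *
        Complex.exp (Complex.I * ((r : ℂ)⁻¹ *
          ((w ᵥ* (S + ((ε : ℂ) * Complex.I) • (1 : Matrix (Fin m) (Fin m) ℂ))) ⬝ᵥ star w))) := by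
  obtain ⟨V, d, h1, h2, h3⟩ := exists_eq_conjTranspose_mul_diagonal_mul hS
  rw [h3]
  set D : Fin m → ℂ := fun j => (d j : ℂ) + ε * Complex.I with hD
  have hD0 (j) : D j ≠ 0 := fun h => hε.ne' (by simpa [hD] using congrArg Complex.im h)
  have hinv : (Vᴴ * diagonal D * V)⁻¹ = Vᴴ * diagonal (fun j => (D j)⁻¹) * V := by
    refine Matrix.inv_eq_left_inv ?_
    calc _ = Vᴴ * diagonal (fun j => (D j)⁻¹) * (V * Vᴴ) * diagonal D * V := by
          simp only [Matrix.mul_assoc]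
      _ = 1 := by
        rw [h1, Matrix.mul_one, Matrix.mul_assoc Vᴴ, Matrix.diagonal_mul_diagonal]
        simp [hD0, h2]
  have hdet : (Vᴴ * diagonal D * V).det = ∏ j, D j := by
    rw [Matrix.det_mul_right_comm, h2, Matrix.one_mul, Matrix.det_diagonal]
  have hVdet : ‖V.det‖ ^ 2 = 1 := by
    have := congrArg Matrix.det h1
    rw [Matrix.det_mul, Matrix.det_conjTranspose, Matrix.det_one] at this
    have h5 := congrArg norm this
    simpa [← sq] using h5
  have hV0 : V.det ≠ 0 := fun h => by simp [h] at hVdet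
  have hdot (a b : Fin m → ℂ) : (a ᵥ* V) ⬝ᵥ star (b ᵥ* V) = a ⬝ᵥ star b := by
    rw [Matrix.star_vecMul, Matrix.dotProduct_mulVec, Matrix.vecMul_vecMul, h1, Matrix.vecMul_one]
  have hquad (a : Fin m → ℂ) (E : Fin m → ℂ) :
      ((a ᵥ* V) ᵥ* (Vᴴ * diagonal E * V)) ⬝ᵥ star (a ᵥ* V) = ∑ j, E j * (a j * star (a j)) := by
    rw [Matrix.vecMul_vecMul, ← Matrix.mul_assoc, ← Matrix.mul_assoc, h1, Matrix.one_mul,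
      ← Matrix.vecMul_vecMul, hdot]
    simp [dotProduct, Matrix.vecMul_diagonal]
    refine Finset.sum_congr rfl fun j _ => by ring
  obtain ⟨b, rfl⟩ : ∃ b, w = b ᵥ* V := ⟨w ᵥ* Vᴴ, by rw [Matrix.vecMul_vecMul, h2, Matrix.vecMul_one]⟩
  rw [hquad, hdet, hinv]
  have hmap := map_vecMul_volume hV0
  rw [hVdet, inv_one, ENNReal.ofReal_one, one_smul] at hmap
  rw [← hmap, integral_map (by fun_prop) (by fun_prop)]
  simp_rw [hquad, hdot]
  have hre (j) : 0 < (Complex.I * r * (D j)⁻¹).re := by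
    have : 0 < Complex.normSq (D j) := Complex.normSq_pos.2 (hD0 j)
    rw [show (Complex.I * r * (D j)⁻¹).re = r * ε / Complex.normSq (D j) by simp [hD]; ring]
    positivity
  have hprod (a : Fin m → ℂ) : Complex.exp (-(Complex.I * (b ⬝ᵥ star a + a ⬝ᵥ star b +
      r * ∑ j, (D j)⁻¹ * (a j * star (a j))))) =
      ∏ j, Complex.exp (-(Complex.I * r * (D j)⁻¹) * ‖a j‖ ^ 2 +
        (-2 * Complex.I) * inner ℝ (b j) (a j)) := by
    rw [← Complex.exp_sum]
    congr 1
    simp only [dotProduct, Finset.mul_sum, ← Finset.sum_add_distrib, ← Finset.sum_neg_distrib]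
    refine Finset.sum_congr rfl fun j _ => ?_
    have e1 : a j * star (a j) = (‖a j‖ : ℂ) ^ 2 := Complex.mul_conj' (a j)
    have e2 : b j * star (a j) + a j * star (b j) = 2 * ((inner ℝ (b j) (a j) : ℝ) : ℂ) := by
      rw [Complex.inner]
      apply Complex.ext <;> simp <;> ring
    rw [e1, Pi.star_apply, Pi.star_apply, e2]
    ring
  simp_rw [hprod]
  rw [integral_fintype_prod_volume_eq_prod (fun j z => Complex.exp
    (-(Complex.I * r * (D j)⁻¹) * ‖z‖ ^ 2 + (-2 * Complex.I) * inner ℝ (b j) z))]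
  have hr0 : (r : ℂ) ≠ 0 := by exact_mod_cast hr.ne'
  have hj (j) := GaussianFourier.integral_cexp_neg_mul_sq_norm_add (hre j) (-2 * Complex.I) (b j)
  simp_rw [hj, Complex.finrank_real_complex]
  rw [Finset.prod_mul_distrib, ← Complex.exp_sum]
  congr 1
  · simp only [Nat.cast_ofNat, div_self (two_ne_zero' ℂ), Complex.cpow_one]
    rw [← Fin.prod_const, ← Finset.prod_mul_distrib]
    refine Finset.prod_congr rfl fun j _ => ?_
    have := hD0 j
    field_simp
  · congr 1
    rw [Finset.mul_sum, Finset.mul_sum]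
    refine Finset.sum_congr rfl fun j _ => ?_
    have := hD0 j
    have e1 : b j * star (b j) = (‖b j‖ : ℂ) ^ 2 := Complex.mul_conj' (b j)
    rw [e1]
    field_simp
    ring

/-- The Hermitian matrix with given coordinates, shifted by `iε`. -/
noncomputable abbrev shiftedHermOf {m : ℕ} (ε : ℝ)
    (p : (Fin m → ℝ) × (UpperIdx m → ℝ) × (UpperIdx m → ℝ)) : Matrix (Fin m) (Fin m) ℂ :=
  hermOf p.1 p.2.1 p.2.2 + ((ε : ℂ) * Complex.I) • (1 : Matrix (Fin m) (Fin m) ℂ)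

theorem continuous_hermOf {m : ℕ} :
    Continuous fun p : (Fin m → ℝ) × (UpperIdx m → ℝ) × (UpperIdx m → ℝ) =>
      hermOf p.1 p.2.1 p.2.2 := by
  refine continuous_matrix fun i j => ?_
  simp only [hermOf, Matrix.of_apply]
  split_ifs <;> fun_prop

theorem continuous_shiftedHermOf {m : ℕ} (ε : ℝ) :
    Continuous (shiftedHermOf (m := m) ε) :=
  continuous_hermOf.add continuous_const

theorem det_shiftedHermOf_ne_zero {m : ℕ} {ε : ℝ} (hε : 0 < ε)
    (p : (Fin m → ℝ) × (UpperIdx m → ℝ) × (UpperIdx m → ℝ)) : (shiftedHermOf ε p).det ≠ 0 :=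
  det_add_smul_one_ne_zero (isHermitian_hermOf _ _ _) (by simpa using ne_of_gt hε)

/-- The Schur complement of `shiftedHermOf` in the coordinates `splitCoord` has the form
`s + schurShift ε p u`. -/
noncomputable def schurShift {m : ℕ} (ε : ℝ)
    (p : (Fin m → ℝ) × (UpperIdx m → ℝ) × (UpperIdx m → ℝ)) (u : Fin m → ℂ) : ℂ :=
  ε * Complex.I - (u ᵥ* (shiftedHermOf ε p)⁻¹) ⬝ᵥ star u

theorem shiftedHermOf_submatrix_succ {m : ℕ} (ε : ℝ) (x : (Fin (m + 1) → ℝ) ×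
    (UpperIdx (m + 1) → ℝ) × (UpperIdx (m + 1) → ℝ)) :
    (shiftedHermOf ε x).submatrix Fin.succ Fin.succ = shiftedHermOf ε (splitCoord x).1 := by
  rw [shiftedHermOf, Matrix.submatrix_add, Pi.add_apply, Pi.add_apply, hermOf_submatrix_succ]
  congr 1
  ext i j
  simp [Matrix.one_apply]

theorem shiftedHermOf_zero_zero {m : ℕ} (ε : ℝ) (x : (Fin (m + 1) → ℝ) ×
    (UpperIdx (m + 1) → ℝ) × (UpperIdx (m + 1) → ℝ)) :
    shiftedHermOf ε x 0 0 = (splitCoord x).2.2 + ε * Complex.I := by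
  simp [shiftedHermOf, hermOf_zero_zero]

theorem shiftedHermOf_zero_succ {m : ℕ} (ε : ℝ) (x : (Fin (m + 1) → ℝ) ×
    (UpperIdx (m + 1) → ℝ) × (UpperIdx (m + 1) → ℝ)) :
    (fun j : Fin m => shiftedHermOf ε x 0 j.succ) = (splitCoord x).2.1 := by
  ext j
  simp [shiftedHermOf, hermOf_zero_succ, (Fin.succ_ne_zero j).symm]

theorem shiftedHermOf_succ_zero {m : ℕ} (ε : ℝ) (x : (Fin (m + 1) → ℝ) ×
    (UpperIdx (m + 1) → ℝ) × (UpperIdx (m + 1) → ℝ)) :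
    (fun j : Fin m => shiftedHermOf ε x j.succ 0) = star (splitCoord x).2.1 := by
  ext j
  simp [shiftedHermOf, hermOf_succ_zero]

theorem det_shiftedHermOf_succ {m : ℕ} {ε : ℝ} (hε : 0 < ε) (x : (Fin (m + 1) → ℝ) ×
    (UpperIdx (m + 1) → ℝ) × (UpperIdx (m + 1) → ℝ)) :
    (shiftedHermOf ε x).det = (shiftedHermOf ε (splitCoord x).1).det *
      ((splitCoord x).2.2 + schurShift ε (splitCoord x).1 (splitCoord x).2.1) := by
  rw [det_eq_det_mul_schur, shiftedHermOf_submatrix_succ, shiftedHermOf_zero_zero,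
    shiftedHermOf_zero_succ, shiftedHermOf_succ_zero, schurShift, add_sub_assoc]
  rw [shiftedHermOf_submatrix_succ]
  exact det_shiftedHermOf_ne_zero hε _

theorem continuous_inv_shiftedHermOf {m : ℕ} {ε : ℝ} (hε : 0 < ε) :
    Continuous fun p => (shiftedHermOf (m := m) ε p)⁻¹ := by
  simp_rw [Matrix.inv_def, Ring.inverse_eq_inv']
  have hZ := continuous_shiftedHermOf (m := m) ε
  exact (hZ.matrix_det.inv₀ fun y => det_shiftedHermOf_ne_zero hε _).smul hZ.matrix_adjugate

theorem continuous_schurShift {m : ℕ} {ε : ℝ} (hε : 0 < ε) :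
    Continuous fun y : ((Fin m → ℝ) × (UpperIdx m → ℝ) × (UpperIdx m → ℝ)) × (Fin m → ℂ) =>
      schurShift ε y.1 y.2 := by
  unfold schurShift
  exact continuous_const.sub ((continuous_snd.matrix_vecMul
    ((continuous_inv_shiftedHermOf hε).comp continuous_fst)).dotProduct continuous_snd.star)

theorem continuous_ofReal_add_schurShift {m : ℕ} {ε : ℝ} (hε : 0 < ε) :
    Continuous fun y : ((Fin m → ℝ) × (UpperIdx m → ℝ) × (UpperIdx m → ℝ)) ×
      ((Fin m → ℂ) × ℝ) => (y.2.2 : ℂ) + schurShift ε y.1 y.2.1 := by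
  have h := (continuous_schurShift (m := m) hε).comp
    ((continuous_fst (Y := (Fin m → ℂ) × ℝ)).prodMk (continuous_fst.comp continuous_snd))
  exact (Complex.continuous_ofReal.comp (continuous_snd.comp continuous_snd)).add h

theorem im_schurShift_vecMul {m : ℕ} {ε : ℝ} (hε : 0 < ε)
    (p : (Fin m → ℝ) × (UpperIdx m → ℝ) × (UpperIdx m → ℝ)) (a : Fin m → ℂ) :
    (schurShift ε p (a ᵥ* shiftedHermOf ε p)).im = ε * (1 + ∑ j, ‖a j‖ ^ 2) := by
  have hu : IsUnit (shiftedHermOf ε p).det :=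
    isUnit_iff_ne_zero.2 (det_shiftedHermOf_ne_zero hε p)
  have h1 : (a ⬝ᵥ star (a ᵥ* hermOf p.1 p.2.1 p.2.2)).im = 0 := by
    have := (isHermitian_hermOf p.1 p.2.1 p.2.2).im_star_dotProduct_mulVec_self (star a)
    rw [Matrix.star_vecMul, (isHermitian_hermOf p.1 p.2.1 p.2.2).eq]
    simpa using this
  have h2 : a ⬝ᵥ star a = ((∑ j, ‖a j‖ ^ 2 : ℝ) : ℂ) := by
    push_cast
    exact Finset.sum_congr rfl fun j _ => Complex.mul_conj' (a j)
  have h3 : a ⬝ᵥ star (a ᵥ* shiftedHermOf ε p) = a ⬝ᵥ star (a ᵥ* hermOf p.1 p.2.1 p.2.2) -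
      ε * Complex.I * (a ⬝ᵥ star a) := by
    rw [shiftedHermOf, Matrix.vecMul_add, star_add, dotProduct_add, Matrix.vecMul_smul,
      Matrix.vecMul_one, star_smul, dotProduct_smul]
    simp [sub_eq_add_neg]
  rw [schurShift, Matrix.vecMul_vecMul, Matrix.mul_nonsing_inv _ hu, Matrix.vecMul_one, h3, h2,
    Complex.sub_im, Complex.sub_im, h1]
  simp [-Complex.ofReal_sum, -Complex.ofReal_pow]
  ring

theorem le_im_schurShift {m : ℕ} {ε : ℝ} (hε : 0 < ε)
    (p : (Fin m → ℝ) × (UpperIdx m → ℝ) × (UpperIdx m → ℝ)) (u : Fin m → ℂ) :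
    ε ≤ (schurShift ε p u).im := by
  have hu : IsUnit (shiftedHermOf ε p).det :=
    isUnit_iff_ne_zero.2 (det_shiftedHermOf_ne_zero hε p)
  have h : u = (u ᵥ* (shiftedHermOf ε p)⁻¹) ᵥ* shiftedHermOf ε p := by
    rw [Matrix.vecMul_vecMul, Matrix.nonsing_inv_mul _ hu, Matrix.vecMul_one]
  rw [h, im_schurShift_vecMul hε]
  have : 0 ≤ ∑ j, ‖(u ᵥ* (shiftedHermOf ε p)⁻¹) j‖ ^ 2 := by positivity
  nlinarith

theorem lintegral_inv_ofReal_add_pow_le {n : ℕ} (hn : 2 ≤ n) {c : ℂ} {ε : ℝ} (hε : 0 < ε)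
    (hc : ε ≤ c.im) :
    ∫⁻ s : ℝ, ‖(((s : ℂ) + c) ^ n)⁻¹‖ₑ ≤
      ENNReal.ofReal (c.im ^ (n - 2))⁻¹ * ∫⁻ s : ℝ, ENNReal.ofReal (s ^ 2 + ε ^ 2)⁻¹ := by
  have hc0 : 0 < c.im := hε.trans_le hc
  calc _ ≤ ∫⁻ s : ℝ, ENNReal.ofReal (c.im ^ (n - 2))⁻¹ *
        ENNReal.ofReal ((s + c.re) ^ 2 + ε ^ 2)⁻¹ := by
        refine lintegral_mono fun s => ?_
        rw [← ENNReal.ofReal_mul (by positivity), ← ofReal_norm]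
        exact ENNReal.ofReal_le_ofReal (norm_inv_ofReal_add_pow_le hn hε hc s)
    _ = _ := by
        rw [lintegral_const_mul' _ _ ENNReal.ofReal_ne_top]
        congr 1
        exact lintegral_add_right_eq_self (fun s : ℝ => ENNReal.ofReal (s ^ 2 + ε ^ 2)⁻¹) c.re

theorem integrable_inv_mul_one_add_sum_sq_pow (m : ℕ) {k : ℕ} (hk : 2 * m ≤ k) {ε : ℝ}
    (hε : 0 < ε) :
    Integrable fun a : Fin m → ℂ => ((ε * (1 + ∑ j, ‖a j‖ ^ 2)) ^ k)⁻¹ := by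
  have h1 : Integrable fun z : ℂ => ((1 + ‖z‖ ^ 2) ^ 2)⁻¹ := by
    have := integrable_rpow_neg_one_add_norm_sq (E := ℂ) (μ := volume) (r := 4)
      (by rw [Complex.finrank_real_complex]; norm_num)
    refine this.congr (.of_forall fun z => ?_)
    simp only
    rw [show (-4 / 2 : ℝ) = -(2 : ℕ) by norm_num, Real.rpow_neg (by positivity),
      Real.rpow_natCast]
  have h2 := (Integrable.fintype_prod (f := fun (_ : Fin m) (z : ℂ) => ((1 + ‖z‖ ^ 2) ^ 2)⁻¹)
    (fun _ => h1)).const_mul (ε ^ k)⁻¹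
  refine h2.mono' (Measurable.aestronglyMeasurable ?_) (.of_forall fun a => ?_)
  · have : Measurable fun a : Fin m → ℂ => ∑ j, ‖a j‖ ^ 2 :=
      Finset.measurable_sum _ fun j _ => by fun_prop
    fun_prop
  have h0 : 0 ≤ ∑ j, ‖a j‖ ^ 2 := by positivity
  rw [Real.norm_of_nonneg (by positivity), Finset.prod_inv_distrib, ← mul_inv, mul_pow]
  refine inv_anti₀ (by positivity) ?_
  gcongr
  calc ∏ j, (1 + ‖a j‖ ^ 2) ^ 2 ≤ ∏ _j : Fin m, (1 + ∑ j, ‖a j‖ ^ 2) ^ 2 := by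
        gcongr with j
        exact Finset.single_le_sum (f := fun j => ‖a j‖ ^ 2) (fun _ _ => by positivity)
          (Finset.mem_univ j)
    _ = (1 + ∑ j, ‖a j‖ ^ 2) ^ (2 * m) := by simp [pow_mul]
    _ ≤ _ := by gcongr; linarith

/-- The integrand of `lintegral_inv_det_shiftedHermOf_pow_lt_top` in the coordinates
`splitCoord`. -/
noncomputable def invDetMulInvShift {m : ℕ} (ε : ℝ) (n : ℕ)
    (y : ((Fin m → ℝ) × (UpperIdx m → ℝ) × (UpperIdx m → ℝ)) × ((Fin m → ℂ) × ℝ)) : ENNReal :=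
  ‖((shiftedHermOf ε y.1).det ^ n)⁻¹‖ₑ * ‖(((y.2.2 : ℂ) + schurShift ε y.1 y.2.1) ^ n)⁻¹‖ₑ

theorem measurable_invDetMulInvShift {m : ℕ} {ε : ℝ} (hε : 0 < ε) (n : ℕ) :
    Measurable (invDetMulInvShift (m := m) ε n) := by
  have h1 : Measurable fun y : ((Fin m → ℝ) × (UpperIdx m → ℝ) × (UpperIdx m → ℝ)) ×
      ((Fin m → ℂ) × ℝ) => (shiftedHermOf ε y.1).det :=
    (((continuous_shiftedHermOf ε).comp continuous_fst).matrix_det).measurable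
  have h2 := (continuous_ofReal_add_schurShift (m := m) hε).measurable
  exact (h1.pow_const n).inv.enorm.mul (h2.pow_const n).inv.enorm

theorem lintegral_invDetMulInvShift_le {m : ℕ} {ε : ℝ} (hε : 0 < ε) {n : ℕ} (hn : 2 ≤ n)
    (p : (Fin m → ℝ) × (UpperIdx m → ℝ) × (UpperIdx m → ℝ)) :
    ∫⁻ us, invDetMulInvShift ε n (p, us) ≤ ‖((shiftedHermOf ε p).det ^ (n - 2))⁻¹‖ₑ *
      ((∫⁻ a : Fin m → ℂ, ENNReal.ofReal ((ε * (1 + ∑ j, ‖a j‖ ^ 2)) ^ (n - 2))⁻¹) *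
        ∫⁻ s : ℝ, ENNReal.ofReal (s ^ 2 + ε ^ 2)⁻¹) := by
  have hp : Measurable fun u => schurShift ε p u :=
    ((continuous_schurShift hε).comp (continuous_const.prodMk continuous_id)).measurable
  have hdp := det_shiftedHermOf_ne_zero hε p
  have hG : AEMeasurable (fun us => invDetMulInvShift ε n (p, us))
      ((volume : Measure (Fin m → ℂ)).prod (volume : Measure ℝ)) :=
    ((measurable_invDetMulInvShift hε n).comp measurable_prodMk_left).aemeasurable
  have hK : ∫⁻ s : ℝ, ENNReal.ofReal (s ^ 2 + ε ^ 2)⁻¹ ≠ ⊤ :=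
    (integrable_inv_sq_add_sq hε).lintegral_lt_top.ne
  calc _ = ∫⁻ u, ∫⁻ s, invDetMulInvShift ε n (p, (u, s)) := lintegral_prod _ hG
    _ ≤ ∫⁻ u, ‖((shiftedHermOf ε p).det ^ n)⁻¹‖ₑ *
        (ENNReal.ofReal ((schurShift ε p u).im ^ (n - 2))⁻¹ *
          ∫⁻ s : ℝ, ENNReal.ofReal (s ^ 2 + ε ^ 2)⁻¹) := by
      refine lintegral_mono fun u => ?_
      simp only [invDetMulInvShift]
      rw [lintegral_const_mul' _ _ enorm_ne_top]
      gcongr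
      exact lintegral_inv_ofReal_add_pow_le hn hε (le_im_schurShift hε p u)
    _ = ‖((shiftedHermOf ε p).det ^ n)⁻¹‖ₑ * ((ENNReal.ofReal (‖(shiftedHermOf ε p).det‖ ^ 2) *
        ∫⁻ a : Fin m → ℂ, ENNReal.ofReal ((ε * (1 + ∑ j, ‖a j‖ ^ 2)) ^ (n - 2))⁻¹) *
          ∫⁻ s : ℝ, ENNReal.ofReal (s ^ 2 + ε ^ 2)⁻¹) := by
      rw [lintegral_const_mul' _ _ enorm_ne_top, lintegral_mul_const' _ _ hK,
        lintegral_eq_mul_lintegral_vecMul hdp]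
      · simp_rw [im_schurShift_vecMul hε]
      · exact ((Complex.measurable_im.comp hp).pow_const _).inv.ennreal_ofReal
    _ = _ := by
      rw [← mul_assoc, ← mul_assoc, ← mul_assoc]
      congr 2
      rw [← ofReal_norm, ← ofReal_norm, ← ENNReal.ofReal_mul (by positivity)]
      congr 1
      have : ‖(shiftedHermOf ε p).det‖ ≠ 0 := norm_ne_zero_iff.2 hdp
      obtain ⟨k, rfl⟩ : ∃ k, n = k + 2 := ⟨n - 2, by omega⟩
      simp only [norm_inv, norm_pow, Nat.add_sub_cancel]
      field_simp
      ring

theorem lintegral_inv_det_shiftedHermOf_pow_lt_top {ε : ℝ} (hε : 0 < ε) (m : ℕ) :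
    ∀ n : ℕ, 2 * m ≤ n → ∫⁻ p, ‖((shiftedHermOf (m := m) ε p).det ^ n)⁻¹‖ₑ < ⊤ := by
  induction m with
  | zero =>
    intro n _
    simp [Measure.volume_eq_prod]
  | succ m ih =>
    intro n hn
    have hK : (∫⁻ a : Fin m → ℂ, ENNReal.ofReal ((ε * (1 + ∑ j, ‖a j‖ ^ 2)) ^ (n - 2))⁻¹) *
        ∫⁻ s : ℝ, ENNReal.ofReal (s ^ 2 + ε ^ 2)⁻¹ < ⊤ :=
      ENNReal.mul_lt_top
        (integrable_inv_mul_one_add_sum_sq_pow m (by omega) hε).lintegral_lt_top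
        (integrable_inv_sq_add_sq hε).lintegral_lt_top
    have hG := measurable_invDetMulInvShift (m := m) hε n
    calc _ = ∫⁻ x, invDetMulInvShift ε n (splitCoord x) := by
          refine lintegral_congr fun x => ?_
          rw [det_shiftedHermOf_succ hε, mul_pow, mul_inv, enorm_mul, invDetMulInvShift]
      _ = ∫⁻ y, invDetMulInvShift ε n y := (measurePreserving_splitCoord m).lintegral_comp hG
      _ = ∫⁻ p, ∫⁻ us, invDetMulInvShift ε n (p, us) := lintegral_prod _ hG.aemeasurable
      _ ≤ _ := lintegral_mono fun p => lintegral_invDetMulInvShift_le hε (by omega) p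
      _ = _ := lintegral_mul_const' _ _ hK.ne
      _ < ⊤ := ENNReal.mul_lt_top (ih _ (by omega)) hK

theorem integrable_inv_det_shiftedHermOf_pow {ε : ℝ} (hε : 0 < ε) {m n : ℕ} (hn : 2 * m ≤ n) :
    Integrable fun p => ((shiftedHermOf (m := m) ε p).det ^ n)⁻¹ :=
  ⟨(((continuous_shiftedHermOf ε).matrix_det.pow n).inv₀ fun p =>
      pow_ne_zero _ (det_shiftedHermOf_ne_zero hε p)).aestronglyMeasurable,
    lintegral_inv_det_shiftedHermOf_pow_lt_top hε m n hn⟩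

theorem inghamSiegelIntegrand_eq (m n : ℕ) (ε : ℝ) (R : Matrix (Fin m) (Fin m) ℂ)
    (p : (Fin m → ℝ) × (UpperIdx m → ℝ) × (UpperIdx m → ℝ)) :
    inghamSiegelIntegrand m n ε R p =
      Complex.exp (-(Complex.I * (R * shiftedHermOf ε p).trace)) *
        ((shiftedHermOf ε p).det ^ n)⁻¹ := by
  rw [inghamSiegelIntegrand, _root_.zpow_neg, zpow_natCast]

theorem norm_cexp_neg_trace_mul_shiftedHermOf {m : ℕ} (ε : ℝ) {R : Matrix (Fin m) (Fin m) ℂ}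
    (hR : R.IsHermitian) (p : (Fin m → ℝ) × (UpperIdx m → ℝ) × (UpperIdx m → ℝ)) :
    ‖Complex.exp (-(Complex.I * (R * shiftedHermOf ε p).trace))‖ =
      Real.exp (ε * R.trace.re) := by
  have h : ((R * hermOf p.1 p.2.1 p.2.2).trace).im = 0 := by
    rw [← Complex.conj_eq_iff_im, starRingEnd_apply, ← Matrix.trace_conjTranspose,
      Matrix.conjTranspose_mul, hR.eq, (isHermitian_hermOf _ _ _).eq, Matrix.trace_mul_comm]
  rw [Complex.norm_exp, shiftedHermOf, Matrix.mul_add, Matrix.trace_add, Matrix.mul_smul,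
    Matrix.mul_one, Matrix.trace_smul]
  congr 1
  simp [h]

theorem integrable_inghamSiegelIntegrand {ε : ℝ} (hε : 0 < ε) {m n : ℕ} (hn : 2 * m ≤ n)
    {R : Matrix (Fin m) (Fin m) ℂ} (hR : R.IsHermitian) :
    Integrable (inghamSiegelIntegrand m n ε R) := by
  simp_rw [funext (inghamSiegelIntegrand_eq m n ε R)]
  refine (integrable_inv_det_shiftedHermOf_pow hε hn).bdd_mul (c := Real.exp (ε * R.trace.re)) ?_
    (.of_forall fun p => (norm_cexp_neg_trace_mul_shiftedHermOf ε hR p).le)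
  exact (Complex.continuous_exp.comp (continuous_const.mul
    (continuous_const.matrix_mul (continuous_shiftedHermOf ε)).matrix_trace).neg
      ).aestronglyMeasurable

/-- The Ingham–Siegel integrand in the coordinates `splitCoord`. -/
noncomputable def splitIntegrand {m : ℕ} (n : ℕ) (ε : ℝ)
    (R : Matrix (Fin (m + 1)) (Fin (m + 1)) ℂ)
    (y : ((Fin m → ℝ) × (UpperIdx m → ℝ) × (UpperIdx m → ℝ)) × ((Fin m → ℂ) × ℝ)) : ℂ :=
  Complex.exp (-(Complex.I * (R.submatrix Fin.succ Fin.succ * shiftedHermOf ε y.1).trace)) *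
    ((shiftedHermOf ε y.1).det ^ n)⁻¹ *
    (Complex.exp (-(Complex.I * ((fun j => R 0 j.succ) ⬝ᵥ star y.2.1 +
        y.2.1 ⬝ᵥ star (fun j => R 0 j.succ) +
        ((R 0 0).re : ℂ) * ((y.2.1 ᵥ* (shiftedHermOf ε y.1)⁻¹) ⬝ᵥ star y.2.1)))) *
      (Complex.exp (-(Complex.I * ((R 0 0).re * (y.2.2 + schurShift ε y.1 y.2.1)))) *
        ((y.2.2 + schurShift ε y.1 y.2.1) ^ n)⁻¹))

theorem inghamSiegelIntegrand_succ {m : ℕ} {ε : ℝ} (hε : 0 < ε) (n : ℕ)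
    {R : Matrix (Fin (m + 1)) (Fin (m + 1)) ℂ} (hR : R.IsHermitian)
    (x : (Fin (m + 1) → ℝ) × (UpperIdx (m + 1) → ℝ) × (UpperIdx (m + 1) → ℝ)) :
    inghamSiegelIntegrand (m + 1) n ε R x = splitIntegrand n ε R (splitCoord x) := by
  have h0 : R 0 0 = ((R 0 0).re : ℂ) := (hR.coe_re_apply_self 0).symm
  have h1 : (fun i : Fin m => R i.succ 0) = star (fun j : Fin m => R 0 j.succ) :=
    funext fun i => (hR.apply i.succ 0).symm
  rw [inghamSiegelIntegrand_eq, trace_mul_succ, det_shiftedHermOf_succ hε,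
    shiftedHermOf_submatrix_succ, shiftedHermOf_zero_zero, shiftedHermOf_zero_succ,
    shiftedHermOf_succ_zero, h1, h0, splitIntegrand, mul_pow, mul_inv]
  have hc : ε * Complex.I = schurShift ε (splitCoord x).1 (splitCoord x).2.1 +
      ((splitCoord x).2.1 ᵥ* (shiftedHermOf ε (splitCoord x).1)⁻¹) ⬝ᵥ star (splitCoord x).2.1 := by
    rw [schurShift]; ring
  have key (r s c q a b t d e : ℂ) :
      Complex.exp (-(Complex.I * (r * (s + (c + q)) + a + b + t))) * (d * e) =
        Complex.exp (-(Complex.I * t)) * d * (Complex.exp (-(Complex.I * (a + b + r * q))) *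
          (Complex.exp (-(Complex.I * (r * (s + c)))) * e)) := by
    rw [show -(Complex.I * (r * (s + (c + q)) + a + b + t)) = -(Complex.I * t) +
      (-(Complex.I * (a + b + r * q)) + -(Complex.I * (r * (s + c)))) by ring,
      Complex.exp_add, Complex.exp_add]
    ring
  rw [hc]
  exact key ..

theorem measurable_splitIntegrand {m : ℕ} {ε : ℝ} (hε : 0 < ε) (n : ℕ)
    (R : Matrix (Fin (m + 1)) (Fin (m + 1)) ℂ) : Measurable (splitIntegrand n ε R) := by
  have hZ : Continuous fun y : ((Fin m → ℝ) × (UpperIdx m → ℝ) × (UpperIdx m → ℝ)) ×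
      ((Fin m → ℂ) × ℝ) => shiftedHermOf ε y.1 := (continuous_shiftedHermOf ε).comp continuous_fst
  have hu : Continuous fun y : ((Fin m → ℝ) × (UpperIdx m → ℝ) × (UpperIdx m → ℝ)) ×
      ((Fin m → ℂ) × ℝ) => y.2.1 := continuous_fst.comp continuous_snd
  have hs := continuous_ofReal_add_schurShift (m := m) hε
  have hq := (hu.matrix_vecMul
    ((continuous_inv_shiftedHermOf hε).comp continuous_fst)).dotProduct hu.star
  exact (((Complex.continuous_exp.comp (continuous_const.mul
    (continuous_const.matrix_mul hZ).matrix_trace).neg).measurable.mul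
      (hZ.matrix_det.measurable.pow_const n).inv).mul
    ((Complex.continuous_exp.comp (continuous_const.mul
      (((continuous_const.dotProduct hu.star).add (hu.dotProduct continuous_const)).add
        (continuous_const.mul hq))).neg).measurable.mul
      ((Complex.continuous_exp.comp (continuous_const.mul
        (continuous_const.mul hs)).neg).measurable.mul (hs.measurable.pow_const n).inv)))

theorem trace_schurZero_mul {m : ℕ} {R : Matrix (Fin (m + 1)) (Fin (m + 1)) ℂ}
    (hR : R.IsHermitian) (Z : Matrix (Fin m) (Fin m) ℂ) :
    (schurZero R * Z).trace = (R.submatrix Fin.succ Fin.succ * Z).trace -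
      ((R 0 0).re : ℂ)⁻¹ * ((fun j => R 0 j.succ) ᵥ* Z ⬝ᵥ star fun j => R 0 j.succ) := by
  have h0 : R 0 0 = ((R 0 0).re : ℂ) := (hR.coe_re_apply_self 0).symm
  have h1 : (fun i : Fin m => R i.succ 0) = star (fun j : Fin m => R 0 j.succ) :=
    funext fun i => (hR.apply i.succ 0).symm
  rw [schurZero, ← h0, h1, Matrix.sub_mul, Matrix.trace_sub, Matrix.smul_mul, Matrix.trace_smul,
    Matrix.vecMulVec_mul, Matrix.trace_vecMulVec, smul_eq_mul, dotProduct_comm]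

theorem isHermitian_schurZero {m : ℕ} {R : Matrix (Fin (m + 1)) (Fin (m + 1)) ℂ}
    (hR : R.IsHermitian) : (schurZero R).IsHermitian := by
  refine Matrix.IsHermitian.ext fun i j => ?_
  simp only [schurZero, Matrix.sub_apply, Matrix.smul_apply, Matrix.vecMulVec_apply,
    Matrix.submatrix_apply, star_sub, smul_eq_mul, star_mul', star_inv₀, hR.apply]
  ring

theorem integral_splitIntegrand {m : ℕ} {ε : ℝ} (hε : 0 < ε) {n : ℕ} (hn : 2 ≤ n)
    {R : Matrix (Fin (m + 1)) (Fin (m + 1)) ℂ} (hR : R.IsHermitian)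
    (p : (Fin m → ℝ) × (UpperIdx m → ℝ) × (UpperIdx m → ℝ))
    (hint : Integrable fun us => splitIntegrand n ε R (p, us)) :
    ∫ us, splitIntegrand n ε R (p, us) = (if 0 < (R 0 0).re then
      2 * Real.pi * (-Complex.I) ^ n * ((R 0 0).re : ℂ) ^ (n - 1) / Real.Gamma n *
        (Real.pi / (Complex.I * (R 0 0).re)) ^ m else 0) *
      inghamSiegelIntegrand m (n - 1) ε (schurZero R) p := by
  have hs (u : Fin m → ℂ) := integral_cexp_mul_inv_ofReal_add_pow hn
    (hε.trans_le (le_im_schurShift hε p u)) (R 0 0).re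
  have hd := det_shiftedHermOf_ne_zero hε p
  calc _ = ∫ u, ∫ s, splitIntegrand n ε R (p, (u, s)) := integral_prod _ hint
    _ = _ := by
      simp only [splitIntegrand]
      simp_rw [integral_const_mul, hs]
      rw [integral_mul_const]
      split_ifs with hr
      · rw [integral_cexp_vecMul_inv (isHermitian_hermOf _ _ _) hε hr, inghamSiegelIntegrand_eq,
          trace_schurZero_mul hR, mul_sub, neg_sub, sub_eq_add_neg, Complex.exp_add]
        obtain ⟨k, rfl⟩ : ∃ k, n = k + 1 := ⟨n - 1, by omega⟩
        rw [Nat.add_sub_cancel, pow_succ (shiftedHermOf ε p).det]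
        rw [shiftedHermOf] at hd ⊢
        generalize hermOf p.1 p.2.1 p.2.2 + ((ε : ℂ) * Complex.I) • 1 = Z at hd ⊢
        field_simp
      · simp

theorem integral_inghamSiegelIntegrand_succ {m : ℕ} {ε : ℝ} (hε : 0 < ε) {n : ℕ}
    (hn : 2 * (m + 1) ≤ n) {R : Matrix (Fin (m + 1)) (Fin (m + 1)) ℂ} (hR : R.IsHermitian) :
    ∫ x, inghamSiegelIntegrand (m + 1) n ε R x = (if 0 < (R 0 0).re then
      2 * Real.pi * (-Complex.I) ^ n * ((R 0 0).re : ℂ) ^ (n - 1) / Real.Gamma n *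
        (Real.pi / (Complex.I * (R 0 0).re)) ^ m else 0) *
      ∫ p, inghamSiegelIntegrand m (n - 1) ε (schurZero R) p := by
  have hG := measurable_splitIntegrand hε n R
  have heq : inghamSiegelIntegrand (m + 1) n ε R = splitIntegrand n ε R ∘ splitCoord :=
    funext fun x => inghamSiegelIntegrand_succ hε n hR x
  have hmp := measurePreserving_splitCoord m
  have hint : Integrable (splitIntegrand n ε R) (volume.prod volume) := by
    refine (hmp.integrable_comp hG.aestronglyMeasurable).1 ?_
    rw [← heq]
    exact integrable_inghamSiegelIntegrand hε hn hR
  calc _ = ∫ x, splitIntegrand n ε R (splitCoord x) := by rw [heq]; rfl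
    _ = ∫ y, splitIntegrand n ε R y := by
      rw [← hmp.map_eq, integral_map hmp.measurable.aemeasurable hG.aestronglyMeasurable]
    _ = ∫ p, ∫ us, splitIntegrand n ε R (p, us) := integral_prod _ hint
    _ = ∫ p, _ := integral_congr_ae <| hint.prod_right_ae.mono fun p hp =>
      integral_splitIntegrand hε (by omega) hR p hp
    _ = _ := integral_const_mul _ _

theorem inghamSiegel_const_succ (m k : ℕ) {r : ℂ} (hr : r ≠ 0) (d : ℂ) :
    2 * Real.pi * (-Complex.I) ^ (k + m + 1) * r ^ (k + m) / Real.Gamma ((k + m + 1 : ℕ) : ℝ) *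
        (Real.pi / (Complex.I * r)) ^ m *
      (Complex.I ^ (-(m * (k + m : ℕ) : ℤ)) * (Real.pi : ℂ) ^ (-(m * ((k + m : ℕ) - m) : ℤ)) *
        ((∏ j ∈ Finset.Icc (k + 1) (k + m), 2 * Real.pi ^ j / Real.Gamma j : ℝ) : ℂ) * d ^ k) =
    Complex.I ^ (-((m + 1 : ℕ) * (k + m + 1 : ℕ) : ℤ)) *
      (Real.pi : ℂ) ^ (-((m + 1 : ℕ) * ((k + m + 1 : ℕ) - (m + 1 : ℕ)) : ℤ)) *
      ((∏ j ∈ Finset.Icc (k + 1) (k + m + 1), 2 * Real.pi ^ j / Real.Gamma j : ℝ) : ℂ) *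
        (r * d) ^ k := by
  have hπ : (Real.pi : ℂ) ≠ 0 := Complex.ofReal_ne_zero.2 Real.pi_ne_zero
  have hI : (-Complex.I) = Complex.I⁻¹ := by simp
  have e1 : (-(m * (k + m : ℕ) : ℤ)) = -((m * (k + m) : ℕ) : ℤ) := by push_cast; ring
  have e2 : (-(m * ((k + m : ℕ) - m) : ℤ)) = -((m * k : ℕ) : ℤ) := by push_cast; ring
  have e3 : (-((m + 1 : ℕ) * (k + m + 1 : ℕ) : ℤ)) = -(((m + 1) * (k + m + 1) : ℕ) : ℤ) := by
    push_cast; ring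
  have e4 : (-((m + 1 : ℕ) * ((k + m + 1 : ℕ) - (m + 1 : ℕ)) : ℤ)) =
      -(((m + 1) * k : ℕ) : ℤ) := by push_cast; ring
  rw [Finset.prod_Icc_succ_top (by omega), e1, e2, e3, e4, hI]
  simp only [_root_.zpow_neg, zpow_natCast, Complex.ofReal_mul, Complex.ofReal_div,
    Complex.ofReal_pow, Complex.ofReal_ofNat]
  have hΓ : ((Real.Gamma ((k + m + 1 : ℕ) : ℝ) : ℝ) : ℂ) ≠ 0 :=
    Complex.ofReal_ne_zero.2 (Real.Gamma_pos_of_pos (by positivity)).ne'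
  have hI0 := Complex.I_ne_zero
  generalize ((∏ j ∈ Finset.Icc (k + 1) (k + m), 2 * Real.pi ^ j / Real.Gamma j : ℝ) : ℂ) = P
  rw [inv_pow, div_pow, mul_pow, mul_pow]
  field_simp
  ring

theorem integral_inghamSiegelIntegrand {ε : ℝ} (hε : 0 < ε) (m : ℕ) :
    ∀ n : ℕ, 2 * m ≤ n → ∀ R : Matrix (Fin m) (Fin m) ℂ, R.IsHermitian →
      (R.PosDef → ∫ p, inghamSiegelIntegrand m n ε R p =
        Complex.I ^ (-(m * n : ℤ)) * (Real.pi : ℂ) ^ (-(m * (n - m) : ℤ)) *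
          ((∏ j ∈ Finset.Icc (n - m + 1) n,
            2 * Real.pi ^ j / Real.Gamma j : ℝ) : ℂ) * R.det ^ (n - m)) ∧
      (¬ R.PosDef → ∫ p, inghamSiegelIntegrand m n ε R p = 0) := by
  induction m with
  | zero =>
    intro n _ R _
    have hpd : R.PosDef := by
      rw [Subsingleton.elim R 1]
      exact Matrix.PosDef.one
    refine ⟨fun _ => ?_, fun h => absurd hpd h⟩
    simp [inghamSiegelIntegrand, Measure.volume_eq_prod, measureReal_def,
      ← Set.univ_prod_univ, volume_pi]
  | succ m ih =>
    intro n hn R hR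
    have h0 : R 0 0 = ((R 0 0).re : ℂ) := (hR.coe_re_apply_self 0).symm
    have hpos : 0 < R 0 0 ↔ 0 < (R 0 0).re := by rw [h0]; simp
    obtain ⟨k, rfl⟩ : ∃ k, n = k + m + 1 := ⟨n - m - 1, by omega⟩
    obtain ⟨ih1, ih2⟩ := ih (k + m) (by omega) (schurZero R) (isHermitian_schurZero hR)
    rw [integral_inghamSiegelIntegrand_succ hε hn hR, Nat.add_sub_cancel, posDef_succ_iff hR, hpos]
    refine ⟨fun ⟨hr, hS⟩ => ?_, fun h => ?_⟩
    · have hr0 : R 0 0 ≠ 0 := (hpos.2 hr).ne'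
      rw [if_pos hr, ih1 hS, det_eq_mul_det_schur R hr0, ← h0, Nat.add_sub_cancel, add_assoc k m 1,
        Nat.add_sub_cancel, ← add_assoc k m 1]
      exact inghamSiegel_const_succ m k hr0 _
    · by_cases hr : 0 < (R 0 0).re
      · rw [ih2 fun hS => h ⟨hr, hS⟩, mul_zero]
      · rw [if_neg hr, zero_mul]

end

/-- The ordinary Ingham–Siegel integral for β = 2 (Eq. (4.3) of the paper). -/
theorem ingham_siegel (m n : ℕ) (hm : 1 ≤ m) (hn : 2 * m ≤ n) (ε : ℝ) (hε : 0 < ε)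
    (R : Matrix (Fin m) (Fin m) ℂ) (hR : R.IsHermitian) :
    (R.PosDef →
      ∫ p : (Fin m → ℝ) × (UpperIdx m → ℝ) × (UpperIdx m → ℝ),
          inghamSiegelIntegrand m n ε R p
        = Complex.I ^ (-(m * n : ℤ)) * (Real.pi : ℂ) ^ (-(m * (n - m) : ℤ)) *
            ((∏ j ∈ Finset.Icc (n - m + 1) n,
              2 * Real.pi ^ j / Real.Gamma j : ℝ) : ℂ) * R.det ^ (n - m)) ∧
    (¬ R.PosDef →
      ∫ p : (Fin m → ℝ) × (UpperIdx m → ℝ) × (UpperIdx m → ℝ),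
          inghamSiegelIntegrand m n ε R p = 0) := by
  exact integral_inghamSiegelIntegrand hε m n hn R hR
end

section
/- For every n ≥ 1, ∫_{ℝ^n} exp(−∑_{j=1}^{n} E_j²) · ∏_{1≤a<b≤n} |E_a − E_b| dE = 2^{−n(n−5)/4} · ∏_{j=1}^{n} Γ(j/2 + 1). -/
open Finset MeasureTheory

open Polynomial in
/-- The monic orthogonal polynomials for the weight `exp (-b * x ^ 2)`. -/
noncomputable def gaussianPoly (b : ℝ) : ℕ → ℝ[X]
  | 0 => 1
  | k + 1 => X * gaussianPoly b k - C (1 / (2 * b)) * derivative (gaussianPoly b k)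

namespace gaussianPoly

open Polynomial

theorem monic_and_natDegree (b : ℝ) (k : ℕ) :
    (gaussianPoly b k).Monic ∧ (gaussianPoly b k).natDegree = k := by
  induction k with
  | zero => simp [gaussianPoly]
  | succ k ih =>
    obtain ⟨hm, hd⟩ := ih
    have hX : (X * gaussianPoly b k).Monic := monic_X.mul hm
    have hXd : (X * gaussianPoly b k).natDegree = k + 1 := by
      rw [natDegree_X_mul hm.ne_zero, hd]
    have hlt : (C (1 / (2 * b)) * derivative (gaussianPoly b k)).degree
        < (X * gaussianPoly b k).degree := by
      rw [degree_eq_natDegree hX.ne_zero, hXd]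
      refine lt_of_le_of_lt degree_le_natDegree ?_
      refine Nat.cast_lt.2 (lt_of_le_of_lt (natDegree_C_mul_le _ _) ?_)
      exact lt_of_le_of_lt (natDegree_derivative_le _) (by omega)
    refine ⟨hX.sub_of_left hlt, ?_⟩
    rw [gaussianPoly, natDegree_sub_eq_left_of_natDegree_lt, hXd]
    rw [hXd]
    exact lt_of_le_of_lt ((natDegree_C_mul_le _ _).trans (natDegree_derivative_le _)) (by omega)

theorem monic (b : ℝ) (k : ℕ) : (gaussianPoly b k).Monic := (monic_and_natDegree b k).1

theorem natDegree_eq (b : ℝ) (k : ℕ) : (gaussianPoly b k).natDegree = k :=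
  (monic_and_natDegree b k).2

theorem integrable_eval_mul_exp {b : ℝ} (hb : 0 < b) (p : ℝ[X]) :
    Integrable fun x : ℝ => p.eval x * Real.exp (-b * x ^ 2) := by
  induction p using Polynomial.induction_on' with
  | add p q hp hq => simpa [add_mul] using! hp.add hq
  | monomial n a =>
    have := (integrable_rpow_mul_exp_neg_mul_sq hb (s := n)
      (by have : (0 : ℝ) ≤ n := n.cast_nonneg
          linarith)).const_mul a
    simpa [mul_assoc] using this

theorem hasDerivAt_mul_exp {b : ℝ} (hb : 0 < b) (k : ℕ) (q : ℝ[X]) (x : ℝ) :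
    HasDerivAt (fun x : ℝ => (gaussianPoly b k * q).eval x * Real.exp (-b * x ^ 2))
      ((C (-(2 * b)) * (gaussianPoly b (k + 1) * q)
        + gaussianPoly b k * derivative q).eval x * Real.exp (-b * x ^ 2)) x := by
  have h1 := (gaussianPoly b k * q).hasDerivAt x
  have h2 : HasDerivAt (fun x : ℝ => Real.exp (-b * x ^ 2))
      (Real.exp (-b * x ^ 2) * (-b * (2 * x))) x := by
    simpa using ((hasDerivAt_pow 2 x).const_mul (-b)).exp
  refine (h1.mul h2).congr_deriv ?_
  have hrec : gaussianPoly b (k + 1) = X * gaussianPoly b k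
    - C (1 / (2 * b)) * derivative (gaussianPoly b k) := rfl
  simp only [hrec, derivative_mul, eval_add, eval_mul, eval_C, eval_sub, eval_X]
  field_simp
  ring

theorem integral_succ_mul {b : ℝ} (hb : 0 < b) (k : ℕ) (q : ℝ[X]) :
    ∫ x : ℝ, (gaussianPoly b (k + 1) * q).eval x * Real.exp (-b * x ^ 2)
      = 1 / (2 * b) * ∫ x : ℝ, (gaussianPoly b k * derivative q).eval x
          * Real.exp (-b * x ^ 2) := by
  have h := integral_eq_zero_of_hasDerivAt_of_integrable (hasDerivAt_mul_exp hb k q)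
    (integrable_eval_mul_exp hb _) (integrable_eval_mul_exp hb _)
  simp only [eval_add (p := C _ * _), add_mul] at h
  rw [integral_add (integrable_eval_mul_exp hb _) (integrable_eval_mul_exp hb _)] at h
  simp only [eval_mul (p := C _), eval_C, mul_assoc (-(2 * b)), integral_const_mul] at h
  rw [one_div, eq_inv_mul_iff_mul_eq₀ (by positivity)]
  linarith

theorem integral_mul_exp {b : ℝ} (hb : 0 < b) (k : ℕ) (q : ℝ[X]) :
    ∫ x : ℝ, (gaussianPoly b k * q).eval x * Real.exp (-b * x ^ 2)
      = (1 / (2 * b)) ^ k * ∫ x : ℝ, (derivative^[k] q).eval x * Real.exp (-b * x ^ 2) := by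
  induction k generalizing q with
  | zero => simp [gaussianPoly]
  | succ k ih => rw [integral_succ_mul hb, ih, Function.iterate_succ_apply, pow_succ]; ring

theorem integral_mul_eq_zero_of_lt {b : ℝ} (hb : 0 < b) {j k : ℕ} (h : j < k) :
    ∫ x : ℝ, (gaussianPoly b k).eval x * (gaussianPoly b j).eval x * Real.exp (-b * x ^ 2)
      = 0 := by
  simp only [← eval_mul]
  rw [integral_mul_exp hb, iterate_derivative_eq_zero (by rwa [natDegree_eq])]
  simp

theorem integral_mul_eq_zero {b : ℝ} (hb : 0 < b) {j k : ℕ} (h : j ≠ k) :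
    ∫ x : ℝ, (gaussianPoly b j).eval x * (gaussianPoly b k).eval x * Real.exp (-b * x ^ 2)
      = 0 := by
  rcases h.lt_or_gt with h | h
  · simpa only [mul_comm (eval _ (gaussianPoly b k))] using integral_mul_eq_zero_of_lt hb h
  · exact integral_mul_eq_zero_of_lt hb h

theorem iterate_derivative_eq (b : ℝ) (k : ℕ) :
    derivative^[k] (gaussianPoly b k) = C (k.factorial : ℝ) := by
  have hd : (derivative^[k] (gaussianPoly b k)).natDegree = 0 := by
    have := natDegree_iterate_derivative (gaussianPoly b k) k
    rw [natDegree_eq] at this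
    omega
  rw [eq_C_of_natDegree_eq_zero hd, coeff_iterate_derivative]
  have hc : (gaussianPoly b k).coeff k = 1 := by
    simpa [Monic, leadingCoeff, natDegree_eq] using monic b k
  simp [Nat.descFactorial_self, hc]

theorem integral_mul_self {b : ℝ} (hb : 0 < b) (k : ℕ) :
    ∫ x : ℝ, (gaussianPoly b k).eval x * (gaussianPoly b k).eval x * Real.exp (-b * x ^ 2)
      = (1 / (2 * b)) ^ k * (k.factorial * √(Real.pi / b)) := by
  simp only [← eval_mul]
  rw [integral_mul_exp hb, iterate_derivative_eq]
  simp only [eval_C, integral_const_mul, integral_gaussian]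

theorem integral_succ {b : ℝ} (hb : 0 < b) (k : ℕ) :
    ∫ x : ℝ, (gaussianPoly b (k + 1)).eval x * Real.exp (-b * x ^ 2) = 0 := by
  simpa using integral_succ_mul hb k 1

theorem integral_Iic_succ {b : ℝ} (hb : 0 < b) (k : ℕ) (y : ℝ) :
    ∫ x in Set.Iic y, (gaussianPoly b (k + 1)).eval x * Real.exp (-b * x ^ 2)
      = -(1 / (2 * b)) * ((gaussianPoly b k).eval y * Real.exp (-b * y ^ 2)) := by
  have hderiv := hasDerivAt_mul_exp hb k 1
  have hInt := fun p => integrable_eval_mul_exp hb p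
  have h := integral_Iic_of_hasDerivAt_of_tendsto' (a := y) (fun x _ => hderiv x)
    (hInt _).integrableOn
    (tendsto_zero_of_hasDerivAt_of_integrableOn_Iic (a := y) (fun x _ => hderiv x)
      (hInt _).integrableOn (hInt _).integrableOn)
  simp only [derivative_one, mul_zero, add_zero, mul_one, eval_mul, eval_C, mul_assoc,
    integral_const_mul, sub_zero] at h
  rw [← h]
  field_simp

end gaussianPoly

/-- The interlacing of two blocks: merging a `Fin (n + 1)` block with a `Fin n` block, the element
`i` of the first block takes position `2 * i` and the element `j` of the second block takes
position `2 * j + 1`. -/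
noncomputable def interlaceEquiv (n : ℕ) : Fin (n + 1) ⊕ Fin n ≃ Fin (n + 1 + n) :=
  Equiv.ofBijective
    (Sum.elim (fun i => ⟨2 * i, by omega⟩) (fun j => ⟨2 * j + 1, by omega⟩)) <| by
    rw [Fintype.bijective_iff_injective_and_card]
    refine ⟨?_, by simp⟩
    rintro (i | i) (j | j) h <;> simp [Fin.ext_iff] at h ⊢ <;> omega

@[simp]
theorem interlaceEquiv_inl {n : ℕ} (i : Fin (n + 1)) :
    (interlaceEquiv n (Sum.inl i) : ℕ) = 2 * i := rfl

@[simp]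
theorem interlaceEquiv_inr {n : ℕ} (j : Fin n) :
    (interlaceEquiv n (Sum.inr j) : ℕ) = 2 * j + 1 := rfl

open Matrix in
/-- The matrix with columns `1, v, …, v ^ n` followed by `ε, ε * v, …, ε * v ^ (n - 1)`. -/
def signedVandermonde {n : ℕ} (ε v : Fin (n + 1) ⊕ Fin n → ℝ) :
    Matrix (Fin (n + 1) ⊕ Fin n) (Fin (n + 1) ⊕ Fin n) ℝ :=
  Matrix.of fun r => Sum.elim (fun k => v r ^ (k : ℕ)) (fun k => ε r * v r ^ (k : ℕ))

open Matrix in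
theorem det_signedVandermonde_alternating {n : ℕ} (v : Fin (n + 1) ⊕ Fin n → ℝ) :
    (signedVandermonde (Sum.elim (fun _ => 1) (fun _ => -1)) v).det
      = (-2) ^ n * ((vandermonde (v ∘ Sum.inl)).det * (vandermonde (v ∘ Sum.inr)).det) := by
  let P : Matrix (Fin (n + 1)) (Fin n) ℝ := Matrix.of fun i j => if i = j.castSucc then 1 else 0
  have hP : (fromBlocks (1 : Matrix (Fin (n + 1)) (Fin (n + 1)) ℝ) (-P) 0
      (1 : Matrix (Fin n) (Fin n) ℝ)).det = 1 := by simp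
  have hM : signedVandermonde (Sum.elim (fun _ => 1) (fun _ => -1)) v
      * fromBlocks (1 : Matrix (Fin (n + 1)) (Fin (n + 1)) ℝ) (-P) 0 1
      = fromBlocks (vandermonde (v ∘ Sum.inl)) 0
          (Matrix.of fun i k => v (Sum.inr i) ^ (k : ℕ))
          ((-2 : ℝ) • vandermonde (v ∘ Sum.inr)) := by
    ext (r | r) (c | c)
    · simp [signedVandermonde, Matrix.mul_apply, Matrix.one_apply, vandermonde_apply]
    · simp [signedVandermonde, Matrix.mul_apply, Matrix.one_apply, P]
    · simp [signedVandermonde, Matrix.mul_apply, Matrix.one_apply]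
    · simp [signedVandermonde, Matrix.mul_apply, Matrix.one_apply, vandermonde_apply, P]
      ring
  have := congrArg Matrix.det hM
  rw [det_mul, hP, mul_one, det_fromBlocks_zero₁₂, det_smul, Fintype.card_fin] at this
  rw [this]
  ring

open Matrix in
theorem factorial_mul_det_signedVandermonde {n : ℕ} (ε v : Fin (n + 1) ⊕ Fin n → ℝ) :
    ((n + 1).factorial * n.factorial : ℝ) * (signedVandermonde ε v).det
      = ∑ σ : Equiv.Perm (Fin (n + 1) ⊕ Fin n), (Equiv.Perm.sign σ : ℝ) *
          ((∏ k, ε (σ (Sum.inr k))) *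
          ((vandermonde (v ∘ σ ∘ Sum.inl)).det * (vandermonde (v ∘ σ ∘ Sum.inr)).det)) := by
  have key : ∀ τ : Equiv.Perm (Fin (n + 1)) × Equiv.Perm (Fin n),
      (signedVandermonde ε v).det = ∑ σ : Equiv.Perm (Fin (n + 1) ⊕ Fin n),
        (Equiv.Perm.sign σ : ℝ) * ((∏ k, ε (σ (Sum.inr k))) *
          (((Equiv.Perm.sign τ.1 : ℝ) * ∏ k, v (σ (Sum.inl (τ.1 k))) ^ (k : ℕ)) *
            ((Equiv.Perm.sign τ.2 : ℝ) * ∏ k, v (σ (Sum.inr (τ.2 k))) ^ (k : ℕ)))) := by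
    intro τ
    rw [det_apply', ← Equiv.sum_comp (Equiv.mulRight (Equiv.Perm.sumCongr τ.1 τ.2))]
    refine Finset.sum_congr rfl fun σ _ => ?_
    rw [← Equiv.prod_comp τ.2 (fun k => ε (σ (Sum.inr k)))]
    simp only [Equiv.coe_mulRight, Equiv.Perm.sign_mul, Equiv.Perm.sign_sumCongr,
      Fintype.prod_sum_type, signedVandermonde, Equiv.Perm.coe_mul, Function.comp_apply,
      Matrix.of_apply, Sum.elim_inl, Sum.elim_inr, Equiv.Perm.sumCongr_apply, Sum.map_inl,
      Sum.map_inr, Finset.prod_mul_distrib]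
    push_cast
    ring
  have hsum := Finset.sum_congr (rfl : (Finset.univ : Finset
    (Equiv.Perm (Fin (n + 1)) × Equiv.Perm (Fin n))) = _) fun τ _ => key τ
  rw [Finset.sum_const, Finset.sum_comm] at hsum
  simp only [Finset.card_univ, Fintype.card_prod, Fintype.card_perm, Fintype.card_fin,
    nsmul_eq_mul] at hsum
  push_cast at hsum
  rw [hsum]
  refine Finset.sum_congr rfl fun σ _ => ?_
  rw [← Finset.mul_sum, ← Finset.mul_sum]
  congr 2
  rw [det_apply', det_apply', Finset.sum_mul_sum, Fintype.sum_prod_type]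
  simp [vandermonde_apply]

/-- The product of the signs of `w i - w j` over ordered pairs `i ≠ j` does not depend on `w`. -/
theorem prod_prod_sign_sub {n : ℕ} {w : Fin n → ℝ} (hw : Function.Injective w) :
    ∏ i, ∏ j ∈ ({i}ᶜ : Finset (Fin n)), SignType.sign (w i - w j)
      = ∏ i : Fin n, ∏ _j ∈ Finset.Ioi i, (-1 : SignType) := by
  rw [← Finset.prod_comm' (s := univ) (t := fun i => {i}ᶜ) (t' := univ) (s' := fun i => {i}ᶜ)
    (f := fun i j => SignType.sign (w j - w i))
    (by intro x y; simp [eq_comm]),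
   ← Finset.prod_prod_Ioi_mul_eq_prod_prod_off_diag (fun i j => SignType.sign (w i - w j))]
  refine Finset.prod_congr rfl fun i _ => Finset.prod_congr rfl fun j hj => ?_
  have hij : w i ≠ w j := hw.ne (Finset.mem_Ioi.1 hj).ne
  rw [← neg_sub (w i) (w j), Left.sign_neg]
  rcases lt_or_gt_of_ne hij with h | h
  · rw [sign_neg (sub_neg.2 h)]; rfl
  · rw [sign_pos (sub_pos.2 h)]; rfl

open Matrix in
theorem det_vandermonde_castAdd_natAdd {R : Type*} [CommRing R] {m n : ℕ} (u : Fin (m + n) → R) :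
    (vandermonde u).det = (vandermonde (u ∘ Fin.castAdd n)).det
      * (vandermonde (u ∘ Fin.natAdd m)).det
      * ∏ j : Fin n, ∏ i : Fin m, (u (Fin.natAdd m j) - u (Fin.castAdd n i)) := by
  have h : ∀ {N : ℕ} (w : Fin N → R), (vandermonde w).det
      = ∏ i, ∏ j, if i < j then w j - w i else 1 := by
    intro N w
    rw [det_vandermonde]
    refine Finset.prod_congr rfl fun i _ => ?_
    rw [Finset.prod_ite]
    simp [Finset.filter_lt_eq_Ioi]
  simp only [h, Fin.prod_univ_add, Finset.prod_mul_distrib]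
  have h1 : ∀ (i : Fin m) (j : Fin n), Fin.castAdd n i < Fin.natAdd m j := fun i j => by
    simp [Fin.lt_def]; omega
  have h2 : ∀ (i : Fin m) (j : Fin n), ¬ Fin.natAdd m j < Fin.castAdd n i := fun i j => by
    simp [Fin.lt_def]; omega
  have h3 : ∀ (i j : Fin n), Fin.natAdd m i < Fin.natAdd m j ↔ i < j := fun i j => by
    simp
  have h4 : ∀ (i j : Fin m), Fin.castAdd n i < Fin.castAdd n j ↔ i < j := fun i j => Iff.rfl
  simp only [h1, h2, h3, h4, if_true, if_false, Function.comp_apply, Finset.prod_const_one]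
  rw [Finset.prod_comm (s := (univ : Finset (Fin m))) (t := (univ : Finset (Fin n)))]
  ring

open Matrix in
theorem det_vandermonde_comp_perm {R : Type*} [CommRing R] {N : ℕ} (u : Fin N → R)
    (σ : Equiv.Perm (Fin N)) :
    (vandermonde (u ∘ σ)).det = (Equiv.Perm.sign σ : R) * (vandermonde u).det := by
  rw [← det_permute σ]
  rfl

open Matrix in
theorem det_vandermonde_sum_comp_perm {R : Type*} [CommRing R] {m n : ℕ}
    (v : Fin m ⊕ Fin n → R) (σ : Equiv.Perm (Fin m ⊕ Fin n)) :
    (vandermonde (v ∘ σ ∘ Sum.inl)).det * (vandermonde (v ∘ σ ∘ Sum.inr)).det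
        * ∏ j : Fin n, ∏ i : Fin m, (v (σ (Sum.inr j)) - v (σ (Sum.inl i)))
      = (Equiv.Perm.sign σ : R) * (vandermonde (v ∘ finSumFinEquiv.symm)).det := by
  have h := det_vandermonde_castAdd_natAdd (v ∘ σ ∘ finSumFinEquiv.symm)
  have h2 := det_vandermonde_comp_perm (v ∘ finSumFinEquiv.symm)
    (finSumFinEquiv.permCongr σ)
  rw [Equiv.Perm.sign_permCongr] at h2
  rw [← h2]
  have h3 : (v ∘ finSumFinEquiv.symm) ∘ (finSumFinEquiv.permCongr σ)
      = v ∘ σ ∘ finSumFinEquiv.symm := by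
    ext i; simp [Equiv.permCongr_apply]
  rw [h3, h]
  have h4 : finSumFinEquiv.symm ∘ Fin.castAdd n = (Sum.inl : Fin m → Fin m ⊕ Fin n) := by
    ext i; simp
  have h5 : finSumFinEquiv.symm ∘ Fin.natAdd m = (Sum.inr : Fin n → Fin m ⊕ Fin n) := by
    ext i; simp
  simp [Function.comp_assoc, h4, h5]

/-- The product of the signs of `v r - v r'` over all `r' ≠ r`. -/
noncomputable def rankSign {ι : Type*} [Fintype ι] [DecidableEq ι] (v : ι → ℝ) (r : ι) :
    SignType :=
  ∏ r' ∈ ({r}ᶜ : Finset ι), SignType.sign (v r - v r')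

theorem prod_rankSign_inr {m n : ℕ} {v : Fin m ⊕ Fin n → ℝ} (hv : Function.Injective v)
    (σ : Equiv.Perm (Fin m ⊕ Fin n)) :
    ∏ k, rankSign v (σ (Sum.inr k)) = (∏ i : Fin n, ∏ _j ∈ Finset.Ioi i, (-1 : SignType)) *
      SignType.sign (∏ k : Fin n, ∏ i : Fin m, (v (σ (Sum.inr k)) - v (σ (Sum.inl i)))) := by
  have h : ∀ k : Fin n, rankSign v (σ (Sum.inr k))
      = (∏ j ∈ ({k}ᶜ : Finset (Fin n)),
          SignType.sign ((v ∘ σ ∘ Sum.inr) k - (v ∘ σ ∘ Sum.inr) j))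
        * SignType.sign (∏ i : Fin m, (v (σ (Sum.inr k)) - v (σ (Sum.inl i)))) := by
    intro k
    have h1 : ∀ g : Fin n → SignType,
        ∏ j ∈ ({k}ᶜ : Finset (Fin n)), g j = ∏ j, if j = k then 1 else g j := by
      intro g
      rw [Finset.prod_ite]
      simp [Finset.filter_not, Finset.compl_eq_univ_sdiff, Finset.filter_eq']
    rw [rankSign, Finset.prod_subset_one_on_sdiff (g := fun r' => if r' = σ (Sum.inr k) then 1
        else SignType.sign (v (σ (Sum.inr k)) - v r')) (Finset.subset_univ _) (by simp)
        (by intro x hx; simp at hx; simp [hx]),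
      ← Equiv.prod_comp σ, Fintype.prod_sum_type, mul_comm, h1, ← signHom_apply, map_prod]
    simp
  simp only [h, Finset.prod_mul_distrib]
  congr 1
  · exact prod_prod_sign_sub (hv.comp (σ.injective.comp Sum.inr_injective))
  · simp [← signHom_apply, map_prod]

open Matrix in
theorem sum_perm_abs_det_vandermonde {n : ℕ} {v : Fin (n + 1) ⊕ Fin n → ℝ}
    (hv : Function.Injective v) :
    ∑ σ : Equiv.Perm (Fin (n + 1) ⊕ Fin n),
        |(vandermonde (v ∘ σ ∘ Sum.inl)).det * (vandermonde (v ∘ σ ∘ Sum.inr)).det|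
      = ((n + 1).factorial * n.factorial : ℝ) *
          |(signedVandermonde (fun r => (rankSign v r : ℝ)) v).det| := by
  set K : SignType := ∏ i : Fin n, ∏ _j ∈ Finset.Ioi i, (-1 : SignType) with hK
  set V : ℝ := (vandermonde (v ∘ finSumFinEquiv.symm)).det with hV
  have hV0 : V ≠ 0 := det_vandermonde_ne_zero_iff.2 (hv.comp (Equiv.injective _))
  have hterm : ∀ σ : Equiv.Perm (Fin (n + 1) ⊕ Fin n),
      (Equiv.Perm.sign σ : ℝ) * ((∏ k, (rankSign v (σ (Sum.inr k)) : ℝ)) *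
          ((vandermonde (v ∘ σ ∘ Sum.inl)).det * (vandermonde (v ∘ σ ∘ Sum.inr)).det))
      = ((K * SignType.sign V : SignType) : ℝ) *
        |(vandermonde (v ∘ σ ∘ Sum.inl)).det * (vandermonde (v ∘ σ ∘ Sum.inr)).det| := by
    intro σ
    set a := (vandermonde (v ∘ σ ∘ Sum.inl)).det * (vandermonde (v ∘ σ ∘ Sum.inr)).det
    set c := ∏ k : Fin n, ∏ i : Fin (n + 1), (v (σ (Sum.inr k)) - v (σ (Sum.inl i)))
    have hac : a * c = (Equiv.Perm.sign σ : ℝ) * V := det_vandermonde_sum_comp_perm v σ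
    have hp : ∏ k, (rankSign v (σ (Sum.inr k)) : ℝ) = ((K * SignType.sign c : SignType) : ℝ) := by
      rw [← prod_rankSign_inr hv σ]
      exact (map_prod (SignType.castHom (α := ℝ)) _ _).symm
    have hs : (SignType.sign a : ℝ) * (SignType.sign c : ℝ)
        = (Equiv.Perm.sign σ : ℝ) * (SignType.sign V : ℝ) := by
      have h := congrArg (fun x => (SignType.sign x : ℝ)) hac
      simp only [sign_mul, SignType.coe_mul] at h
      rw [h]
      rcases Int.units_eq_one_or (Equiv.Perm.sign σ) with h1 | h1 <;> simp [h1]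
    have hss : (Equiv.Perm.sign σ : ℝ) * (Equiv.Perm.sign σ : ℝ) = 1 := by
      rcases Int.units_eq_one_or (Equiv.Perm.sign σ) with h1 | h1 <;> simp [h1]
    rw [hp]
    conv_lhs => rw [← sign_mul_abs a]
    push_cast
    linear_combination ((Equiv.Perm.sign σ : ℝ) * K * |a|) * hs
      + ((K : ℝ) * SignType.sign V * |a|) * hss
  have hfac := factorial_mul_det_signedVandermonde (fun r => (rankSign v r : ℝ)) v
  simp only [hterm, ← Finset.mul_sum] at hfac
  have hKV : |((K * SignType.sign V : SignType) : ℝ)| = 1 := by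
    have hne : K * SignType.sign V ≠ 0 := by
      refine mul_ne_zero ?_ (by simpa using hV0)
      exact Finset.prod_ne_zero_iff.2 fun _ _ => Finset.prod_ne_zero_iff.2 fun _ _ => by decide
    generalize K * SignType.sign V = s at hne
    cases s <;> simp_all
  have := congrArg abs hfac
  rw [abs_mul, abs_mul _ (∑ _, _), hKV, one_mul, abs_of_nonneg (by positivity)] at this
  rw [this, abs_of_nonneg (Finset.sum_nonneg fun _ _ => abs_nonneg _)]

theorem rankSign_comp_interlaceEquiv {n : ℕ} {z : Fin (n + 1 + n) → ℝ} (hz : StrictMono z)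
    (r : Fin (n + 1) ⊕ Fin n) :
    (rankSign (z ∘ interlaceEquiv n) r : ℝ) = Sum.elim (fun _ => 1) (fun _ => -1) r := by
  have h : rankSign (z ∘ interlaceEquiv n) r
      = (-1 : SignType) ^ (n + 1 + n - 1 - (interlaceEquiv n r : ℕ)) := by
    rw [rankSign, ← Fin.card_Ioi, ← Finset.prod_const]
    refine (Finset.prod_map ({r}ᶜ) (interlaceEquiv n).toEmbedding
      (fun p => SignType.sign ((z ∘ interlaceEquiv n) r - z p))).symm.trans ?_
    symm
    refine Finset.prod_subset_one_on_sdiff ?_ ?_ ?_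
    · intro p hp
      simp only [Finset.mem_map_equiv, Finset.mem_compl, Finset.mem_singleton]
      intro h
      rw [← h] at hp
      simp at hp
    · intro p hp
      simp only [Finset.mem_sdiff, Finset.mem_map_equiv, Finset.mem_compl, Finset.mem_singleton,
        Finset.mem_Ioi, not_lt] at hp
      refine sign_pos (sub_pos.2 (hz (lt_of_le_of_ne hp.2 ?_)))
      rintro rfl
      simp at hp
    · intro p hp
      exact (sign_neg (sub_neg.2 (hz (Finset.mem_Ioi.1 hp)))).symm
  rw [h]
  rcases r with i | j
  · have : Even (n + 1 + n - 1 - (interlaceEquiv n (Sum.inl i) : ℕ)) := by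
      rw [Nat.even_iff, interlaceEquiv_inl]; omega
    rw [this.neg_one_pow]; simp
  · have : Odd (n + 1 + n - 1 - (interlaceEquiv n (Sum.inr j) : ℕ)) := by
      rw [Nat.odd_iff, interlaceEquiv_inr]; omega
    rw [this.neg_one_pow]; simp

open Matrix in
theorem sum_perm_abs_det_vandermonde_of_strictMono {n : ℕ} {z : Fin (n + 1 + n) → ℝ}
    (hz : StrictMono z) :
    ∑ σ : Equiv.Perm (Fin (n + 1 + n)),
        |(vandermonde (z ∘ σ ∘ interlaceEquiv n ∘ Sum.inl)).det
          * (vandermonde (z ∘ σ ∘ interlaceEquiv n ∘ Sum.inr)).det|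
      = ((n + 1).factorial * n.factorial * 2 ^ n : ℝ) *
          |(vandermonde (z ∘ interlaceEquiv n ∘ Sum.inl)).det
            * (vandermonde (z ∘ interlaceEquiv n ∘ Sum.inr)).det| := by
  have h := sum_perm_abs_det_vandermonde (v := z ∘ interlaceEquiv n)
    (hz.injective.comp (Equiv.injective _))
  simp only [funext (rankSign_comp_interlaceEquiv hz)] at h
  rw [det_signedVandermonde_alternating, abs_mul, abs_pow] at h
  rw [← Equiv.sum_comp (interlaceEquiv n).permCongr]
  convert h using 1
  · refine Finset.sum_congr rfl fun σ _ => ?_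
    have : ∀ s : Fin (n + 1) ⊕ Fin n, (interlaceEquiv n).permCongr σ (interlaceEquiv n s)
        = interlaceEquiv n (σ s) := fun s => by simp [Equiv.permCongr_apply]
    simp only [Function.comp_def, this]
  · simp only [abs_neg, Nat.abs_ofNat, Function.comp_assoc]
    ring

theorem measurableSet_strictMono (n : ℕ) : MeasurableSet {z : Fin n → ℝ | StrictMono z} := by
  have : {z : Fin n → ℝ | StrictMono z} = ⋂ (i : Fin n) (j : Fin n) (_ : i < j),
      {z | z i < z j} := by
    ext z
    simp [StrictMono]
  rw [this]
  exact MeasurableSet.iInter fun i => MeasurableSet.iInter fun j => MeasurableSet.iInter fun _ =>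
    measurableSet_lt (measurable_pi_apply i) (measurable_pi_apply j)

theorem ae_injective (n : ℕ) : ∀ᵐ z : Fin n → ℝ, Function.Injective z := by
  have h : ∀ i j : Fin n, i ≠ j → ∀ᵐ z : Fin n → ℝ, z i ≠ z j := by
    intro i j hij
    let p : Submodule ℝ (Fin n → ℝ) := LinearMap.ker
      ((LinearMap.proj i : (Fin n → ℝ) →ₗ[ℝ] ℝ) - LinearMap.proj j)
    have hp : p ≠ ⊤ := by
      intro h
      have : Pi.single i (1 : ℝ) ∈ p := h ▸ Submodule.mem_top
      simp [p, hij.symm] at this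
    have h0 := Measure.addHaar_submodule (volume : Measure (Fin n → ℝ)) p hp
    filter_upwards [measure_eq_zero_iff_ae_notMem.1 h0] with z hz hzz
    exact hz (by simp [p, hzz])
  have h2 : ∀ᵐ z : Fin n → ℝ, ∀ i j : Fin n, i ≠ j → z i ≠ z j := by
    rw [ae_all_iff]; intro i
    rw [ae_all_iff]; intro j
    by_cases hij : i = j
    · simp [hij]
    · filter_upwards [h i j hij] with z hz _ using hz
  filter_upwards [h2] with z hz i j hij
  by_contra hne
  exact hz i j hne hij

theorem perm_eq_of_strictMono_comp {n : ℕ} {z : Fin n → ℝ} {σ τ : Equiv.Perm (Fin n)}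
    (hσ : StrictMono (z ∘ σ)) (hτ : StrictMono (z ∘ τ)) : σ = τ := by
  have hinj : Function.Injective z := by
    have := hσ.injective.comp σ.symm.injective
    simpa [Function.comp_assoc] using this
  have h := Tuple.unique_monotone hσ.monotone hτ.monotone
  exact Equiv.ext fun i => hinj (congrFun h i)

theorem measurePreserving_comp_perm {n : ℕ} (σ : Equiv.Perm (Fin n)) :
    MeasurePreserving (fun z : Fin n → ℝ => z ∘ σ) := by
  have := volume_measurePreserving_piCongrLeft (fun _ : Fin n => ℝ) σ.symm
  have heq : (fun z : Fin n → ℝ => z ∘ σ)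
      = MeasurableEquiv.piCongrLeft (fun _ : Fin n => ℝ) σ.symm := by
    funext z i
    obtain ⟨j, rfl⟩ := σ.symm.surjective i
    rw [MeasurableEquiv.coe_piCongrLeft, Equiv.piCongrLeft_apply_apply]
    simp
  rwa [heq]

theorem integral_eq_setIntegral_strictMono_sum_perm {n : ℕ} {F : (Fin n → ℝ) → ℝ}
    (hF : Integrable F) :
    ∫ z, F z = ∫ z in {z | StrictMono z}, ∑ σ : Equiv.Perm (Fin n), F (z ∘ σ) := by
  have hmp := fun σ : Equiv.Perm (Fin n) => measurePreserving_comp_perm σ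
  have hemb : ∀ σ : Equiv.Perm (Fin n),
      MeasurableEmbedding (fun z : Fin n → ℝ => z ∘ σ) := fun σ =>
    (MeasurableEquiv.mk ⟨fun z => z ∘ σ, fun z => z ∘ σ.symm,
      fun z => by ext; simp, fun z => by ext; simp⟩ (hmp σ).measurable
      (hmp σ.symm).measurable).measurableEmbedding
  have hInt : ∀ σ : Equiv.Perm (Fin n), Integrable fun z : Fin n → ℝ => F (z ∘ σ) :=
    fun σ => (hmp σ).integrable_comp_of_integrable hF
  rw [integral_finsetSum _ fun σ _ => (hInt σ).integrableOn]
  let S : Equiv.Perm (Fin n) → Set (Fin n → ℝ) := fun σ => {z | StrictMono (z ∘ σ.symm)}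
  have hS : ∀ σ : Equiv.Perm (Fin n), ∫ z in {z | StrictMono z}, F (z ∘ σ) = ∫ z in S σ, F z := by
    intro σ
    rw [← (hmp σ).setIntegral_preimage_emb (hemb σ) F (S σ)]
    congr 2
    ext z
    simp [S, Function.comp_assoc]
  simp only [hS]
  have hSm : ∀ σ, MeasurableSet (S σ) := fun σ =>
    (hmp σ.symm).measurable (measurableSet_strictMono n)
  rw [← integral_iUnion_fintype hSm ?_ fun σ => hF.integrableOn]
  · rw [← setIntegral_univ]
    refine setIntegral_congr_set ?_
    symm
    rw [ae_eq_univ, measure_eq_zero_iff_ae_notMem]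
    filter_upwards [ae_injective n] with z hz
    simp only [Set.mem_compl_iff, not_not, Set.mem_iUnion]
    refine ⟨(Tuple.sort z).symm, ?_⟩
    exact (Tuple.monotone_sort z).strictMono_of_injective (hz.comp (Equiv.injective _))
  · intro σ τ hne
    refine Set.disjoint_left.2 fun z hσ hτ => hne ?_
    exact Equiv.symm_bijective.injective (perm_eq_of_strictMono_comp hσ hτ)

section Determinants

open Matrix

theorem integrable_det_of_coordinates {ι : Type*} [Fintype ι] [DecidableEq ι]
    {g : ι → ι → ℝ → ℝ} (hg : ∀ i k, Integrable (g i k)) :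
    Integrable fun x : ι → ℝ => (Matrix.of fun i k => g i k (x i)).det := by
  simp only [← det_transpose (Matrix.of _), det_apply', transpose_apply, of_apply]
  exact integrable_finsetSum _ fun σ _ =>
    (Integrable.fintype_prod_dep fun i => hg i (σ i)).const_mul _

theorem integral_det_of_coordinates {ι : Type*} [Fintype ι] [DecidableEq ι]
    {g : ι → ι → ℝ → ℝ} (hg : ∀ i k, Integrable (g i k)) :
    ∫ x : ι → ℝ, (Matrix.of fun i k => g i k (x i)).det
      = (Matrix.of fun i k => ∫ t, g i k t).det := by
  simp only [← det_transpose (Matrix.of _), det_apply', transpose_apply, of_apply]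
  rw [integral_finsetSum _ fun σ _ =>
    (Integrable.fintype_prod_dep fun i => hg i (σ i)).const_mul _]
  refine Finset.sum_congr rfl fun σ _ => ?_
  rw [integral_const_mul, integral_fintype_prod_volume_eq_prod (fun i => g i (σ i))]

theorem det_vandermonde_eq_det_gaussianPoly (b : ℝ) {n : ℕ} (v : Fin n → ℝ) :
    (vandermonde v).det
      = (Matrix.of fun i k : Fin n => (gaussianPoly b k).eval (v i)).det :=
  det_eval_matrixOfPolynomials_eq_det_vandermonde v (fun k => gaussianPoly b k)
    (fun k => gaussianPoly.natDegree_eq b k) (fun k => gaussianPoly.monic b k)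

theorem det_mul_rows {n : ℕ} (c : Fin n → ℝ) (g : Fin n → Fin n → ℝ) :
    (Matrix.of fun i k => g i k * c i).det = (Matrix.of g).det * ∏ i, c i := by
  have := det_mul_column c (Matrix.of g)
  rw [mul_comm, ← this]
  congr 1
  ext i k
  simp [mul_comm]

theorem integrable_det_vandermonde_mul_exp {b : ℝ} (hb : 0 < b) (n : ℕ) :
    Integrable fun v : Fin n → ℝ =>
      (vandermonde v).det * ∏ i, Real.exp (-b * v i ^ 2) := by
  simp only [det_vandermonde_eq_det_gaussianPoly b, ← det_mul_rows]
  exact integrable_det_of_coordinates (g := fun (_ k : Fin n) t =>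
      (gaussianPoly b k).eval t * Real.exp (-b * t ^ 2))
    fun i k => gaussianPoly.integrable_eval_mul_exp hb _

theorem integrable_and_integral_det_vandermonde_sq_mul_exp {b : ℝ} (hb : 0 < b) (n : ℕ) :
    Integrable (fun v : Fin n → ℝ =>
        (vandermonde v).det ^ 2 * ∏ i, Real.exp (-b * v i ^ 2)) ∧
    ∫ v : Fin n → ℝ, (vandermonde v).det ^ 2 * ∏ i, Real.exp (-b * v i ^ 2)
      = n.factorial * ∏ k ∈ Finset.range n,
          ((1 / (2 * b)) ^ k * (k.factorial * √(Real.pi / b))) := by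
  let f : ℕ → ℕ → ℝ → ℝ := fun j k t =>
    (gaussianPoly b j).eval t * (gaussianPoly b k).eval t * Real.exp (-b * t ^ 2)
  have hf : ∀ j k, Integrable (f j k) := fun j k => by
    simpa [f] using gaussianPoly.integrable_eval_mul_exp hb (gaussianPoly b j * gaussianPoly b k)
  have hexp : ∀ v : Fin n → ℝ, (vandermonde v).det ^ 2 * ∏ i, Real.exp (-b * v i ^ 2)
      = ∑ σ : Equiv.Perm (Fin n), ∑ τ : Equiv.Perm (Fin n),
        ((Equiv.Perm.sign σ : ℝ) * (Equiv.Perm.sign τ : ℝ)) * ∏ i, f (σ i) (τ i) (v i) := by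
    intro v
    rw [sq, det_vandermonde_eq_det_gaussianPoly b, ← det_transpose, det_apply',
      Finset.sum_mul_sum, Finset.sum_mul]
    refine Finset.sum_congr rfl fun σ _ => ?_
    rw [Finset.sum_mul]
    refine Finset.sum_congr rfl fun τ _ => ?_
    simp only [transpose_apply, of_apply, f, Finset.prod_mul_distrib]
    ring
  have hInt : ∀ σ τ : Equiv.Perm (Fin n), Integrable fun v : Fin n → ℝ =>
      ((Equiv.Perm.sign σ : ℝ) * (Equiv.Perm.sign τ : ℝ)) * ∏ i, f (σ i) (τ i) (v i) :=
    fun σ τ => (Integrable.fintype_prod_dep fun i => hf (σ i) (τ i)).const_mul _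
  simp only [hexp]
  refine ⟨integrable_finsetSum _ fun σ _ => integrable_finsetSum _ fun τ _ => hInt σ τ, ?_⟩
  rw [integral_finsetSum _ fun σ _ => integrable_finsetSum _ fun τ _ => hInt σ τ]
  have hterm : ∀ σ : Equiv.Perm (Fin n),
      ∫ v : Fin n → ℝ, ∑ τ : Equiv.Perm (Fin n),
        ((Equiv.Perm.sign σ : ℝ) * (Equiv.Perm.sign τ : ℝ)) * ∏ i, f (σ i) (τ i) (v i)
      = ∏ k ∈ Finset.range n, ((1 / (2 * b)) ^ k * (k.factorial * √(Real.pi / b))) := by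
    intro σ
    rw [integral_finsetSum _ fun τ _ => hInt σ τ, Finset.sum_eq_single σ]
    · rw [integral_const_mul, integral_fintype_prod_volume_eq_prod (fun i : Fin n =>
        f (σ i) (σ i)), Equiv.prod_comp σ (fun i : Fin n => ∫ t, f i i t), Finset.prod_range]
      have : (Equiv.Perm.sign σ : ℝ) * (Equiv.Perm.sign σ : ℝ) = 1 := by
        rcases Int.units_eq_one_or (Equiv.Perm.sign σ) with h1 | h1 <;> simp [h1]
      rw [this, one_mul]
      exact Finset.prod_congr rfl fun i _ => gaussianPoly.integral_mul_self hb i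
    · intro τ _ hne
      obtain ⟨i, hi⟩ : ∃ i, σ i ≠ τ i := by
        by_contra! h
        exact hne (Equiv.ext h).symm
      rw [integral_const_mul, integral_fintype_prod_volume_eq_prod (fun i : Fin n =>
        f (σ i) (τ i)), Finset.prod_eq_zero (Finset.mem_univ i), mul_zero]
      exact gaussianPoly.integral_mul_eq_zero hb (Fin.val_injective.ne hi)
    · simp
  simp only [hterm, Finset.sum_const, Finset.card_univ, Fintype.card_perm, Fintype.card_fin,
    nsmul_eq_mul]

end Determinants

/-- The points lying strictly between the entries of `y` with index `< i` and those with
index `≥ i`. -/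
def interlacingGap {n : ℕ} (y : Fin n → ℝ) (i : Fin (n + 1)) : Set ℝ :=
  {t | (∀ j : Fin n, j.castSucc < i → y j < t) ∧ ∀ j : Fin n, i ≤ j.castSucc → t < y j}

theorem measurableSet_interlacingGap {n : ℕ} (y : Fin n → ℝ) (i : Fin (n + 1)) :
    MeasurableSet (interlacingGap y i) := by
  have : interlacingGap y i = (⋂ (j : Fin n) (_ : j.castSucc < i), Set.Ioi (y j)) ∩
      ⋂ (j : Fin n) (_ : i ≤ j.castSucc), Set.Iio (y j) := by
    ext t; simp [interlacingGap]
  rw [this]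
  exact (MeasurableSet.iInter fun j => MeasurableSet.iInter fun _ => measurableSet_Ioi).inter
    (MeasurableSet.iInter fun j => MeasurableSet.iInter fun _ => measurableSet_Iio)

theorem strictMono_interlace_iff {n : ℕ} (x : Fin (n + 1) → ℝ) (y : Fin n → ℝ) :
    StrictMono (Sum.elim x y ∘ (interlaceEquiv n).symm)
      ↔ StrictMono y ∧ ∀ i, x i ∈ interlacingGap y i := by
  have h : StrictMono (Sum.elim x y ∘ (interlaceEquiv n).symm) ↔
      ∀ r s, interlaceEquiv n r < interlaceEquiv n s → Sum.elim x y r < Sum.elim x y s := by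
    constructor
    · intro h r s hrs
      simpa using h hrs
    · intro h p q hpq
      exact h _ _ (by simpa using hpq)
  rw [h]
  simp only [Fin.lt_def]
  constructor
  · intro h
    refine ⟨fun i j hij => ?_, fun i => ⟨fun j hj => ?_, fun j hj => ?_⟩⟩
    · exact h (Sum.inr i) (Sum.inr j) (by have : (i : ℕ) < j := hij
                                          simp; omega)
    · exact h (Sum.inr j) (Sum.inl i) (by have : (j : ℕ) < i := hj
                                          simp; omega)
    · exact h (Sum.inl i) (Sum.inr j) (by have : (i : ℕ) ≤ j := hj
                                          simp; omega)
  · rintro ⟨hy, hx⟩ (i | i) (j | j) hij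
    · simp only [interlaceEquiv_inl] at hij
      have hi : (i : ℕ) < n := by omega
      exact ((hx i).2 ⟨i, hi⟩ le_rfl).trans
        ((hx j).1 ⟨i, hi⟩ (by simp only [Fin.lt_def, Fin.val_castSucc]; omega))
    · simp only [interlaceEquiv_inl, interlaceEquiv_inr] at hij
      exact (hx i).2 j (by simp only [Fin.le_def, Fin.val_castSucc]; omega)
    · simp only [interlaceEquiv_inl, interlaceEquiv_inr] at hij
      exact (hx j).1 i (by simp only [Fin.lt_def, Fin.val_castSucc]; omega)
    · simp only [interlaceEquiv_inr] at hij
      exact hy (by simp only [Fin.lt_def]; omega)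

open Matrix in
theorem det_vandermonde_nonneg {n : ℕ} {v : Fin n → ℝ} (hv : Monotone v) :
    0 ≤ (vandermonde v).det := by
  rw [det_vandermonde]
  exact Finset.prod_nonneg fun i _ => Finset.prod_nonneg fun j hj =>
    sub_nonneg.2 (hv (Finset.mem_Ioi.1 hj).le)

open Matrix in
theorem det_setIntegral_interlacingGap {n : ℕ} {y : Fin n → ℝ} (hy : StrictMono y)
    {g : Fin (n + 1) → ℝ → ℝ} (hg : ∀ k, Integrable (g k)) :
    (Matrix.of fun i k => ∫ t in interlacingGap y i, g k t).det
      = (Matrix.of fun (i : Fin (n + 1)) k =>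
          Fin.lastCases (motive := fun _ => ℝ) (∫ t, g k t) (fun j => ∫ t in Set.Iic (y j), g k t)
            i).det := by
  let U : Fin (n + 1) → Set ℝ := fun i => {t | ∀ j : Fin n, i ≤ j.castSucc → t < y j}
  have hUlast : U (Fin.last n) = Set.univ := by
    ext t
    simp only [U, Set.mem_ofPred_eq, Set.mem_univ, iff_true]
    intro j hj
    exact absurd hj (not_le.2 (Fin.castSucc_lt_last j))
  have hUcast : ∀ j : Fin n, U j.castSucc = Set.Iio (y j) := by
    intro j
    ext t
    simp only [U, Set.mem_ofPred_eq, Set.mem_Iio, Fin.castSucc_le_castSucc_iff]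
    exact ⟨fun h => h j le_rfl, fun h j' hj' => h.trans_le (hy.monotone hj')⟩
  have hrows : ∀ (i : Fin (n + 1)) k, (Fin.lastCases (motive := fun _ => ℝ) (∫ t, g k t)
      (fun j => ∫ t in Set.Iic (y j), g k t) i : ℝ) = ∫ t in U i, g k t := by
    intro i k
    induction i using Fin.lastCases with
    | last => simp [hUlast]
    | cast j => simp [hUcast, integral_Iic_eq_integral_Iio]
  simp only [hrows]
  symm
  refine det_eq_of_forall_row_eq_smul_add_pred (fun _ => 1) (fun k => ?_) fun i k => ?_
  · have : interlacingGap y 0 = U 0 := by ext t; simp [interlacingGap, U]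
    simp [this]
  · have h1 : U i.castSucc = U i.succ ∩ Set.Iio (y i) := by
      rw [hUcast]
      ext t
      simp only [U, Set.mem_inter_iff, Set.mem_ofPred_eq, Set.mem_Iio]
      refine ⟨fun h => ⟨fun j hj => h.trans (hy ?_), h⟩, fun h => h.2⟩
      exact Fin.succ_le_castSucc_iff.1 hj
    have h2 : interlacingGap y i.succ = U i.succ ∩ Set.Ioi (y i) := by
      ext t
      simp only [interlacingGap, U, Set.mem_inter_iff, Set.mem_ofPred_eq, Set.mem_Ioi]
      refine ⟨fun h => ⟨h.2, h.1 i (Fin.castSucc_lt_succ)⟩, fun h => ⟨fun j hj => ?_, h.1⟩⟩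
      have hji : j ≤ i := Fin.castSucc_lt_succ_iff.1 hj
      exact (hy.monotone hji).trans_lt h.2
    have h3 : (U i.succ \ Set.Iio (y i) : Set ℝ) =ᵐ[volume] interlacingGap y i.succ := by
      rw [h2, Set.sdiff_eq, Set.compl_Iio]
      exact (Filter.EventuallyEq.refl _ _).inter Ioi_ae_eq_Ici.symm
    simp only [of_apply, one_mul]
    rw [← setIntegral_congr_set h3, h1, add_comm]
    exact (integral_inter_add_sdiff measurableSet_Iio (hg k).integrableOn).symm

open Matrix in
theorem integral_interlacing {n : ℕ} {y : Fin n → ℝ} (hy : StrictMono y) {b : ℝ} (hb : 0 < b) :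
    ∫ x in {x : Fin (n + 1) → ℝ | ∀ i, x i ∈ interlacingGap y i},
        (vandermonde x).det * ∏ i, Real.exp (-b * x i ^ 2)
      = √(Real.pi / b) * (1 / (2 * b)) ^ n *
          ((vandermonde y).det * ∏ i, Real.exp (-b * y i ^ 2)) := by
  let g : Fin (n + 1) → ℝ → ℝ := fun k t =>
    (gaussianPoly b k).eval t * Real.exp (-b * t ^ 2)
  have hg : ∀ k, Integrable (g k) := fun k => gaussianPoly.integrable_eval_mul_exp hb _
  have hmeas : MeasurableSet {x : Fin (n + 1) → ℝ | ∀ i, x i ∈ interlacingGap y i} := by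
    rw [Set.ofPred_forall]
    exact MeasurableSet.iInter fun i => measurable_pi_apply i (measurableSet_interlacingGap y i)
  have hind : ∀ x : Fin (n + 1) → ℝ,
      {x : Fin (n + 1) → ℝ | ∀ i, x i ∈ interlacingGap y i}.indicator
        (fun x => (vandermonde x).det * ∏ i, Real.exp (-b * x i ^ 2)) x
      = (Matrix.of fun i k => (interlacingGap y i).indicator (g k) (x i)).det := by
    intro x
    by_cases hx : ∀ i, x i ∈ interlacingGap y i
    · rw [Set.indicator_of_mem (by exact hx), det_vandermonde_eq_det_gaussianPoly b,
        ← det_mul_rows]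
      simp only [Set.indicator_of_mem (hx _), g]
    · rw [Set.indicator_of_notMem (by exact hx)]
      push Not at hx
      obtain ⟨i, hi⟩ := hx
      refine (det_eq_zero_of_row_eq_zero i fun k => ?_).symm
      simp [Set.indicator_of_notMem hi]
  rw [← integral_indicator hmeas]
  simp only [hind]
  rw [integral_det_of_coordinates
    (g := fun i k t => (interlacingGap y i).indicator (g k) t)
    (fun i k => (hg k).indicator (measurableSet_interlacingGap y i))]
  simp only [integral_indicator (measurableSet_interlacingGap y _)]
  rw [det_setIntegral_interlacingGap hy hg, det_succ_row _ (Fin.last n), Fin.sum_univ_succ,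
    Finset.sum_eq_zero]
  · have hsub : (Matrix.of fun (i : Fin (n + 1)) (k : Fin (n + 1)) =>
          (Fin.lastCases (motive := fun _ => ℝ) (∫ t, g k t)
            (fun j => ∫ t in Set.Iic (y j), g k t) i : ℝ)).submatrix
          (Fin.last n).succAbove (Fin.succAbove 0)
        = Matrix.of fun (i k : Fin n) => (gaussianPoly b k).eval (y i) *
            (-(1 / (2 * b)) * Real.exp (-b * y i ^ 2)) := by
      ext i k
      simp only [submatrix_apply, Fin.succAbove_last, Fin.succAbove_zero, of_apply,
        Fin.lastCases_castSucc, g, Fin.val_succ]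
      rw [gaussianPoly.integral_Iic_succ hb]
      ring
    rw [hsub, det_mul_rows _ fun i k : Fin n => (gaussianPoly b k).eval (y i),
      ← det_vandermonde_eq_det_gaussianPoly, Finset.prod_mul_distrib]
    have h0 : ∫ t, g 0 t = √(Real.pi / b) := by
      simp [g, gaussianPoly, ← integral_gaussian]
    simp only [of_apply, Fin.lastCases_last, h0, Finset.prod_const, Finset.card_univ,
      Fintype.card_fin, Fin.val_last, Fin.val_zero, add_zero]
    rw [neg_pow (1 / (2 * b))]
    have : ((-1 : ℝ) ^ n) * (-1) ^ n = 1 := by rw [← mul_pow]; simp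
    linear_combination (√(Real.pi / b) * (1 / (2 * b)) ^ n *
          ((vandermonde y).det * ∏ i, Real.exp (-b * y i ^ 2))) * this
  · intro k _
    have : ∫ t, g k.succ t = 0 := gaussianPoly.integral_succ hb k
    simp [this]

section Recursion

open Matrix

/-- The integral of `|Δ(v)| * exp (-b * ‖v‖ ^ 2)` over `ℝⁿ`, with `Δ` the Vandermonde product. -/
noncomputable def mehtaIntegral (b : ℝ) (n : ℕ) : ℝ :=
  ∫ v : Fin n → ℝ, |(vandermonde v).det| * ∏ i, Real.exp (-b * v i ^ 2)

theorem integrable_abs_det_vandermonde_mul_exp {b : ℝ} (hb : 0 < b) (n : ℕ) :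
    Integrable fun v : Fin n → ℝ => |(vandermonde v).det| * ∏ i, Real.exp (-b * v i ^ 2) := by
  convert (integrable_det_vandermonde_mul_exp hb n).abs using 2 with v
  rw [abs_mul, abs_of_pos (Finset.prod_pos fun i _ => Real.exp_pos _)]

/-- The point of `Fin (n + 1 + n) → ℝ` whose entries of even index and of odd index are the given
vectors. -/
noncomputable def interlace (n : ℕ) :
    (Fin (n + 1) → ℝ) × (Fin n → ℝ) ≃ᵐ (Fin (n + 1 + n) → ℝ) :=
  (MeasurableEquiv.sumPiEquivProdPi (fun _ : Fin (n + 1) ⊕ Fin n => ℝ)).symm.trans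
    (MeasurableEquiv.piCongrLeft (fun _ : Fin (n + 1 + n) => ℝ) (interlaceEquiv n))

theorem measurePreserving_interlace (n : ℕ) : MeasurePreserving (interlace n) :=
  (volume_measurePreserving_sumPiEquivProdPi_symm (fun _ : Fin (n + 1) ⊕ Fin n => ℝ)).trans
    (volume_measurePreserving_piCongrLeft (fun _ : Fin (n + 1 + n) => ℝ) (interlaceEquiv n))

theorem interlace_apply {n : ℕ} (p : (Fin (n + 1) → ℝ) × (Fin n → ℝ)) :
    interlace n p = Sum.elim p.1 p.2 ∘ (interlaceEquiv n).symm := by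
  funext k
  obtain ⟨r, rfl⟩ := (interlaceEquiv n).surjective k
  rw [interlace, MeasurableEquiv.trans_apply, MeasurableEquiv.coe_piCongrLeft,
    Equiv.piCongrLeft_apply_apply]
  rcases r with i | j <;> simp [MeasurableEquiv.sumPiEquivProdPi]

/-- The integrand of `mehtaIntegral b (n + 1) * mehtaIntegral b n`, as a function of the
interlaced variables. -/
noncomputable def interlacedIntegrand (b : ℝ) (n : ℕ) (z : Fin (n + 1 + n) → ℝ) : ℝ :=
  |(vandermonde (z ∘ interlaceEquiv n ∘ Sum.inl)).det
    * (vandermonde (z ∘ interlaceEquiv n ∘ Sum.inr)).det| * ∏ k, Real.exp (-b * z k ^ 2)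

theorem interlacedIntegrand_interlace (b : ℝ) {n : ℕ}
    (p : (Fin (n + 1) → ℝ) × (Fin n → ℝ)) :
    interlacedIntegrand b n (interlace n p)
      = (|(vandermonde p.1).det| * ∏ i, Real.exp (-b * p.1 i ^ 2)) *
        (|(vandermonde p.2).det| * ∏ i, Real.exp (-b * p.2 i ^ 2)) := by
  rw [interlacedIntegrand, interlace_apply, ← Equiv.prod_comp (interlaceEquiv n),
    Fintype.prod_sum_type]
  have h1 : (Sum.elim p.1 p.2 ∘ (interlaceEquiv n).symm) ∘ interlaceEquiv n ∘ Sum.inl = p.1 := by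
    ext i; simp
  have h2 : (Sum.elim p.1 p.2 ∘ (interlaceEquiv n).symm) ∘ interlaceEquiv n ∘ Sum.inr = p.2 := by
    ext i; simp
  rw [h1, h2, abs_mul]
  simp only [Function.comp_apply, Equiv.symm_apply_apply, Sum.elim_inl, Sum.elim_inr]
  ring

theorem integrable_interlacedIntegrand {b : ℝ} (hb : 0 < b) (n : ℕ) :
    Integrable (interlacedIntegrand b n) := by
  rw [← (measurePreserving_interlace n).integrable_comp_emb
    (interlace n).measurableEmbedding]
  exact ((integrable_abs_det_vandermonde_mul_exp hb (n + 1)).mul_prod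
    (integrable_abs_det_vandermonde_mul_exp hb n)).congr
    (Filter.Eventually.of_forall fun p => (interlacedIntegrand_interlace b p).symm)

theorem integral_interlacedIntegrand (b : ℝ) (n : ℕ) :
    ∫ z, interlacedIntegrand b n z = mehtaIntegral b (n + 1) * mehtaIntegral b n := by
  rw [← (measurePreserving_interlace n).integral_comp (interlace n).measurableEmbedding]
  simp only [interlacedIntegrand_interlace]
  exact integral_prod_mul
    (fun x : Fin (n + 1) → ℝ => |(vandermonde x).det| * ∏ i, Real.exp (-b * x i ^ 2))
    (fun y : Fin n → ℝ => |(vandermonde y).det| * ∏ i, Real.exp (-b * y i ^ 2))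

theorem setIntegral_interlacedIntegrand {b : ℝ} (hb : 0 < b) (n : ℕ) :
    ∫ z in {z | StrictMono z}, interlacedIntegrand b n z
      = √(Real.pi / b) * (1 / (2 * b)) ^ n * ∫ y in {y : Fin n → ℝ | StrictMono y},
          (vandermonde y).det ^ 2 * ∏ i, Real.exp (-(2 * b) * y i ^ 2) := by
  have hmeas := measurableSet_strictMono (n + 1 + n)
  rw [← integral_indicator hmeas,
    ← (measurePreserving_interlace n).integral_comp (interlace n).measurableEmbedding]
  have hInt : Integrable fun p => {z | StrictMono z}.indicator (interlacedIntegrand b n)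
      (interlace n p) :=
    (measurePreserving_interlace n).integrable_comp_of_integrable
      ((integrable_interlacedIntegrand hb n).indicator hmeas)
  rw [Measure.volume_eq_prod] at hInt ⊢
  rw [integral_prod_symm _ hInt, ← integral_const_mul,
    ← integral_indicator (measurableSet_strictMono n)]
  refine integral_congr_ae (Filter.Eventually.of_forall fun y => ?_)
  have hind : ∀ x : Fin (n + 1) → ℝ,
      {z | StrictMono z}.indicator (interlacedIntegrand b n) (interlace n (x, y))
      = {y | StrictMono y}.indicator (fun y : Fin n → ℝ =>
          {x : Fin (n + 1) → ℝ | ∀ i, x i ∈ interlacingGap y i}.indicator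
          (fun x => ((vandermonde x).det * ∏ i, Real.exp (-b * x i ^ 2))
            * ((vandermonde y).det * ∏ i, Real.exp (-b * y i ^ 2))) x) y := by
    intro x
    have hiff := strictMono_interlace_iff x y
    have hz : interlace n (x, y) = Sum.elim x y ∘ (interlaceEquiv n).symm :=
      interlace_apply (x, y)
    by_cases hy : StrictMono y
    · by_cases hx : ∀ i, x i ∈ interlacingGap y i
      · have hxy := hiff.2 ⟨hy, hx⟩
        have hxm : Monotone x := by
          have h1 : x = (Sum.elim x y ∘ (interlaceEquiv n).symm) ∘ interlaceEquiv n ∘ Sum.inl := by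
            ext i; simp
          rw [h1]
          refine hxy.monotone.comp fun i j hij => ?_
          have : (i : ℕ) ≤ j := hij
          simp only [Function.comp_apply, Fin.le_def, interlaceEquiv_inl]
          omega
        rw [Set.indicator_of_mem (by rw [Set.mem_ofPred_eq, hz]; exact hxy),
          Set.indicator_of_mem (by exact hy), Set.indicator_of_mem (by exact hx),
          interlacedIntegrand_interlace, abs_of_nonneg (det_vandermonde_nonneg hxm),
          abs_of_nonneg (det_vandermonde_nonneg hy.monotone)]
      · rw [Set.indicator_of_notMem (by
          rw [Set.mem_ofPred_eq, hz]; exact fun h => hx (hiff.1 h).2),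
          Set.indicator_of_mem (by exact hy), Set.indicator_of_notMem (by exact hx)]
    · rw [Set.indicator_of_notMem (by
        rw [Set.mem_ofPred_eq, hz]; exact fun h => hy (hiff.1 h).1),
        Set.indicator_of_notMem (by exact hy)]
  simp only [hind]
  by_cases hy : StrictMono y
  · simp only [Set.indicator_of_mem (show y ∈ {y : Fin n → ℝ | StrictMono y} from hy)]
    rw [integral_indicator (by
      rw [Set.ofPred_forall]
      exact MeasurableSet.iInter fun i =>
        measurable_pi_apply i (measurableSet_interlacingGap y i)),
      integral_mul_const, integral_interlacing hy hb]
    have : ∏ i, Real.exp (-(2 * b) * y i ^ 2)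
        = (∏ i, Real.exp (-b * y i ^ 2)) * ∏ i, Real.exp (-b * y i ^ 2) := by
      rw [← Finset.prod_mul_distrib]
      refine Finset.prod_congr rfl fun i _ => ?_
      rw [← Real.exp_add]
      ring_nf
    rw [this]
    ring
  · simp [Set.indicator_of_notMem (show y ∉ {y : Fin n → ℝ | StrictMono y} from hy)]

theorem det_vandermonde_comp_perm_sq {n : ℕ} (v : Fin n → ℝ) (σ : Equiv.Perm (Fin n)) :
    (vandermonde (v ∘ σ)).det ^ 2 = (vandermonde v).det ^ 2 := by
  rw [det_vandermonde_comp_perm, mul_pow]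
  rcases Int.units_eq_one_or (Equiv.Perm.sign σ) with h | h <;> simp [h]

theorem mehtaIntegral_succ_mul {b : ℝ} (hb : 0 < b) (n : ℕ) :
    mehtaIntegral b (n + 1) * mehtaIntegral b n
      = (n + 1).factorial * n.factorial * √(Real.pi / b) * (1 / b) ^ n *
        ∏ k ∈ Finset.range n, ((1 / (4 * b)) ^ k * (k.factorial * √(Real.pi / (2 * b)))) := by
  have hbb : 0 < 2 * b := by positivity
  obtain ⟨hInt, hval⟩ := integrable_and_integral_det_vandermonde_sq_mul_exp hbb n
  have hsq : ∫ y : Fin n → ℝ, (vandermonde y).det ^ 2 * ∏ i, Real.exp (-(2 * b) * y i ^ 2)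
      = n.factorial * ∫ y in {y : Fin n → ℝ | StrictMono y},
          (vandermonde y).det ^ 2 * ∏ i, Real.exp (-(2 * b) * y i ^ 2) := by
    rw [integral_eq_setIntegral_strictMono_sum_perm hInt, ← integral_const_mul]
    refine setIntegral_congr_fun (measurableSet_strictMono n) fun y _ => ?_
    have : ∀ σ : Equiv.Perm (Fin n), ∏ i, Real.exp (-(2 * b) * (y ∘ σ) i ^ 2)
        = ∏ i, Real.exp (-(2 * b) * y i ^ 2) := fun σ =>
      Equiv.prod_comp σ fun i => Real.exp (-(2 * b) * y i ^ 2)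
    simp only [det_vandermonde_comp_perm_sq, this, Finset.sum_const, Finset.card_univ,
      Fintype.card_perm, Fintype.card_fin, nsmul_eq_mul]
  have hprod : ∫ z, interlacedIntegrand b n z
      = ((n + 1).factorial * n.factorial * 2 ^ n : ℝ) *
        ∫ z in {z | StrictMono z}, interlacedIntegrand b n z := by
    rw [integral_eq_setIntegral_strictMono_sum_perm (integrable_interlacedIntegrand hb n),
      ← integral_const_mul]
    refine setIntegral_congr_fun (measurableSet_strictMono _) fun z hz => ?_
    have : ∀ σ : Equiv.Perm (Fin (n + 1 + n)), ∏ i, Real.exp (-b * (z ∘ σ) i ^ 2)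
        = ∏ i, Real.exp (-b * z i ^ 2) := fun σ =>
      Equiv.prod_comp σ fun i => Real.exp (-b * z i ^ 2)
    simp only [interlacedIntegrand, this, Function.comp_assoc, ← Finset.sum_mul]
    rw [sum_perm_abs_det_vandermonde_of_strictMono hz]
    ring
  rw [← integral_interlacedIntegrand, hprod, setIntegral_interlacedIntegrand hb]
  rw [hval] at hsq
  have hfac : (n.factorial : ℝ) ≠ 0 := by positivity
  rw [← mul_left_cancel₀ hfac hsq, show 2 * (2 * b) = 4 * b by ring,
    show 1 / b = 2 * (1 / (2 * b)) by field_simp, mul_pow]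
  ring

end Recursion

theorem mehtaIntegral_zero (b : ℝ) : mehtaIntegral b 0 = 1 := by
  simp [mehtaIntegral, measureReal_def, volume_pi]

theorem mehtaIntegral_one_eq (n : ℕ) :
    mehtaIntegral 1 n
      = (2 : ℝ) ^ (-((n : ℝ) * ((n : ℝ) - 5)) / 4) *
        ∏ j ∈ Finset.Icc 1 n, Real.Gamma ((j : ℝ) / 2 + 1) := by
  have hpos : ∀ n : ℕ, 0 < (2 : ℝ) ^ (-((n : ℝ) * ((n : ℝ) - 5)) / 4) *
      ∏ j ∈ Finset.Icc 1 n, Real.Gamma ((j : ℝ) / 2 + 1) := fun n =>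
    mul_pos (by positivity) (Finset.prod_pos fun j _ => Real.Gamma_pos_of_pos (by positivity))
  set R : ℕ → ℝ := fun n => (2 : ℝ) ^ (-((n : ℝ) * ((n : ℝ) - 5)) / 4) *
      ∏ j ∈ Finset.Icc 1 n, Real.Gamma ((j : ℝ) / 2 + 1) with hR
  have hR0 : R 0 = 1 := by simp [hR]
  have hRstep : ∀ n : ℕ, R (n + 1) = R n * ((2 : ℝ) ^ ((2 - (n : ℝ)) / 2) *
      Real.Gamma (((n : ℝ) + 1) / 2 + 1)) := by
    intro n
    simp only [hR]
    rw [Finset.prod_Icc_succ_top (by omega)]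
    have : -(((n + 1 : ℕ) : ℝ) * (((n + 1 : ℕ) : ℝ) - 5)) / 4
        = -((n : ℝ) * ((n : ℝ) - 5)) / 4 + (2 - (n : ℝ)) / 2 := by
      push_cast; ring
    rw [this, Real.rpow_add two_pos]
    push_cast
    ring
  have hRmul : ∀ n : ℕ, R (n + 1) * R n = (n + 1).factorial * n.factorial * √Real.pi *
      ∏ k ∈ Finset.range n, ((1 / 4 : ℝ) ^ k * (k.factorial * √(Real.pi / 2))) := by
    intro n
    induction n with
    | zero =>
      rw [hRstep 0, hR0]
      have : Real.Gamma (2⁻¹ + 1) = 2⁻¹ * √Real.pi := by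
        rw [← one_div, Real.Gamma_add_one (by norm_num), Real.Gamma_one_half_eq]
      simp [this]
    | succ n ih =>
      have hdup := Real.Gamma_mul_Gamma_add_half (((n : ℝ) + 1) / 2 + 1)
      have h1 : 2 * (((n : ℝ) + 1) / 2 + 1) = ((n + 2 : ℕ) : ℝ) + 1 := by push_cast; ring
      rw [h1, Real.Gamma_nat_eq_factorial] at hdup
      have h2 : ((n : ℝ) + 1) / 2 + 1 + 1 / 2 = (((n + 1 : ℕ) : ℝ) + 1) / 2 + 1 := by
        push_cast; ring
      rw [h2] at hdup
      have hpow : (2 : ℝ) ^ ((2 - (n : ℝ)) / 2) * (2 : ℝ) ^ ((2 - ((n + 1 : ℕ) : ℝ)) / 2) *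
          (2 : ℝ) ^ (1 - (((n + 2 : ℕ) : ℝ) + 1)) = (1 / 4) ^ n * (√2)⁻¹ := by
        have h4 : (1 / 4 : ℝ) ^ n = (2 : ℝ) ^ (-(2 * n) : ℝ) := by
          rw [Real.rpow_neg two_pos.le, Real.rpow_mul two_pos.le, Real.rpow_natCast, one_div,
            inv_pow]
          norm_num
        rw [h4, Real.sqrt_eq_rpow, ← Real.rpow_neg two_pos.le, ← Real.rpow_add two_pos,
          ← Real.rpow_add two_pos, ← Real.rpow_add two_pos]
        congr 1
        push_cast
        ring
      have hsqrt : √(Real.pi / 2) = √Real.pi * (√2)⁻¹ := by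
        rw [Real.sqrt_div Real.pi_pos.le, div_eq_mul_inv]
      rw [Finset.prod_range_succ, hRstep (n + 1)]
      rw [hRstep n] at ih ⊢
      have hfac : ((n + 1 + 1).factorial : ℝ) * (n + 1).factorial
          = ((n + 2).factorial) * ((n + 1).factorial) := rfl
      rw [hfac, hsqrt]
      rw [hsqrt] at ih
      set G1 := Real.Gamma (((n : ℝ) + 1) / 2 + 1)
      set G2 := Real.Gamma ((((n + 1 : ℕ) : ℝ) + 1) / 2 + 1)
      set A := (2 : ℝ) ^ ((2 - (n : ℝ)) / 2)
      set B := (2 : ℝ) ^ ((2 - ((n + 1 : ℕ) : ℝ)) / 2)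
      set C := (2 : ℝ) ^ (1 - (((n + 2 : ℕ) : ℝ) + 1))
      set Q := ∏ k ∈ Finset.range n, ((1 / 4 : ℝ) ^ k * (k.factorial * (√Real.pi * (√2)⁻¹)))
      calc R n * (A * G1) * (B * G2) * (R n * (A * G1))
          = (R n * (A * G1) * R n) * (A * B * (G1 * G2)) := by ring
        _ = ((n + 1).factorial * n.factorial * √Real.pi * Q) *
            (A * B * ((n + 2).factorial * C * √Real.pi)) := by rw [ih, hdup]
        _ = ((n + 1).factorial * n.factorial * √Real.pi * Q) *
            ((A * B * C) * (n + 2).factorial * √Real.pi) := by ring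
        _ = _ := by rw [hpow]; ring
  have hmul := fun n => mehtaIntegral_succ_mul one_pos n
  simp only [mul_one, div_one, one_pow] at hmul
  change mehtaIntegral 1 n = R n
  induction n with
  | zero => rw [mehtaIntegral_zero, hR0]
  | succ n ih =>
    refine mul_right_cancel₀ (hpos n).ne' ?_
    change _ * R n = _ * R n
    rw [hRmul, ← hmul n, ih]

/-- The Mehta-type Selberg integral for β = 1 (Eq. (C.7) of the paper). -/
theorem mehta_integral_beta_one (n : ℕ) (hn : 1 ≤ n) :
    ∫ E : Fin n → ℝ,
        Real.exp (-∑ j : Fin n, E j ^ 2) *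
          ∏ a : Fin n, ∏ b ∈ Finset.Ioi a, |E a - E b|
      = (2 : ℝ) ^ (-((n : ℝ) * ((n : ℝ) - 5)) / 4) *
        ∏ j ∈ Finset.Icc 1 n, Real.Gamma ((j : ℝ) / 2 + 1) := by
  rw [← mehtaIntegral_one_eq, mehtaIntegral]
  refine integral_congr_ae (Filter.Eventually.of_forall fun E => ?_)
  simp only [Matrix.det_vandermonde, Finset.abs_prod, abs_sub_comm, neg_mul, one_mul,
    ← Real.exp_sum, Finset.sum_neg_distrib]
  rw [mul_comm]
end

section
/- For every n ≥ 1, ∫_{ℝ^n} exp(−∑_{j=1}^{n} E_j²) · (∏_{1≤a<b≤n} (E_a − E_b))² dE = 2^{−n(n−1)/2} · π^{n/2} · ∏_{j=1}^{n} Γ(j + 1). -/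
open Finset MeasureTheory

open Polynomial in
/-- The monic Hermite polynomials orthogonal with respect to the weight `exp (-x ^ 2)`. -/
noncomputable def monicHermite : ℕ → ℝ[X]
  | 0 => 1
  | k + 1 => X * monicHermite k - C (1 / 2) * derivative (monicHermite k)

namespace monicHermite

open Polynomial

theorem monic_and_natDegree (k : ℕ) :
    (monicHermite k).Monic ∧ (monicHermite k).natDegree = k := by
  induction k with
  | zero => simp [monicHermite]
  | succ k ih =>
    obtain ⟨hm, hd⟩ := ih
    have hX : (X * monicHermite k).Monic := monic_X.mul hm
    have hXd : (X * monicHermite k).natDegree = k + 1 := by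
      rw [monic_X.natDegree_mul hm, hd, natDegree_X, add_comm]
    have hlt : (C (1 / 2 : ℝ) * derivative (monicHermite k)).degree
        < (X * monicHermite k).degree := by
      rw [degree_eq_natDegree hX.ne_zero, hXd]
      refine lt_of_le_of_lt degree_le_natDegree ?_
      have h₁ := natDegree_C_mul_le (1 / 2 : ℝ) (derivative (monicHermite k))
      have h₂ := natDegree_derivative_le (monicHermite k)
      exact_mod_cast (by omega :
        (C (1 / 2 : ℝ) * derivative (monicHermite k)).natDegree < k + 1)
    refine ⟨hX.sub_of_left hlt, ?_⟩
    rw [monicHermite, natDegree_eq_of_degree_eq (degree_sub_eq_left_of_degree_lt hlt), hXd]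

theorem monic (k : ℕ) : (monicHermite k).Monic := (monic_and_natDegree k).1

theorem natDegree_eq (k : ℕ) : (monicHermite k).natDegree = k := (monic_and_natDegree k).2

end monicHermite

namespace Polynomial

theorem integrable_eval_mul_exp_neg_sq (p : ℝ[X]) :
    Integrable fun x : ℝ => p.eval x * Real.exp (-x ^ 2) := by
  induction p using Polynomial.induction_on' with
  | add p q hp hq =>
    simp only [eval_add, add_mul]
    exact hp.add hq
  | monomial k a =>
    have h := (integrable_rpow_mul_exp_neg_mul_sq (b := 1) one_pos (s := k)
      (by have := k.cast_nonneg (α := ℝ); linarith)).const_mul a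
    simpa [mul_assoc] using h

theorem Monic.iterate_derivative_natDegree {R : Type*} [Semiring R] {p : R[X]} (hp : p.Monic) :
    derivative^[p.natDegree] p = C (p.natDegree.factorial : R) := by
  have h : (derivative^[p.natDegree] p).natDegree = 0 := by
    have := natDegree_iterate_derivative p p.natDegree
    omega
  rw [eq_C_of_natDegree_eq_zero h, coeff_iterate_derivative]
  simp [hp.coeff_natDegree, Nat.descFactorial_self]

theorem integral_mul_monicHermite_succ (q : ℝ[X]) (k : ℕ) :
    ∫ x : ℝ, q.eval x * ((monicHermite (k + 1)).eval x * Real.exp (-x ^ 2)) =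
      1 / 2 * ∫ x : ℝ, (derivative q).eval x * ((monicHermite k).eval x * Real.exp (-x ^ 2)) := by
  have hint (r s : ℝ[X]) :
      Integrable fun x : ℝ => r.eval x * (s.eval x * Real.exp (-x ^ 2)) := by
    simpa only [eval_mul, mul_assoc] using (r * s).integrable_eval_mul_exp_neg_sq
  have hv (x : ℝ) : HasDerivAt (fun y => (monicHermite k).eval y * Real.exp (-y ^ 2))
      (-2 * ((monicHermite (k + 1)).eval x * Real.exp (-x ^ 2))) x := by
    refine (((monicHermite k).hasDerivAt x).mul ((hasDerivAt_pow 2 x).neg.exp)).congr_deriv ?_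
    simp [monicHermite]
    ring
  have h := integral_mul_deriv_eq_deriv_mul_of_integrable
    (fun x _ => q.hasDerivAt x) (fun x _ => hv x)
    (by
      convert (hint q (monicHermite (k + 1))).const_mul (-2) using 1
      ext x
      simp only [Pi.mul_apply]
      ring)
    (hint _ _) (hint _ _)
  have h' : ∫ x : ℝ, q.eval x * (-2 * ((monicHermite (k + 1)).eval x * Real.exp (-x ^ 2))) =
      -2 * ∫ x : ℝ, q.eval x * ((monicHermite (k + 1)).eval x * Real.exp (-x ^ 2)) := by
    rw [← integral_const_mul]
    congr with x
    ring
  linarith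

theorem integral_mul_monicHermite (q : ℝ[X]) (k : ℕ) :
    ∫ x : ℝ, q.eval x * ((monicHermite k).eval x * Real.exp (-x ^ 2)) =
      (1 / 2) ^ k * ∫ x : ℝ, (derivative^[k] q).eval x * Real.exp (-x ^ 2) := by
  induction k generalizing q with
  | zero => simp [monicHermite]
  | succ k ih =>
    rw [integral_mul_monicHermite_succ, ih, Function.iterate_succ_apply]
    ring

end Polynomial

namespace monicHermite

open Polynomial

theorem integral_mul_of_lt {m k : ℕ} (h : m < k) :
    ∫ x : ℝ, (monicHermite m).eval x * ((monicHermite k).eval x * Real.exp (-x ^ 2)) = 0 := by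
  rw [integral_mul_monicHermite, iterate_derivative_eq_zero (by rwa [natDegree_eq])]
  simp

theorem integral_mul_self (k : ℕ) :
    ∫ x : ℝ, (monicHermite k).eval x * ((monicHermite k).eval x * Real.exp (-x ^ 2)) =
      (1 / 2) ^ k * (k.factorial * √Real.pi) := by
  have h := (monic k).iterate_derivative_natDegree
  rw [natDegree_eq] at h
  have hg := integral_gaussian 1
  simp only [neg_mul, one_mul, div_one] at hg
  simp only [integral_mul_monicHermite, h, eval_C, integral_const_mul, hg]

theorem integral_mul (m k : ℕ) :
    ∫ x : ℝ, (monicHermite m).eval x * ((monicHermite k).eval x * Real.exp (-x ^ 2)) =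
      if m = k then (1 / 2) ^ k * (k.factorial * √Real.pi) else 0 := by
  split_ifs with h
  · rw [h, integral_mul_self]
  · rcases lt_or_gt_of_ne h with h | h
    · exact integral_mul_of_lt h
    · rw [← integral_mul_of_lt h]
      congr with x
      ring

end monicHermite

/-- **Andréief's identity**. -/
theorem integral_det_mul_det {ι α : Type*} [Fintype ι] [DecidableEq ι] [MeasurableSpace α]
    (μ : Measure α) [SigmaFinite μ] (f g : ι → α → ℝ)
    (hfg : ∀ i j, Integrable (fun x => f i x * g j x) μ) :
    ∫ x : ι → α, (Matrix.of fun i j => f j (x i)).det * (Matrix.of fun i j => g j (x i)).det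
        ∂Measure.pi (fun _ => μ) =
      (Fintype.card ι).factorial * (Matrix.of fun i j => ∫ x, f i x * g j x ∂μ).det := by
  have hexp (x : ι → α) :
      (Matrix.of fun i j => f j (x i)).det * (Matrix.of fun i j => g j (x i)).det =
        ∑ τ : Equiv.Perm ι, ∑ σ : Equiv.Perm ι,
          ((Equiv.Perm.sign σ : ℤ) * (Equiv.Perm.sign τ : ℤ) : ℝ) *
            ∏ i, (f (σ i) (x i) * g (τ i) (x i)) := by
    rw [← Matrix.det_transpose, ← Matrix.det_transpose (Matrix.of fun i j => g j (x i)),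
      Matrix.det_apply', Matrix.det_apply', sum_mul_sum, sum_comm]
    refine sum_congr rfl fun τ _ => sum_congr rfl fun σ _ => ?_
    simp only [Matrix.transpose_apply, Matrix.of_apply, prod_mul_distrib]
    ring
  have hint (σ τ : Equiv.Perm ι) :
      Integrable (fun x : ι → α => ∏ i, (f (σ i) (x i) * g (τ i) (x i)))
        (Measure.pi fun _ => μ) :=
    Integrable.fintype_prod (f := fun i y => f (σ i) y * g (τ i) y) fun i => hfg _ _
  simp_rw [hexp]
  rw [integral_finsetSum _ fun τ _ => integrable_finsetSum _ fun σ _ => (hint σ τ).const_mul _]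
  have hperm (τ : Equiv.Perm ι) :
      ∫ x : ι → α, ∑ σ : Equiv.Perm ι, ((Equiv.Perm.sign σ : ℤ) * (Equiv.Perm.sign τ : ℤ) : ℝ) *
          ∏ i, (f (σ i) (x i) * g (τ i) (x i)) ∂Measure.pi (fun _ => μ) =
        (Matrix.of fun i j => ∫ x, f i x * g j x ∂μ).det := by
    rw [integral_finsetSum _ fun σ _ => (hint σ τ).const_mul _, Matrix.det_apply',
      ← Equiv.sum_comp (Equiv.mulRight τ)]
    refine sum_congr rfl fun σ _ => ?_
    simp only [Matrix.of_apply, Equiv.coe_mulRight]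
    rw [integral_const_mul,
      integral_fintype_prod_eq_prod (fun i y => f ((σ * τ) i) y * g (τ i) y),
      ← Equiv.prod_comp τ (fun i => ∫ x, f (σ i) x * g i x ∂μ)]
    rcases Int.units_eq_one_or (Equiv.Perm.sign τ) with h | h <;> simp [h]
  simp [hperm, Fintype.card_perm]

theorem exp_mul_vandermonde_sq_eq_det_mul_det {n : ℕ} (E : Fin n → ℝ) :
    Real.exp (-∑ j, E j ^ 2) * (∏ a, ∏ b ∈ Ioi a, (E a - E b)) ^ 2 =
      (Matrix.of fun i j : Fin n => (monicHermite j).eval (E i)).det *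
        (Matrix.of fun i j : Fin n =>
          (monicHermite j).eval (E i) * Real.exp (-E i ^ 2)).det := by
  have hV : (∏ a, ∏ b ∈ Ioi a, (E a - E b)) ^ 2 =
      (Matrix.of fun i j : Fin n => (monicHermite j).eval (E i)).det ^ 2 := by
    rw [← Matrix.det_eval_matrixOfPolynomials_eq_det_vandermonde E (fun j => monicHermite j)
      (fun j => monicHermite.natDegree_eq j) (fun j => monicHermite.monic j),
      Matrix.det_vandermonde]
    simp only [← prod_pow]
    exact prod_congr rfl fun a _ => prod_congr rfl fun b _ => by ring
  have hW := Matrix.det_mul_column (fun i => Real.exp (-E i ^ 2))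
    (Matrix.of fun i j : Fin n => (monicHermite j).eval (E i))
  simp only [Matrix.of_apply, mul_comm (Real.exp _)] at hW
  rw [hW, hV, ← Real.exp_sum, ← sum_neg_distrib]
  ring

theorem prod_half_pow_mul_factorial (n : ℕ) :
    (n.factorial : ℝ) * ∏ j ∈ range n, ((1 / 2) ^ j * (j.factorial * √Real.pi)) =
      (2 : ℝ) ^ (-((n : ℝ) * ((n : ℝ) - 1)) / 2) * Real.pi ^ ((n : ℝ) / 2) *
        ∏ j ∈ Icc 1 n, Real.Gamma ((j : ℝ) + 1) := by
  induction n with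
  | zero => simp
  | succ n ih =>
    rw [prod_range_succ, prod_Icc_succ_top (by omega), Real.Gamma_nat_eq_factorial]
    have h2 : (2 : ℝ) ^ (-(((n + 1 : ℕ) : ℝ) * (((n + 1 : ℕ) : ℝ) - 1)) / 2) =
        2 ^ (-((n : ℝ) * ((n : ℝ) - 1)) / 2) * (1 / 2) ^ n := by
      rw [one_div, inv_pow, ← Real.rpow_natCast, ← Real.rpow_neg two_pos.le,
        ← Real.rpow_add two_pos]
      congr 1
      push_cast
      ring
    have hpi : Real.pi ^ (((n + 1 : ℕ) : ℝ) / 2) = Real.pi ^ ((n : ℝ) / 2) * √Real.pi := by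
      rw [Real.sqrt_eq_rpow, ← Real.rpow_add Real.pi_pos]
      congr 1
      push_cast
      ring
    rw [h2, hpi]
    linear_combination ((1 / 2) ^ n * √Real.pi * (n + 1).factorial : ℝ) * ih

/-- The Mehta-type Selberg integral for β = 2 (Eq. (C.7) of the paper). -/
theorem mehta_integral_beta_two (n : ℕ) (hn : 1 ≤ n) :
    ∫ E : Fin n → ℝ,
        Real.exp (-∑ j : Fin n, E j ^ 2) *
          (∏ a : Fin n, ∏ b ∈ Finset.Ioi a, (E a - E b)) ^ 2
      = (2 : ℝ) ^ (-((n : ℝ) * ((n : ℝ) - 1)) / 2) * Real.pi ^ ((n : ℝ) / 2) *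
        ∏ j ∈ Finset.Icc 1 n, Real.Gamma ((j : ℝ) + 1) := by
  have hint (i j : Fin n) : Integrable fun x : ℝ =>
      (monicHermite i).eval x * ((monicHermite j).eval x * Real.exp (-x ^ 2)) := by
    simpa only [Polynomial.eval_mul, mul_assoc] using
      (monicHermite i * monicHermite j).integrable_eval_mul_exp_neg_sq
  have hdiag : (Matrix.of fun i j : Fin n => ∫ x : ℝ,
      (monicHermite i).eval x * ((monicHermite j).eval x * Real.exp (-x ^ 2))) =
      Matrix.diagonal fun j : Fin n =>
        (1 / 2 : ℝ) ^ (j : ℕ) * ((j : ℕ).factorial * √Real.pi) := by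
    ext i j
    rw [Matrix.of_apply, monicHermite.integral_mul, Matrix.diagonal_apply]
    by_cases h : i = j
    · simp [h]
    · simp [h, Fin.val_inj]
  simp only [exp_mul_vandermonde_sq_eq_det_mul_det]
  rw [volume_pi, integral_det_mul_det volume (fun j : Fin n => fun x => (monicHermite j).eval x)
    (fun j x => (monicHermite j).eval x * Real.exp (-x ^ 2)) hint, hdiag, Matrix.det_diagonal,
    Fintype.card_fin, ← prod_half_pow_mul_factorial,
    Fin.prod_univ_eq_prod_range (fun j => (1 / 2 : ℝ) ^ j * (j.factorial * √Real.pi))]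
end
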